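/- Let F ∈ ℤ[t] be an irreducible polynomial of degree g ≥ 2, and let 0 < δ < 1 and C > 0 be real constants. There exist constants D ≥ 2, y₀ and c > 0, depending only on F, δ and C, such that for all reals x, y, z with y ≥ y₀, y < z ≤ x^{1−δ/2} and, writing η = log(z/y), (log y)^{−C} ≤ η ≤ log y: H_F(x, y, z) − H_F(x/2, y, z) ≥ c · η(1+η) · (x/(log y)²) · ∑_{a ∈ 𝒫(max(D, z/y), z)} (2τ(a) − W(a; η)) ρ(a)/a. -/

import Mathlib

open Real MeasureTheory
open scoped Classical

/-- number of residues n mod d with F(n) ≡ 0 (mod d) -/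
noncomputable def polyRho (F : Polynomial ℤ) (d : ℕ) : ℕ :=
  ((Finset.range d).filter (fun n => (d : ℤ) ∣ F.eval (n : ℤ))).card

/-- H_F(x,y,z): number of positive n ≤ x with F(n) having a divisor in (y,z] -/
noncomputable def polyH (F : Polynomial ℤ) (x y z : ℝ) : ℕ :=
  {n : ℕ | 0 < n ∧ (n : ℝ) ≤ x ∧
    ∃ d : ℕ, 0 < d ∧ (d : ℤ) ∣ F.eval (n : ℤ) ∧ y < (d : ℝ) ∧ (d : ℝ) ≤ z}.ncard

/-- H(x,y,z): number of positive n ≤ x having a divisor in (y,z] -/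
noncomputable def Hdiv (x y z : ℝ) : ℕ :=
  {n : ℕ | 0 < n ∧ (n : ℝ) ≤ x ∧
    ∃ d : ℕ, 0 < d ∧ d ∣ n ∧ y < (d : ℝ) ∧ (d : ℝ) ≤ z}.ncard

/-- L(a;σ) -/
noncomputable def Lfun (a : ℕ) (σ : ℝ) : ℝ :=
  (volume {x : ℝ | ∃ d : ℕ, d ∣ a ∧ Real.exp x < (d : ℝ) ∧ (d : ℝ) ≤ Real.exp (x + σ)}).toReal

/-- W(a;σ): ordered pairs of divisors near each other -/
noncomputable def Wfun (a : ℕ) (σ : ℝ) : ℕ :=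
  {p : ℕ × ℕ | p.1 ∣ a ∧ p.2 ∣ a ∧ |Real.log ((p.1 : ℝ) / (p.2 : ℝ))| ≤ σ}.ncard

/-- 𝒫(s,t): squarefree integers with all prime factors in (s,t] -/
def Psf (s t : ℝ) : Set ℕ :=
  {a : ℕ | 0 < a ∧ Squarefree a ∧ ∀ p : ℕ, p.Prime → p ∣ a → s < (p : ℝ) ∧ (p : ℝ) ≤ t}

/-- φ_F(n) = n ∏_{p|n} (1 - ρ(p)/p) -/
noncomputable def polyPhi (F : Polynomial ℤ) (n : ℕ) : ℝ :=
  (n : ℝ) * ∏ p ∈ n.primeFactors, (1 - (polyRho F p : ℝ) / p)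

/-- P⁺(n): largest prime factor, P⁺(1)=0 -/
def Pplus (n : ℕ) : ℕ := n.primeFactors.sup id

/-- h(n;X): least prime q with ∏_{p^ν ∥ n, p ≤ q} p^ν > √X -/
noncomputable def hfun (n : ℕ) (X : ℝ) : ℕ :=
  sInf {q : ℕ | q.Prime ∧
    Real.sqrt X < ∏ p ∈ n.primeFactors.filter (fun p => p ≤ q), (p : ℝ) ^ (n.factorization p)}

/-- A monic integer polynomial of degree `m + 2` with its distinct complex roots, at which
integer polynomials of smaller degree do not vanish. -/
structure NormData (m : ℕ) where
  G : Polynomial ℤ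
  monic : G.Monic
  natDegree_eq : G.natDegree = m + 2
  θ : Fin (m + 2) → ℂ
  θ_inj : Function.Injective θ
  θ_root : ∀ j, Polynomial.eval₂ (Int.castRingHom ℂ) (θ j) G = 0
  nonvanish : ∀ A : Fin (m + 2) → ℤ, A ≠ 0 → ∀ j, ∑ i, (A i : ℂ) * θ j ^ (i : ℕ) ≠ 0

namespace NormData

variable {m : ℕ} (D : NormData m)

/-- The order `ℤ[X] / (G)`. -/
abbrev R : Type := AdjoinRoot D.G

/-- The power basis of the order. -/
noncomputable def bas : Module.Basis (Fin (m + 2)) ℤ D.R :=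
  (AdjoinRoot.powerBasisAux' D.monic).reindex (finCongr D.natDegree_eq)

/-- The generator of the order. -/
noncomputable def rt : D.R := AdjoinRoot.root D.G

lemma bas_apply (i : Fin (m + 2)) : D.bas i = D.rt ^ (i : ℕ) := by
  have := (AdjoinRoot.powerBasis' D.monic).basis_eq_pow ((finCongr D.natDegree_eq).symm i)
  simp only [bas, Module.Basis.reindex_apply]
  exact this

/-- The element with given coordinates. -/
noncomputable def elt (A : Fin (m + 2) → ℤ) : D.R := D.bas.equivFun.symm A

lemma elt_eq (A : Fin (m + 2) → ℤ) : D.elt A = ∑ i, A i • D.rt ^ (i : ℕ) := by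
  simp [elt, Module.Basis.equivFun_symm_apply, bas_apply]

/-- The value at an integer of the polynomial with given coefficients. -/
def ev (A : Fin (m + 2) → ℤ) (ν : ℤ) : ℤ := ∑ i, A i * ν ^ (i : ℕ)

/-- The matrix of multiplication by an element. -/
noncomputable def mat (x : D.R) : Matrix (Fin (m + 2)) (Fin (m + 2)) ℤ :=
  Algebra.leftMulMatrix D.bas x

/-- The norm form. -/
noncomputable def nrm (A : Fin (m + 2) → ℤ) : ℤ := (D.mat (D.elt A)).det

lemma mul_bas (x : D.R) (c : Fin (m + 2)) :
    x * D.bas c = ∑ r, D.mat x r c • D.bas r := by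
  simp only [mat, Algebra.leftMulMatrix_eq_repr_mul]
  exact (D.bas.sum_repr _).symm

lemma row_mul {S : Type*} [CommRing S] (φ : D.R →+* S) (x : D.R) (c : Fin (m + 2)) :
    ∑ r : Fin (m + 2), φ D.rt ^ (r : ℕ) * (D.mat x r c : S) = φ x * φ D.rt ^ (c : ℕ) := by
  have := congrArg φ (D.mul_bas x c)
  simp only [map_mul, bas_apply, map_pow, map_sum, zsmul_eq_mul, map_intCast] at this
  rw [this]
  exact Finset.sum_congr rfl fun _ _ => mul_comm _ _

lemma map_elt {S : Type*} [CommRing S] (φ : D.R →+* S) (A : Fin (m + 2) → ℤ) :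
    φ (D.elt A) = ∑ i, (A i : S) * φ D.rt ^ (i : ℕ) := by
  simp [elt_eq]

/-- The complex embeddings. -/
noncomputable def emb (j : Fin (m + 2)) : D.R →+* ℂ :=
  AdjoinRoot.lift (Int.castRingHom ℂ) (D.θ j) (D.θ_root j)

lemma emb_rt (j : Fin (m + 2)) : D.emb j D.rt = D.θ j := AdjoinRoot.lift_root _

/-- The conjugates of an element. -/
noncomputable def sg (j : Fin (m + 2)) (A : Fin (m + 2) → ℤ) : ℂ :=
  ∑ i, (A i : ℂ) * D.θ j ^ (i : ℕ)

lemma emb_elt (j : Fin (m + 2)) (A : Fin (m + 2) → ℤ) : D.emb j (D.elt A) = D.sg j A := by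
  rw [map_elt, emb_rt, sg]

lemma nrm_eq_prod (A : Fin (m + 2) → ℤ) : (D.nrm A : ℂ) = ∏ j, D.sg j A := by
  have h : Matrix.vandermonde D.θ * (D.mat (D.elt A)).map (Int.cast : ℤ → ℂ) =
      Matrix.diagonal (fun j => D.sg j A) * Matrix.vandermonde D.θ := by
    ext j c
    rw [Matrix.diagonal_mul, Matrix.mul_apply]
    simp only [Matrix.vandermonde_apply, Matrix.map_apply]
    have := D.row_mul (D.emb j) (D.elt A) c
    rwa [emb_rt, emb_elt] at this
  have h2 := congrArg Matrix.det h
  rw [Matrix.det_mul, Matrix.det_mul, Matrix.det_diagonal, mul_comm] at h2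
  have h3 := mul_right_cancel₀ (Matrix.det_vandermonde_ne_zero_iff.mpr D.θ_inj) h2
  rw [← h3, nrm]
  exact (Int.castRingHom ℂ).map_det _

lemma nrm_ne_zero {A : Fin (m + 2) → ℤ} (hA : A ≠ 0) : D.nrm A ≠ 0 := by
  intro h
  have := D.nrm_eq_prod A
  rw [h, Int.cast_zero, eq_comm, Finset.prod_eq_zero_iff] at this
  obtain ⟨j, -, hj⟩ := this
  exact D.nonvanish A hA j hj

lemma abs_nrm (A : Fin (m + 2) → ℤ) : (|D.nrm A| : ℝ) = ∏ j, ‖D.sg j A‖ := by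
  rw [← norm_prod, ← nrm_eq_prod, Complex.norm_intCast]

/-- Evaluation at a root of `G` modulo `h`. -/
noncomputable def evMod (h : ℕ) (ν : ℤ) (hν : (h : ℤ) ∣ D.G.eval ν) : D.R →+* ZMod h :=
  AdjoinRoot.lift (Int.castRingHom (ZMod h)) (ν : ZMod h) (by
    have : ((D.G.eval ν : ℤ) : ZMod h) = 0 := (ZMod.intCast_zmod_eq_zero_iff_dvd _ _).mpr hν
    rw [← this]
    exact (Polynomial.hom_eval₂ D.G (RingHom.id ℤ) (Int.castRingHom (ZMod h)) ν).symm.trans rfl)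

lemma evMod_rt (h : ℕ) (ν : ℤ) (hν : (h : ℤ) ∣ D.G.eval ν) :
    D.evMod h ν hν D.rt = (ν : ZMod h) := AdjoinRoot.lift_root _

lemma evMod_elt (h : ℕ) (ν : ℤ) (hν : (h : ℤ) ∣ D.G.eval ν) (A : Fin (m + 2) → ℤ) :
    D.evMod h ν hν (D.elt A) = ((ev A ν : ℤ) : ZMod h) := by
  rw [map_elt, evMod_rt, ev]; push_cast; rfl

lemma row_dvd {h : ℕ} {ν : ℤ} (hν : (h : ℤ) ∣ D.G.eval ν) {A : Fin (m + 2) → ℤ}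
    (hA : (h : ℤ) ∣ ev A ν) (c : Fin (m + 2)) :
    (h : ℤ) ∣ ∑ r : Fin (m + 2), ν ^ (r : ℕ) * D.mat (D.elt A) r c := by
  rw [← ZMod.intCast_zmod_eq_zero_iff_dvd]
  have := D.row_mul (D.evMod h ν hν) (D.elt A) c
  rw [evMod_rt, evMod_elt, (ZMod.intCast_zmod_eq_zero_iff_dvd _ _).mpr hA, zero_mul] at this
  rw [← this]; push_cast; rfl

lemma dvd_nrm {h : ℕ} {ν : ℤ} (hν : (h : ℤ) ∣ D.G.eval ν) {A : Fin (m + 2) → ℤ}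
    (hA : (h : ℤ) ∣ ev A ν) : (h : ℤ) ∣ D.nrm A := by
  have h1 := D.row_dvd hν hA
  set M := D.mat (D.elt A) with hM
  let v : Fin (m + 2) → ℤ := fun r => ν ^ (r : ℕ)
  have h2 : Matrix.vecMul (Matrix.vecMul v M) M.adjugate = M.det • v := by
    rw [Matrix.vecMul_vecMul, Matrix.mul_adjugate, Matrix.vecMul_smul, Matrix.vecMul_one]
  have h3 := congrFun h2 0
  simp only [Pi.smul_apply, smul_eq_mul, v, Fin.val_zero, pow_zero, mul_one] at h3
  rw [nrm, ← hM, ← h3]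
  simp only [Matrix.vecMul, dotProduct]
  exact Finset.dvd_sum fun c _ => Dvd.dvd.mul_right (h1 c) (M.adjugate c 0)

lemma sq_dvd_nrm {p : ℕ} (hp : p.Prime) {ν μ : ℤ} (hν : (p : ℤ) ∣ D.G.eval ν)
    (hμ : (p : ℤ) ∣ D.G.eval μ) {A : Fin (m + 2) → ℤ} (hA : (p : ℤ) ∣ ev A ν)
    (hA' : (p : ℤ) ∣ ev A μ) (hne : ¬ (p : ℤ) ∣ μ - ν) : ((p : ℤ) ^ 2) ∣ D.nrm A := by
  have h1 := D.row_dvd hν hA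
  have h2 := D.row_dvd hμ hA'
  set M := D.mat (D.elt A) with hM
  let U : Matrix (Fin (m + 2)) (Fin (m + 2)) ℤ := Matrix.of fun i j =>
    if i = 0 then ν ^ (j : ℕ) else if i = 1 then μ ^ (j : ℕ) - ν ^ (j : ℕ) else
      if i = j then 1 else 0
  have hU : U.det = μ - ν := by
    rw [Matrix.det_of_isUpperTriangular]
    · rw [Fin.prod_univ_succ, Fin.prod_univ_succ]
      have : ∀ i : Fin m, U i.succ.succ i.succ.succ = 1 := by
        intro i
        simp only [U, Matrix.of_apply, Fin.succ_ne_zero, if_false, if_true]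
        rw [if_neg]
        intro h
        rw [← Fin.succ_zero_eq_one, Fin.succ_inj] at h
        exact Fin.succ_ne_zero _ h
      simp [this, U]
    · intro i j hij
      simp only [id] at hij
      have hi : i ≠ 0 := fun h => by subst h; exact absurd hij (Fin.not_lt_zero _)
      simp only [U, Matrix.of_apply, hi, if_false]
      split_ifs with h h'
      · subst h
        have : j = 0 := by
          have : (j : ℕ) < ((1 : Fin (m + 2)) : ℕ) := hij
          rw [Fin.val_one] at this
          exact Fin.ext (by rw [Fin.val_zero]; omega)
        simp [this]
      · exact absurd h' hij.ne'
      · rfl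
  have key : ((p : ℤ) ^ 2) ∣ (U * M).det := by
    have hrow0 : ∀ c, (p : ℤ) ∣ (U * M) 0 c := by
      intro c; simpa [Matrix.mul_apply, U] using h1 c
    have hrow1 : ∀ c, (p : ℤ) ∣ (U * M) 1 c := by
      intro c
      have := dvd_sub (h2 c) (h1 c)
      rw [← Finset.sum_sub_distrib] at this
      simpa [Matrix.mul_apply, U, sub_mul] using this
    rw [Matrix.det_apply]
    refine Finset.dvd_sum fun σ _ => ?_
    rw [Units.smul_def, smul_eq_mul]
    refine Dvd.dvd.mul_left ?_ _
    rw [← Equiv.prod_comp σ.symm]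
    simp only [Equiv.apply_symm_apply]
    rw [Fin.prod_univ_succ, Fin.prod_univ_succ, ← mul_assoc, sq]
    exact (mul_dvd_mul (hrow0 _) (hrow1 _)).mul_right _
  rw [Matrix.det_mul, hU] at key
  refine IsCoprime.dvd_of_dvd_mul_left (IsCoprime.pow_left ?_) key
  exact (Int.isCoprime_iff_gcd_eq_one.mpr (by
    have := (Nat.Prime.coprime_iff_not_dvd hp (n := (μ - ν).natAbs)).mpr
      (fun h => hne (Int.natCast_dvd.mpr h))
    simpa [Int.gcd] using this))

end NormData

namespace NormData

variable {m : ℕ} (D : NormData m)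

lemma mat_mulVec (x y : D.R) : (D.mat x).mulVec (D.bas.repr y) = D.bas.repr (x * y) :=
  Algebra.leftMulMatrix_mulVec_repr D.bas x y

lemma repr_rt_pow (i r : Fin (m + 2)) :
    D.bas.repr (D.rt ^ (i : ℕ)) r = if r = i then 1 else 0 := by
  rw [← bas_apply, Module.Basis.repr_self, Finsupp.single_apply]
  simp only [eq_comm]

lemma repr_intCast (n : ℤ) (r : Fin (m + 2)) :
    D.bas.repr (n : D.R) r = if r = 0 then n else 0 := by
  have : (n : D.R) = n • D.rt ^ ((0 : Fin (m + 2)) : ℕ) := by simp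
  rw [this, map_zsmul, Finsupp.smul_apply, repr_rt_pow]
  split_ifs <;> simp

lemma repr_elt (A : Fin (m + 2) → ℤ) (r : Fin (m + 2)) : D.bas.repr (D.elt A) r = A r := by
  have := D.bas.equivFun.apply_symm_apply A
  exact congrFun this r

lemma det_mat_dvd {x : D.R} {n ν : ℤ} (hx : x ∣ D.rt - ν) (hn : x ∣ (n : D.R)) :
    (D.mat x).det ∣ n := by
  obtain ⟨y₀, hy₀⟩ := hn
  have hi : ∀ i : Fin (m + 2), ∃ y, D.rt ^ (i : ℕ) - (ν : D.R) ^ (i : ℕ) = x * y := fun i =>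
    hx.trans (sub_dvd_pow_sub_pow _ _ _)
  choose y hy using hi
  let z : Fin (m + 2) → D.R := fun i => if i = 0 then y₀ else y i
  let V : Matrix (Fin (m + 2)) (Fin (m + 2)) ℤ := Matrix.of fun r i => D.bas.repr (z i) r
  have hP : ∀ r i, (D.mat x * V) r i = D.bas.repr (x * z i) r := by
    intro r i
    rw [← mat_mulVec]
    rfl
  have hP' : ∀ r i, (D.mat x * V) r i = if i = 0 then (if r = 0 then n else 0) else
      (if r = i then 1 else 0) - (if r = 0 then ν ^ (i : ℕ) else 0) := by
    intro r i
    rw [hP]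
    by_cases h : i = 0
    · simp only [z, h, if_true]
      rw [← hy₀, repr_intCast]
    · simp only [z, h, if_false]
      rw [← hy, map_sub, Finsupp.sub_apply, repr_rt_pow, ← Int.cast_pow, repr_intCast]
  have hdet : (D.mat x * V).det = n := by
    rw [Matrix.det_of_isUpperTriangular]
    · rw [Fin.prod_univ_succ]
      have : ∀ i : Fin (m + 1), (D.mat x * V) i.succ i.succ = 1 := by
        intro i
        rw [hP']
        simp [Fin.succ_ne_zero]
      simp only [this, Finset.prod_const_one, mul_one]
      rw [hP']; simp
    · intro r i hri
      simp only [id] at hri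
      rw [hP']
      have hr : r ≠ 0 := fun h => by subst h; exact absurd hri (Fin.not_lt_zero _)
      simp [hr, hri.ne']
  rw [← hdet, Matrix.det_mul]
  exact dvd_mul_right _ _

lemma sub_dvd_elt_sub (A : Fin (m + 2) → ℤ) (ν : ℤ) :
    D.rt - ν ∣ D.elt A - ((ev A ν : ℤ) : D.R) := by
  rw [elt_eq, ev]
  push_cast
  rw [← Finset.sum_sub_distrib]
  refine Finset.dvd_sum fun i _ => ?_
  rw [zsmul_eq_mul, ← mul_sub]
  exact (sub_dvd_pow_sub_pow _ _ _).mul_left _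

lemma nrm_dvd_of_dvd {A : Fin (m + 2) → ℤ} {ν : ℤ} (h : D.elt A ∣ D.rt - ν) :
    D.nrm A ∣ D.G.eval ν ∧ D.nrm A ∣ ev A ν := by
  constructor
  · refine D.det_mat_dvd h ?_
    have h1 := (D.G.map (Int.castRingHom D.R)).sub_dvd_eval_sub D.rt (ν : D.R)
    have h2 : (D.G.map (Int.castRingHom D.R)).eval D.rt = 0 := by
      rw [Polynomial.eval_map]
      have : (Int.castRingHom D.R) = AdjoinRoot.of D.G := RingHom.ext_int _ _
      rw [this]
      exact AdjoinRoot.eval₂_root D.G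
    have h3 : (D.G.map (Int.castRingHom D.R)).eval (ν : D.R) = ((D.G.eval ν : ℤ) : D.R) :=
      Polynomial.eval_intCast_map (Int.castRingHom D.R) D.G ν
    rw [h2, h3, zero_sub] at h1
    exact (dvd_neg.mp (h.trans h1))
  · refine D.det_mat_dvd h ?_
    have h1 := h.trans (D.sub_dvd_elt_sub A ν)
    exact (dvd_sub_right (dvd_refl _)).mp h1

lemma elt_dvd_nrm (A : Fin (m + 2) → ℤ) : D.elt A ∣ ((D.nrm A : ℤ) : D.R) := by
  let M := D.mat (D.elt A)
  let y : D.R := D.elt (fun r => M.adjugate r 0)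
  refine ⟨y, D.bas.repr.injective (Finsupp.ext fun r => ?_)⟩
  rw [repr_intCast, ← mat_mulVec]
  have : (D.bas.repr y : Fin (m + 2) → ℤ) = fun r => M.adjugate r 0 :=
    funext fun r => D.repr_elt _ r
  rw [this]
  have h := congrFun (congrFun (Matrix.mul_adjugate M) r) 0
  rw [Matrix.mul_apply] at h
  simp only [Matrix.smul_apply, Matrix.one_apply, smul_eq_mul, mul_ite, mul_one, mul_zero] at h
  exact h.symm

lemma elt_add (A B : Fin (m + 2) → ℤ) : D.elt (A + B) = D.elt A + D.elt B := map_add _ _ _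

lemma elt_smul (n : ℤ) (A : Fin (m + 2) → ℤ) : D.elt (n • A) = n • D.elt A := map_zsmul _ _ _

lemma elt_single (i : Fin (m + 2)) (n : ℤ) : D.elt (Pi.single i n) = n • D.rt ^ (i : ℕ) := by
  rw [elt_eq, Finset.sum_eq_single i]
  · simp
  · intro j _ hj; simp [Pi.single_eq_of_ne hj]
  · simp

lemma mat_intCast (n : ℤ) : D.mat (n : D.R) = (n : Matrix (Fin (m + 2)) (Fin (m + 2)) ℤ) :=
  map_intCast (Algebra.leftMulMatrix D.bas) n

lemma mat_add (x y : D.R) : D.mat (x + y) = D.mat x + D.mat y :=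
  map_add (Algebra.leftMulMatrix D.bas) x y

lemma mat_zsmul (n : ℤ) (x : D.R) : D.mat (n • x) = n • D.mat x :=
  map_zsmul (Algebra.leftMulMatrix D.bas) n x

lemma nrm_modEq_one {Q : ℕ} {A : Fin (m + 2) → ℤ} (h0 : (Q : ℤ) ∣ A 0 - 1)
    (h : ∀ i, i ≠ 0 → (Q : ℤ) ∣ A i) : (Q : ℤ) ∣ D.nrm A - 1 := by
  have h' : ∀ i, ∃ b : ℤ, (A - Pi.single 0 1 : Fin (m + 2) → ℤ) i = Q * b := by
    intro i
    by_cases hi : i = 0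
    · subst hi; obtain ⟨b, hb⟩ := h0; exact ⟨b, by simpa using hb⟩
    · obtain ⟨b, hb⟩ := h i hi; exact ⟨b, by simpa [Pi.single_eq_of_ne hi] using hb⟩
  choose B hB using h'
  have hA : A = Pi.single 0 1 + (Q : ℤ) • B := by
    funext i
    have := hB i
    simp only [Pi.sub_apply, Pi.add_apply, Pi.smul_apply, smul_eq_mul] at *
    linarith
  have he : D.elt A = ((1 : ℤ) : D.R) + (Q : ℤ) • D.elt B := by
    rw [hA, elt_add, elt_smul, elt_single]; simp
  rw [← ZMod.intCast_zmod_eq_zero_iff_dvd, nrm, he, mat_add, mat_intCast, mat_zsmul,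
    Int.cast_sub, Int.cast_one, Int.cast_one]
  have : ((Matrix.det (1 + (Q : ℤ) • D.mat (D.elt B)) : ℤ) : ZMod Q) =
      ((Int.castRingHom (ZMod Q)).mapMatrix (1 + (Q : ℤ) • D.mat (D.elt B))).det :=
    (Int.castRingHom (ZMod Q)).map_det _
  have h2 : (Int.castRingHom (ZMod Q)).mapMatrix (1 + (Q : ℤ) • D.mat (D.elt B)) = 1 := by
    rw [map_add, map_one, map_zsmul]
    simp
  have h3 := this
  rw [h2, Matrix.det_one] at h3
  rw [sub_eq_zero, ← h3]

lemma exists_nrm_poly (A : Fin (m + 2) → ℤ) : ∃ f : Polynomial ℤ, f.Monic ∧ f.natDegree = m + 2 ∧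
    ∀ K : ℤ, D.nrm (A + Pi.single 0 K) = f.eval K := by
  refine ⟨(-(D.mat (D.elt A))).charpoly, Matrix.charpoly_monic _, by
    rw [Matrix.charpoly_natDegree_eq_dim, Fintype.card_fin], fun K => ?_⟩
  rw [Matrix.eval_charpoly, nrm, elt_add, elt_single, mat_add, mat_zsmul]
  congr 1
  have : D.mat (D.rt ^ ((0 : Fin (m + 2)) : ℕ)) = 1 := by
    simp only [Fin.val_zero, pow_zero]
    exact map_one (Algebra.leftMulMatrix D.bas)
  rw [this, sub_neg_eq_add, add_comm (D.mat (D.elt A))]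
  congr 1
  ext i j
  rw [Matrix.smul_apply, Matrix.scalar_apply, Matrix.diagonal_apply, Matrix.one_apply]
  split_ifs <;> simp

/-- Matrix of coordinates of the powers of an element. -/
noncomputable def powMat (x : D.R) : Matrix (Fin (m + 2)) (Fin (m + 2)) ℤ :=
  Matrix.of fun r i => D.bas.repr (x ^ (i : ℕ)) r

/-- Index form: the determinant of the coordinates of the powers of an element. -/
noncomputable def idx (B : Fin (m + 2) → ℤ) : ℤ := (D.powMat (D.elt B)).det

lemma exists_root_of_coprime {A B : Fin (m + 2) → ℤ} {K Q : ℤ} (hA : A = Pi.single 0 K + Q • B)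
    (hQ : IsCoprime (D.nrm A) Q) (hB : IsCoprime (D.nrm A) (D.idx B)) :
    ∃ ν : ℤ, D.elt A ∣ D.rt - ν := by
  let P := D.powMat (D.elt B)
  let c : Fin (m + 2) → ℤ := fun i => P.adjugate i 1
  have h1 : (D.idx B : D.R) * D.rt = ∑ i, (c i : D.R) * D.elt B ^ (i : ℕ) := by
    refine D.bas.repr.injective (Finsupp.ext fun r => ?_)
    have h := congrFun (congrFun (Matrix.mul_adjugate P) r) 1
    rw [Matrix.mul_apply] at h
    have e1 : (D.idx B : D.R) * D.rt = D.idx B • D.rt ^ ((1 : Fin (m + 2)) : ℕ) := by simp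
    rw [e1, map_zsmul, Finsupp.smul_apply, repr_rt_pow, map_sum, Finsupp.finsetSum_apply]
    simp only [Matrix.smul_apply, Matrix.one_apply] at h
    rw [idx, ← h]
    refine Finset.sum_congr rfl fun i _ => ?_
    rw [← zsmul_eq_mul, map_zsmul, Finsupp.smul_apply, smul_eq_mul, mul_comm]
    rfl
  have hα : D.elt A = K + Q * D.elt B := by
    rw [hA, elt_add, elt_smul, elt_single]; simp
  let t : ℤ := ∑ i : Fin (m + 2), c i * (Q ^ (m + 1 - (i : ℕ)) * (-K) ^ (i : ℕ))
  have h2 : D.elt A ∣ (Q : D.R) ^ (m + 1) * ((D.idx B : D.R) * D.rt) - t := by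
    rw [h1, Finset.mul_sum]
    simp only [t]
    push_cast
    rw [← Finset.sum_sub_distrib]
    refine Finset.dvd_sum fun i _ => ?_
    have e : (Q : D.R) ^ (m + 1) = Q ^ (m + 1 - (i : ℕ)) * Q ^ (i : ℕ) := by
      rw [← pow_add]; congr 1; have := i.is_lt; omega
    have : (Q : D.R) ^ (m + 1) * (c i * D.elt B ^ (i : ℕ)) -
        c i * (Q ^ (m + 1 - (i : ℕ)) * (-K) ^ (i : ℕ)) =
        c i * Q ^ (m + 1 - (i : ℕ)) * ((Q * D.elt B) ^ (i : ℕ) - (-K) ^ (i : ℕ)) := by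
      rw [e, mul_pow]; ring
    rw [this]
    refine Dvd.dvd.mul_left ?_ _
    have h3 := sub_dvd_pow_sub_pow ((Q : D.R) * D.elt B) (-(K : D.R)) (i : ℕ)
    rwa [sub_neg_eq_add, add_comm, ← hα] at h3
  obtain ⟨u, v, huv⟩ := (hQ.pow_right (n := m + 1)).mul_right hB
  refine ⟨v * t, ?_⟩
  have h4 : D.rt - ((v * t : ℤ) : D.R) =
      (D.nrm A : D.R) * (u * D.rt) + v * ((Q : D.R) ^ (m + 1) * ((D.idx B : D.R) * D.rt) - t) := by
    have := congrArg (fun n : ℤ => (n : D.R)) huv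
    push_cast at this ⊢
    linear_combination (-D.rt) * this
  rw [h4]
  exact dvd_add ((D.elt_dvd_nrm A).mul_right _) (h2.mul_left _)

end NormData

lemma Polynomial.coeff_prod_of_natDegree_le' {ι : Type*} (s : Finset ι) (f : ι → Polynomial ℤ)
    (n : ι → ℕ) (h : ∀ i ∈ s, (f i).natDegree ≤ n i) :
    (∏ i ∈ s, f i).natDegree ≤ ∑ i ∈ s, n i ∧
      (∏ i ∈ s, f i).coeff (∑ i ∈ s, n i) = ∏ i ∈ s, (f i).coeff (n i) := by
  induction s using Finset.induction_on with
  | empty => simp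
  | insert a s ha ih =>
    obtain ⟨h1, h2⟩ := ih fun i hi => h i (Finset.mem_insert_of_mem hi)
    have h3 := h a (Finset.mem_insert_self _ _)
    rw [Finset.prod_insert ha, Finset.sum_insert ha, Finset.prod_insert ha, ← h2]
    exact ⟨Polynomial.natDegree_mul_le_of_le h3 h1, Polynomial.coeff_mul_add_eq_of_natDegree_le h3 h1⟩

lemma Matrix.det_monic_of_natDegree_le {n : ℕ} (M : Matrix (Fin n) (Fin n) (Polynomial ℤ))
    (h : ∀ r i, (M r i).natDegree ≤ (i : ℕ))
    (hc : ∀ r i, (M r i).coeff (i : ℕ) = if r = i then 1 else 0) :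
    M.det.Monic ∧ M.det.natDegree = ∑ i : Fin n, (i : ℕ) := by
  have hd : M.det.natDegree ≤ ∑ i : Fin n, (i : ℕ) := by
    rw [Matrix.det_apply]
    refine Polynomial.natDegree_sum_le_of_forall_le _ _ fun σ _ => ?_
    refine (Polynomial.natDegree_smul_le _ _).trans ?_
    exact (Polynomial.coeff_prod_of_natDegree_le' _ _ _ fun i _ => h _ _).1
  have hl : M.det.coeff (∑ i : Fin n, (i : ℕ)) = 1 := by
    rw [← Matrix.det_one (n := Fin n) (R := ℤ), Matrix.det_apply, Matrix.det_apply,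
      Polynomial.finsetSum_coeff]
    refine Finset.sum_congr rfl fun σ _ => ?_
    rw [Polynomial.coeff_smul,
      (Polynomial.coeff_prod_of_natDegree_le' _ _ _ fun i _ => h _ _).2]
    congr 1
    exact Finset.prod_congr rfl fun i _ => by rw [hc, Matrix.one_apply]
  exact ⟨Polynomial.monic_of_natDegree_le_of_coeff_eq_one _ hd hl,
    Polynomial.natDegree_eq_of_le_of_coeff_ne_zero hd (by rw [hl]; exact one_ne_zero)⟩

namespace NormData

variable {m : ℕ} (D : NormData m)

lemma exists_idx_poly (B : Fin (m + 2) → ℤ) : ∃ f : Polynomial ℤ, f.Monic ∧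
    f.natDegree = ∑ i : Fin (m + 2), (i : ℕ) ∧
    ∀ t : ℤ, D.idx (B + Pi.single 1 t) = f.eval t := by
  let p : Polynomial D.R := Polynomial.C (D.elt B) + Polynomial.C D.rt * Polynomial.X
  have hp : p.natDegree ≤ 1 := by
    refine (Polynomial.natDegree_add_le _ _).trans (max_le ?_ ?_)
    · simp
    · exact (Polynomial.natDegree_C_mul_le _ _).trans Polynomial.natDegree_X_le
  have hpd : ∀ i : ℕ, (p ^ i).natDegree ≤ i := fun i => by
    simpa using Polynomial.natDegree_pow_le_of_le i hp
  have hpc : ∀ i : ℕ, (p ^ i).coeff i = D.rt ^ i := fun i => by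
    have := Polynomial.coeff_pow_of_natDegree_le (m := i) hp
    rw [mul_one] at this
    rw [this]; simp [p]
  let M : Matrix (Fin (m + 2)) (Fin (m + 2)) (Polynomial ℤ) := Matrix.of fun r i =>
    ∑ k ∈ Finset.range ((i : ℕ) + 1), Polynomial.monomial k (D.bas.repr ((p ^ (i : ℕ)).coeff k) r)
  have hM := Matrix.det_monic_of_natDegree_le M (fun r i => by
      simp only [M, Matrix.of_apply]
      refine Polynomial.natDegree_sum_le_of_forall_le _ _ fun k hk => ?_
      exact (Polynomial.natDegree_monomial_le _).trans
        (Nat.lt_succ_iff.mp (Finset.mem_range.mp hk))) (fun r i => by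
      simp only [M, Matrix.of_apply, Polynomial.finsetSum_coeff, Polynomial.coeff_monomial]
      rw [Finset.sum_ite_eq']
      simp only [Finset.mem_range, Nat.lt_succ_self, if_true]
      rw [hpc, repr_rt_pow])
  refine ⟨M.det, hM.1, hM.2, fun t => ?_⟩
  rw [idx, ← Polynomial.coe_evalRingHom, RingHom.map_det]
  congr 1
  ext r i
  have hpe : (p ^ (i : ℕ)).eval (t : D.R) = D.elt (B + Pi.single 1 t) ^ (i : ℕ) := by
    rw [Polynomial.eval_pow, elt_add, elt_single, Fin.val_one, pow_one, zsmul_eq_mul,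
      mul_comm (t : D.R)]
    simp only [p, Polynomial.eval_add, Polynomial.eval_mul, Polynomial.eval_C, Polynomial.eval_X]
  rw [RingHom.mapMatrix_apply, Matrix.map_apply]
  simp only [M, Matrix.of_apply, powMat, ← hpe, Polynomial.coe_evalRingHom]
  rw [Polynomial.eval_eq_sum_range' (Nat.lt_succ_of_le (hpd i)), Polynomial.eval_finsetSum,
    map_sum, Finsupp.finsetSum_apply]
  refine Finset.sum_congr rfl fun k _ => ?_
  rw [Polynomial.eval_monomial, ← Int.cast_pow, mul_comm, ← zsmul_eq_mul, map_zsmul,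
    Finsupp.smul_apply, smul_eq_mul, mul_comm]

lemma exists_idx_bound : ∃ C : ℝ, 1 ≤ C ∧ ∀ (B : Fin (m + 2) → ℤ) (W : ℝ), 1 ≤ W →
    (∀ i, |(B i : ℝ)| ≤ W) → |(D.idx B : ℝ)| ≤ C * W ^ ((m + 2) * (m + 2)) := by
  obtain ⟨C₁, hC₁⟩ : ∃ C₁ : ℝ, ∀ q : Fin (m + 2) × Fin (m + 2) × Fin (m + 2),
      |(D.bas.repr (D.bas q.1 * D.bas q.2.1) q.2.2 : ℝ)| ≤ C₁ := by
    obtain ⟨C₁, h⟩ := (Set.finite_range fun q : Fin (m + 2) × Fin (m + 2) × Fin (m + 2) =>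
      |(D.bas.repr (D.bas q.1 * D.bas q.2.1) q.2.2 : ℝ)|).bddAbove
    exact ⟨C₁, fun q => h ⟨q, rfl⟩⟩
  have hC₁0 : 0 ≤ C₁ := (abs_nonneg _).trans (hC₁ (0, 0, 0))
  set C₂ : ℝ := (m + 2) * ((m + 2) * C₁) + 1 with hC₂
  have hC₂1 : 1 ≤ C₂ := by rw [hC₂]; have : (0 : ℝ) ≤ m := m.cast_nonneg; nlinarith [mul_nonneg this hC₁0, mul_nonneg this (mul_nonneg this hC₁0)]
  have hentry : ∀ (B : Fin (m + 2) → ℤ) (W : ℝ), 1 ≤ W → (∀ i, |(B i : ℝ)| ≤ W) →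
      ∀ (i : ℕ) (r : Fin (m + 2)), |(D.bas.repr (D.elt B ^ i) r : ℝ)| ≤ (C₂ * W) ^ i := by
    intro B W hW hB i
    induction i with
    | zero =>
      intro r
      have := D.repr_intCast 1 r
      rw [Int.cast_one] at this
      rw [pow_zero, pow_zero, this]
      split_ifs <;> simp
    | succ i ih =>
      intro r
      have h1 : D.elt B ^ (i + 1) = ∑ j, ∑ k,
          (B j * D.bas.repr (D.elt B ^ i) k) • (D.bas j * D.bas k) := by
        rw [pow_succ']
        have e1 : D.elt B = ∑ j, B j • D.bas j := by
          rw [elt, Module.Basis.equivFun_symm_apply]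
        rw [← D.bas.sum_repr (D.elt B ^ i)]
        conv_lhs => rw [e1]
        rw [Finset.sum_mul_sum]
        refine Finset.sum_congr rfl fun j _ => Finset.sum_congr rfl fun k _ => ?_
        rw [smul_mul_smul_comm, D.bas.sum_repr, e1]
      rw [h1, map_sum, Finsupp.finsetSum_apply]
      push_cast
      have hb : ∀ j k : Fin (m + 2), |((D.bas.repr ((B j * D.bas.repr (D.elt B ^ i) k) •
          (D.bas j * D.bas k)) r : ℤ) : ℝ)| ≤ W * (C₂ * W) ^ i * C₁ := by
        intro j k
        rw [map_zsmul, Finsupp.smul_apply, smul_eq_mul]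
        push_cast
        rw [abs_mul, abs_mul]
        have := hC₁ (j, k, r)
        have h3 := ih k
        have h4 := hB j
        gcongr
      refine (Finset.abs_sum_le_sum_abs _ _).trans ?_
      have h5 : ∀ j : Fin (m + 2), |((D.bas.repr (∑ k, (B j * D.bas.repr (D.elt B ^ i) k) •
          (D.bas j * D.bas k)) r : ℤ) : ℝ)| ≤ (m + 2) * (W * (C₂ * W) ^ i * C₁) := by
        intro j
        rw [map_sum, Finsupp.finsetSum_apply]
        push_cast
        refine (Finset.abs_sum_le_sum_abs _ _).trans ?_
        refine (Finset.sum_le_sum fun k _ => hb j k).trans ?_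
        simp
      refine (Finset.sum_le_sum fun j _ => h5 j).trans ?_
      simp only [Finset.sum_const, Finset.card_univ, Fintype.card_fin, nsmul_eq_mul]
      push_cast
      rw [pow_succ]
      have h6 : 0 ≤ (C₂ * W) ^ i := by positivity
      have h7 : ((m : ℝ) + 2) * (((m : ℝ) + 2) * C₁) ≤ C₂ := by rw [hC₂]; linarith
      calc ((m : ℝ) + 2) * ((m + 2) * (W * (C₂ * W) ^ i * C₁))
          = (C₂ * W) ^ i * (((m : ℝ) + 2) * (((m : ℝ) + 2) * C₁) * W) := by ring
        _ ≤ (C₂ * W) ^ i * (C₂ * W) := by gcongr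
  refine ⟨((m + 2).factorial : ℝ) * (C₂ ^ (m + 2)) ^ (m + 2), ?_, fun B W hW hB => ?_⟩
  · have h1 : (1 : ℝ) ≤ ((m + 2).factorial : ℝ) := by exact_mod_cast Nat.factorial_pos _
    have h2 : (1 : ℝ) ≤ (C₂ ^ (m + 2)) ^ (m + 2) := one_le_pow₀ (one_le_pow₀ hC₂1)
    nlinarith
  · have h1 : (1 : ℝ) ≤ C₂ * W := by nlinarith
    have h2 := Matrix.det_le (A := (D.powMat (D.elt B)).map (Int.cast : ℤ → ℝ))
      (abv := AbsoluteValue.abs) (x := (C₂ * W) ^ (m + 2)) (fun r i =>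
        (hentry B W hW hB i r).trans (pow_le_pow_right₀ h1 i.is_lt.le))
    have h3 : (((D.powMat (D.elt B)).map (Int.cast : ℤ → ℝ)).det : ℝ) = (D.idx B : ℝ) := by
      rw [idx]; exact ((Int.castRingHom ℝ).map_det _).symm
    rw [h3, Fintype.card_fin, nsmul_eq_mul] at h2
    refine h2.trans (le_of_eq ?_)
    rw [mul_pow, mul_pow, ← pow_mul, pow_mul W]
    ring

end NormData

lemma card_filter_zmod_eq_le {p : ℕ} (L : ℕ) (r : ZMod p) :
    ((Finset.range L).filter fun j : ℕ => (j : ZMod p) = r).card ≤ L / p + 1 := by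
  rw [← Finset.card_range (L / p + 1)]
  refine Finset.card_le_card_of_injOn (fun j => j / p) (fun j hj => ?_) fun j hj i hi h => ?_
  · simp only [Finset.coe_filter, Finset.mem_range, Set.mem_ofPred_eq] at hj
    simp only [Finset.coe_range, Set.mem_Iio]
    exact Nat.lt_succ_of_le (Nat.div_le_div_right hj.1.le)
  · simp only [Finset.coe_filter, Finset.mem_range, Set.mem_ofPred_eq] at hj hi
    have h1 : (j : ZMod p) = i := hj.2.trans hi.2.symm
    rw [ZMod.natCast_eq_natCast_iff'] at h1
    simp only at h
    rw [← Nat.div_add_mod j p, ← Nat.div_add_mod i p, h, h1]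

lemma card_filter_dvd_eval_le {f : Polynomial ℤ} (hf : f.Monic) {p : ℕ} (hp : p.Prime)
    {q : ℤ} (hq : ¬ (p : ℤ) ∣ q) (c : ℤ) (L : ℕ) :
    ((Finset.range L).filter fun j : ℕ => (p : ℤ) ∣ f.eval (c + q * j)).card
      ≤ f.natDegree * (L / p + 1) := by
  have := Fact.mk hp
  let fb := f.map (Int.castRingHom (ZMod p))
  have hfb : fb.Monic := hf.map _
  have hq' : (q : ZMod p) ≠ 0 := fun h => hq ((ZMod.intCast_zmod_eq_zero_iff_dvd _ _).mp h)
  let t : Finset (ZMod p) := fb.roots.toFinset.image fun r => (r - c) / q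
  have ht : t.card ≤ f.natDegree := by
    refine Finset.card_image_le.trans ((Multiset.toFinset_card_le _).trans
      ((Polynomial.card_roots' _).trans ?_))
    exact Polynomial.natDegree_map_le
  have h1 : ((Finset.range L).filter fun j : ℕ => (p : ℤ) ∣ f.eval (c + q * j)) ⊆
      t.biUnion fun r => (Finset.range L).filter fun j => (j : ZMod p) = r := by
    intro j hj
    rw [Finset.mem_filter] at hj
    rw [Finset.mem_biUnion]
    refine ⟨(j : ZMod p), ?_, Finset.mem_filter.mpr ⟨hj.1, rfl⟩⟩
    rw [Finset.mem_image]
    refine ⟨c + q * j, ?_, by field_simp; ring⟩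
    rw [Multiset.mem_toFinset, Polynomial.mem_roots hfb.ne_zero, Polynomial.IsRoot]
    have h2 := (ZMod.intCast_zmod_eq_zero_iff_dvd _ _).mpr hj.2
    have h3 := Polynomial.eval_intCast_map (Int.castRingHom (ZMod p)) f (c + q * j)
    rw [Int.cast_add, Int.cast_mul, Int.cast_natCast] at h3
    rw [h3]; exact h2
  calc _ ≤ _ := Finset.card_le_card h1
    _ ≤ ∑ r ∈ t, ((Finset.range L).filter fun j : ℕ => (j : ZMod p) = r).card :=
        Finset.card_biUnion_le
    _ ≤ ∑ r ∈ t, (L / p + 1) := Finset.sum_le_sum fun r _ => card_filter_zmod_eq_le L r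
    _ = t.card * (L / p + 1) := by simp
    _ ≤ _ := Nat.mul_le_mul_right _ ht

lemma norm_add_ge {K h : ℝ} {s : ℂ} (hs : ‖s‖ ≤ K / 8) (hh : 0 ≤ h) :
    ‖(K : ℂ) + s‖ + 7 / 9 * h ≤ ‖((K + h : ℝ) : ℂ) + s‖ := by
  have hK : 0 ≤ K := by linarith [norm_nonneg s]
  set z : ℂ := (K : ℂ) + s with hz
  have hzn : ‖z‖ ≤ 9 / 8 * K := by
    refine (norm_add_le _ _).trans ?_
    rw [Complex.norm_real, Real.norm_of_nonneg hK]; linarith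
  have hre : 7 / 8 * K ≤ z.re := by
    have := Complex.abs_re_le_norm s
    have h2 := neg_abs_le s.re
    simp only [hz, Complex.add_re, Complex.ofReal_re]; linarith
  have h1 : ((K + h : ℝ) : ℂ) + s = z + (h : ℂ) := by rw [hz]; push_cast; ring
  rw [h1]
  refine abs_le_of_sq_le_sq' ?_ (norm_nonneg _) |>.2
  have e : ∀ w : ℂ, ‖w‖ ^ 2 = w.re ^ 2 + w.im ^ 2 := fun w => by
    rw [← Complex.normSq_eq_norm_sq, Complex.normSq_apply]; ring
  have e1 := e z
  have e2 : ‖z + (h : ℂ)‖ ^ 2 = (z.re + h) ^ 2 + z.im ^ 2 := by rw [e]; simp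
  rw [e2]
  have h3 : ‖z‖ * h ≤ 9 / 7 * z.re * h := by gcongr; linarith
  nlinarith

lemma norm_add_le_mul {K h : ℝ} {s : ℂ} (hK : 0 < K) (hs : ‖s‖ ≤ K / 8) (hh : 0 ≤ h) :
    ‖((K + h : ℝ) : ℂ) + s‖ ≤ ‖(K : ℂ) + s‖ * (1 + 2 * h / K) := by
  have h1 : ((K + h : ℝ) : ℂ) + s = ((K : ℂ) + s) + (h : ℂ) := by push_cast; ring
  rw [h1]
  refine (norm_add_le _ _).trans ?_
  rw [Complex.norm_real, Real.norm_of_nonneg hh]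
  have h2 : K / 2 ≤ ‖(K : ℂ) + s‖ := by
    have := norm_sub_norm_le (K : ℂ) (-s)
    rw [sub_neg_eq_add, norm_neg, Complex.norm_real, Real.norm_of_nonneg hK.le] at this
    linarith
  have h3 : h = K / 2 * (2 * h / K) := by field_simp
  have h4 : K / 2 * (2 * h / K) ≤ ‖(K : ℂ) + s‖ * (2 * h / K) := by gcongr
  linarith

lemma exists_window {n : ℕ} (hn : 0 < n) {T η : ℝ} {Q L : ℕ} (hQ : 1 ≤ Q) (hT : 64 * Q ≤ T)
    (hη : 0 < η) (hη2 : η ≤ 1 / 2) (hL : (L : ℝ) ≤ η * T / (10 * n * Q)) (s : Fin n → ℂ)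
    (hs : ∀ j, ‖s j‖ ≤ T / 64) :
    ∃ k : ℕ, ∀ i < L, T ^ n < ∏ j, ‖((1 + Q * (k + i) : ℝ) : ℂ) + s j‖ ∧
      ∏ j, ‖((1 + Q * (k + i) : ℝ) : ℂ) + s j‖ ≤ T ^ n * Real.exp η ∧
      T / 4 ≤ 1 + Q * (k + i) ∧ (1 + Q * (k + i) : ℝ) ≤ 2 * T := by
  have hQ' : (1 : ℝ) ≤ Q := by exact_mod_cast hQ
  have hn' : (1 : ℝ) ≤ n := by exact_mod_cast hn
  have hT0 : 0 < T := by linarith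
  have hup : ∀ K : ℝ, 0 ≤ K → K ≤ T / 2 → ∏ j, ‖(K : ℂ) + s j‖ ≤ T ^ n := by
    intro K hK0 hK
    calc ∏ j, ‖(K : ℂ) + s j‖ ≤ ∏ _j : Fin n, T := by
          refine Finset.prod_le_prod (fun _ _ => norm_nonneg _) fun j _ => ?_
          refine (norm_add_le _ _).trans ?_
          rw [Complex.norm_real, Real.norm_of_nonneg hK0]; linarith [hs j]
      _ = T ^ n := by simp
  have hlow : ∀ K : ℝ, 5 / 4 * T ≤ K → T ^ n < ∏ j, ‖(K : ℂ) + s j‖ := by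
    intro K hK
    calc T ^ n < (K - T / 64) ^ n := by
          apply pow_lt_pow_left₀ (by linarith) hT0.le hn.ne'
      _ = ∏ _j : Fin n, (K - T / 64) := by simp
      _ ≤ _ := by
          refine Finset.prod_le_prod (fun _ _ => by linarith) fun j _ => ?_
          have := norm_sub_norm_le (K : ℂ) (-(s j))
          rw [sub_neg_eq_add, norm_neg, Complex.norm_real,
            Real.norm_of_nonneg (by linarith)] at this
          linarith [hs j]
  have hex : ∃ k : ℕ, T ^ n < ∏ j, ‖((1 + Q * (k : ℝ) : ℝ) : ℂ) + s j‖ := by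
    obtain ⟨k, hk⟩ := exists_nat_gt (2 * T)
    refine ⟨k, hlow _ ?_⟩
    nlinarith
  set k₁ := Nat.find hex with hk₁
  have hP := Nat.find_spec hex
  rw [← hk₁] at hP
  have hk1 : T / 2 < 1 + Q * (k₁ : ℝ) := by
    by_contra! h
    exact absurd (hup _ (by positivity) h) (not_le.mpr hP)
  have hk1pos : 0 < k₁ := by
    rcases Nat.eq_zero_or_pos k₁ with h | h
    · rw [h] at hk1; simp at hk1; linarith
    · exact h
  obtain ⟨k₀, hk₀⟩ : ∃ k₀, k₁ = k₀ + 1 := ⟨k₁ - 1, by omega⟩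
  have hnot : ∏ j, ‖((1 + Q * (k₀ : ℝ) : ℝ) : ℂ) + s j‖ ≤ T ^ n :=
    not_lt.mp (Nat.find_min hex (m := k₀) (by omega))
  have hk1c : (k₁ : ℝ) = k₀ + 1 := by rw [hk₀]; push_cast; ring
  set K₀ : ℝ := 1 + Q * (k₀ : ℝ) with hK₀
  have hK0low : T / 4 ≤ K₀ := by rw [hk1c] at hk1; rw [hK₀]; linarith
  have hK0up : K₀ < 5 / 4 * T := by
    by_contra! h
    exact absurd hnot (not_le.mpr (hlow _ h))
  have hK0pos : 0 < K₀ := by linarith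
  have hsK : ∀ j, ‖s j‖ ≤ K₀ / 8 := fun j => (hs j).trans (by linarith)
  have hQL : Q * (L : ℝ) * (10 * n) ≤ η * T := by
    rw [le_div_iff₀ (by positivity)] at hL; linarith
  refine ⟨k₁, fun i hi => ?_⟩
  have hi' : (i : ℝ) + 1 ≤ L := by exact_mod_cast hi
  have hi0 : (0 : ℝ) ≤ i := i.cast_nonneg
  have hh : Q * ((i : ℝ) + 1) ≤ Q * (L : ℝ) := by gcongr
  have hQL2 : Q * (L : ℝ) ≤ T / 20 := by nlinarith [mul_nonneg (le_trans zero_le_one hQ') (Nat.cast_nonneg (α := ℝ) L)]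
  have hKe : (1 + Q * (k₁ + i : ℝ)) = K₀ + Q * ((i : ℝ) + 1) := by rw [hk1c, hK₀]; ring
  refine ⟨?_, ?_, ?_, ?_⟩
  · refine hP.trans_le (Finset.prod_le_prod (fun _ _ => norm_nonneg _) fun j _ => ?_)
    have h1 := norm_add_ge (K := 1 + Q * (k₁ : ℝ)) (h := Q * (i : ℝ)) (s := s j)
      ((hs j).trans (by linarith)) (by positivity)
    have h2 : (1 + Q * (k₁ : ℝ)) + Q * (i : ℝ) = 1 + Q * (k₁ + i : ℝ) := by ring
    rw [h2] at h1
    have : 0 ≤ 7 / 9 * (Q * (i : ℝ)) := by positivity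
    linarith
  · rw [hKe]
    calc ∏ j, ‖((K₀ + Q * ((i : ℝ) + 1) : ℝ) : ℂ) + s j‖
        ≤ ∏ j, (‖(K₀ : ℂ) + s j‖ * (1 + 2 * (Q * ((i : ℝ) + 1)) / K₀)) :=
          Finset.prod_le_prod (fun _ _ => norm_nonneg _) fun j _ =>
            norm_add_le_mul hK0pos (hsK j) (by positivity)
      _ = (∏ j, ‖(K₀ : ℂ) + s j‖) * (1 + 2 * (Q * ((i : ℝ) + 1)) / K₀) ^ n := by
          rw [Finset.prod_mul_distrib]; simp
      _ ≤ T ^ n * Real.exp η := by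
          have h1 : 1 + 2 * (Q * ((i : ℝ) + 1)) / K₀ ≤ Real.exp (η / n) := by
            have h2 : 2 * (Q * ((i : ℝ) + 1)) / K₀ ≤ η / n := by
              rw [div_le_div_iff₀ hK0pos (by positivity)]
              nlinarith
            linarith [Real.add_one_le_exp (η / n)]
          have h3 : (1 + 2 * (Q * ((i : ℝ) + 1)) / K₀) ^ n ≤ Real.exp η := by
            refine (pow_le_pow_left₀ (by positivity) h1 n).trans (le_of_eq ?_)
            rw [← Real.exp_nat_mul]; congr 1; field_simp
          gcongr
  · rw [hKe]; nlinarith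
  · rw [hKe]; nlinarith

lemma abs_sub_le_of_prod {n : ℕ} (hn : 0 < n) {T η δ K K' : ℝ} (hT : 0 < T) (hη : 0 < η)
    (hη2 : η ≤ 1 / 2) (s s' : Fin n → ℂ) (hs : ∀ j, ‖s j‖ ≤ T / 64)
    (hδ : ∀ j, ‖s j - s' j‖ ≤ δ) (hδ0 : 0 ≤ δ)
    (hK : T / 4 ≤ K) (hK2 : K ≤ 2 * T)
    (h1 : T ^ n < ∏ j, ‖(K : ℂ) + s j‖)
    (h2' : ∏ j, ‖(K' : ℂ) + s' j‖ ≤ T ^ n * Real.exp η) (hKK : K ≤ K') :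
    K' - K ≤ 2 * δ + 24 * η * T := by
  by_contra! hcon
  obtain ⟨h, hh⟩ : ∃ h, K' = K + h := ⟨K' - K, by ring⟩
  have hh0 : 0 ≤ h := by linarith
  have hh2 : 2 * δ ≤ h := by nlinarith [mul_pos hη hT]
  have hh3 : 24 * η * T < h := by linarith
  have key : ∀ j, ‖(K : ℂ) + s j‖ * (1 + h / (12 * T)) ≤ ‖(K' : ℂ) + s' j‖ := by
    intro j
    have e1 := norm_add_ge (K := K) (h := h) (s := s j) ((hs j).trans (by linarith)) hh0
    rw [← hh] at e1
    have e2 : ‖(K' : ℂ) + s j‖ ≤ ‖(K' : ℂ) + s' j‖ + ‖s j - s' j‖ := by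
      have : (K' : ℂ) + s j = ((K' : ℂ) + s' j) + (s j - s' j) := by ring
      rw [this]; exact norm_add_le _ _
    have e3 : ‖(K : ℂ) + s j‖ ≤ 3 * T := by
      refine (norm_add_le _ _).trans ?_
      rw [Complex.norm_real, Real.norm_of_nonneg (by linarith)]; linarith [hs j]
    have e4 : ‖(K : ℂ) + s j‖ * (h / (12 * T)) ≤ 3 * T * (h / (12 * T)) := by gcongr
    have e5 : 3 * T * (h / (12 * T)) = h / 4 := by field_simp; ring
    have := hδ j
    linarith
  have hprod : (∏ j, ‖(K : ℂ) + s j‖) * (1 + h / (12 * T)) ≤ ∏ j, ‖(K' : ℂ) + s' j‖ := by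
    calc _ ≤ (∏ j, ‖(K : ℂ) + s j‖) * (1 + h / (12 * T)) ^ n := by
          gcongr
          exact le_self_pow₀ (by linarith [div_nonneg hh0 (by positivity : (0:ℝ) ≤ 12 * T)]) hn.ne'
      _ = ∏ j, (‖(K : ℂ) + s j‖ * (1 + h / (12 * T))) := by
          rw [Finset.prod_mul_distrib]; simp
      _ ≤ _ := Finset.prod_le_prod (fun _ _ => by positivity) fun j _ => key j
  have hexp : Real.exp η ≤ 1 + 2 * η := by
    have := Real.abs_exp_sub_one_sub_id_le (x := η) (by rw [abs_of_pos hη]; linarith)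
    have := (abs_le.mp this).2
    nlinarith
  have e6 : 1 + 2 * η < 1 + h / (12 * T) := by
    have : 2 * η < h / (12 * T) := by rw [lt_div_iff₀ (by positivity)]; linarith
    linarith
  have hTn : 0 < T ^ n := by positivity
  have : T ^ n * Real.exp η < (∏ j, ‖(K : ℂ) + s j‖) * (1 + h / (12 * T)) := by
    calc T ^ n * Real.exp η ≤ T ^ n * (1 + 2 * η) := by gcongr
      _ < T ^ n * (1 + h / (12 * T)) := by gcongr
      _ ≤ _ := by gcongr
  linarith

lemma card_le_of_card_cons_le {m W c : ℕ} (s : Finset (Fin (m + 1) → ℕ)) (hs : ∀ a ∈ s, ∀ i, a i < W)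
    (h : ∀ (b : Fin m → ℕ) (t : Finset ℕ), (∀ x ∈ t, (Fin.cons x b : Fin (m + 1) → ℕ) ∈ s) → t.card ≤ c) :
    s.card ≤ W ^ m * c := by
  have h1 := Finset.card_le_mul_card_image_of_maps_to (s := s)
    (t := Fintype.piFinset fun _ : Fin m => Finset.range W) (f := Fin.tail) ?_ c ?_
  · rw [Fintype.card_piFinset_const, Finset.card_range] at h1
    rw [mul_comm]; exact h1
  · intro a ha
    rw [Fintype.mem_piFinset]
    exact fun i => Finset.mem_range.mpr (hs a ha _)
  · intro b _
    have e : (s.filter fun a => Fin.tail a = b).card =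
        ((s.filter fun a => Fin.tail a = b).image fun a => a 0).card := by
      refine (Finset.card_image_of_injOn fun a ha a' ha' e => ?_).symm
      rw [Finset.mem_coe, Finset.mem_filter] at ha ha'
      rw [← Fin.cons_self_tail a, ← Fin.cons_self_tail a', ha.2, ha'.2]
      rw [e]
    refine e.le.trans (h b _ fun x hx => ?_)
    rw [Finset.mem_image] at hx
    obtain ⟨a, ha, rfl⟩ := hx
    rw [Finset.mem_filter] at ha
    rw [← ha.2, Fin.cons_self_tail]; exact ha.1

lemma card_le_of_card_snd_le {α : Type*} {V : Finset α} {c : ℕ} (s : Finset (α × ℕ))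
    (hs : ∀ x ∈ s, x.1 ∈ V) (h : ∀ a ∈ V, ∀ t : Finset ℕ, (∀ j ∈ t, (a, j) ∈ s) → t.card ≤ c) :
    s.card ≤ V.card * c := by
  have h1 := Finset.card_le_mul_card_image_of_maps_to (s := s) (t := V) (f := Prod.fst) hs c ?_
  · rw [mul_comm]; exact h1
  · intro b hb
    have e : (s.filter fun a => a.1 = b).card =
        ((s.filter fun a => a.1 = b).image Prod.snd).card := by
      refine (Finset.card_image_of_injOn fun x hx y hy e => ?_).symm
      rw [Finset.mem_coe, Finset.mem_filter] at hx hy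
      exact Prod.ext (hx.2.trans hy.2.symm) e
    refine e.le.trans (h b hb _ fun x hx => ?_)
    rw [Finset.mem_image] at hx
    obtain ⟨a, ha, rfl⟩ := hx
    rw [Finset.mem_filter] at ha
    rw [← ha.2]; exact ha.1

lemma card_primeFactors_le_of_le_two_pow {n E : ℕ} (hn : n ≠ 0) (h : n ≤ 2 ^ E) :
    n.primeFactors.card ≤ E := by
  have h1 : 2 ^ n.primeFactors.card ≤ n := by
    calc 2 ^ n.primeFactors.card = ∏ _p ∈ n.primeFactors, 2 := by simp
      _ ≤ ∏ p ∈ n.primeFactors, p := Finset.prod_le_prod' fun p hp =>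
          (Nat.prime_of_mem_primeFactors hp).two_le
      _ ≤ n := Nat.le_of_dvd (Nat.pos_of_ne_zero hn) (Nat.prod_primeFactors_dvd n)
  exact (Nat.pow_le_pow_iff_right (by norm_num)).mp (h1.trans h)

lemma div_add_one_le {L p : ℕ} (hp : 0 < p) (h : p ≤ L) : ((L / p + 1 : ℕ) : ℝ) ≤ 2 * L / p := by
  have h1 : ((L / p : ℕ) : ℝ) ≤ L / p := Nat.cast_div_le
  have h2 : (1 : ℝ) ≤ L / p := by
    rw [le_div_iff₀ (by positivity)]; simpa using (by exact_mod_cast h : (p : ℝ) ≤ L)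
  push_cast
  rw [mul_div_assoc]; linarith

lemma card_good_ge {m g d D₀ M W L E k P : ℕ} (N : (Fin (m + 1) → ℕ) → ℕ → ℤ)
    (I : (Fin (m + 1) → ℕ) → ℤ) (hg : 1 ≤ g)
    (hN : ∀ p : ℕ, p.Prime → D₀ < p → ∀ a,
      ((Finset.range L).filter fun j => (p : ℤ) ∣ N a j).card ≤ g * (L / p + 1))
    (hI : ∀ p : ℕ, p.Prime → D₀ < p → ∀ b : Fin m → ℕ,
      ((Finset.range W).filter fun t => (p : ℤ) ∣ I (Fin.cons t b)).card ≤ d * (W / p + 1))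
    (hI0 : ∀ b : Fin m → ℕ, ((Finset.range W).filter fun t => I (Fin.cons t b) = 0).card ≤ d)
    (hIb : ∀ a ∈ Fintype.piFinset fun _ : Fin (m + 1) => Finset.range W, (I a).natAbs ≤ 2 ^ E)
    (hD₀ : 32 * d * g ≤ D₀) (hD₁ : 1 ≤ D₀) (hDM : D₀ ≤ M) (hMW : M ≤ W) (hML : M ≤ L) (hWd : 8 * d ≤ W)
    (hE : 16 * g * E ≤ M) (S : Finset ℕ) (hSk : S.card ≤ k) (hS : ∀ p ∈ S, p.Prime ∧ P ≤ p)
    (hP : 16 * g * k ≤ P) (hP0 : D₀ < P) (hL : 16 * g * k ≤ L) :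
    (W : ℝ) ^ (m + 1) * L / 2 ≤
      ((((Fintype.piFinset fun _ : Fin (m + 1) => Finset.range W) ×ˢ Finset.range L).filter
        fun x => (∀ p : ℕ, p.Prime → D₀ < p → (p : ℤ) ∣ N x.1 x.2 → ¬ (p : ℤ) ∣ I x.1) ∧
          ∀ p ∈ S, ¬ (p : ℤ) ∣ N x.1 x.2).card : ℝ) := by
  set U := Fintype.piFinset fun _ : Fin (m + 1) => Finset.range W with hU
  have hUc : U.card = W ^ (m + 1) := by
    rw [hU, Fintype.card_piFinset_const, Finset.card_range]
  set Ω := U ×ˢ Finset.range L with hΩ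
  have hΩc : Ω.card = W ^ (m + 1) * L := by rw [hΩ, Finset.card_product, hUc, Finset.card_range]
  have hΩU : ∀ x ∈ Ω, x.1 ∈ U := fun x hx => (Finset.mem_product.mp hx).1
  have hΩL : ∀ x ∈ Ω, x.2 ∈ Finset.range L := fun x hx => (Finset.mem_product.mp hx).2
  have hUW : ∀ a ∈ U, ∀ i, a i < W := fun a ha i =>
    Finset.mem_range.mp (Fintype.mem_piFinset.mp ha i)
  have hM0 : 0 < M := by omega
  have hW0 : 0 < W := by omega
  have hL0 : 0 < L := by omega
  let B1 : Finset ((Fin (m + 1) → ℕ) × ℕ) := ((Finset.Ioc D₀ M).filter Nat.Prime).biUnion fun p =>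
    Ω.filter fun x => (p : ℤ) ∣ I x.1 ∧ (p : ℤ) ∣ N x.1 x.2
  let B2 : Finset ((Fin (m + 1) → ℕ) × ℕ) := Ω.filter fun x => I x.1 = 0 ∧ True
  obtain ⟨R3, hR3⟩ : ∃ R : (Fin (m + 1) → ℕ) × ℕ → Prop, ∀ x, R x ↔
      ∃ p ∈ (I x.1).natAbs.primeFactors, M < p ∧ (p : ℤ) ∣ N x.1 x.2 := ⟨_, fun _ => Iff.rfl⟩
  obtain ⟨R4, hR4⟩ : ∃ R : (Fin (m + 1) → ℕ) × ℕ → Prop, ∀ x, R x ↔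
      ∃ p ∈ S, (p : ℤ) ∣ N x.1 x.2 := ⟨_, fun _ => Iff.rfl⟩
  let B3 : Finset ((Fin (m + 1) → ℕ) × ℕ) := Ω.filter fun x => I x.1 ≠ 0 ∧ R3 x
  let B4 : Finset ((Fin (m + 1) → ℕ) × ℕ) := Ω.filter R4
  set Gd := Ω.filter fun x => (∀ p : ℕ, p.Prime → D₀ < p → (p : ℤ) ∣ N x.1 x.2 → ¬ (p : ℤ) ∣ I x.1) ∧
          ∀ p ∈ S, ¬ (p : ℤ) ∣ N x.1 x.2 with hGd
  have hcov : Ω ⊆ Gd ∪ (B1 ∪ (B2 ∪ (B3 ∪ B4))) := by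
    intro x hx
    by_cases hxg : x ∈ Gd
    · exact Finset.mem_union_left _ hxg
    refine Finset.mem_union_right _ ?_
    rw [hGd, Finset.mem_filter, not_and, not_and_or] at hxg
    rcases hxg hx with h | h
    · push Not at h
      obtain ⟨p, hp, hpD, hpN, hpI⟩ := h
      by_cases hpM : p ≤ M
      · refine Finset.mem_union_left _ (Finset.mem_biUnion.mpr ⟨p, ?_, ?_⟩)
        · rw [Finset.mem_filter, Finset.mem_Ioc]; exact ⟨⟨hpD, hpM⟩, hp⟩
        · exact Finset.mem_filter.mpr ⟨hx, hpI, hpN⟩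
      · refine Finset.mem_union_right _ ?_
        by_cases h0 : I x.1 = 0
        · exact Finset.mem_union_left _ (Finset.mem_filter.mpr ⟨hx, h0, trivial⟩)
        · refine Finset.mem_union_right _ (Finset.mem_union_left _ (Finset.mem_filter.mpr
            ⟨hx, h0, (hR3 x).mpr ⟨p, ?_, by omega, hpN⟩⟩))
          exact Nat.mem_primeFactors.mpr ⟨hp, Int.natCast_dvd.mp hpI, by simpa using h0⟩
    · push Not at h
      exact Finset.mem_union_right _ (Finset.mem_union_right _ (Finset.mem_union_right _
        (Finset.mem_filter.mpr ⟨hx, (hR4 x).mpr h⟩)))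
  have hcard : (Ω.card : ℝ) ≤ Gd.card + (B1.card + (B2.card + (B3.card + B4.card))) := by
    have := (Finset.card_le_card hcov).trans ((Finset.card_union_le _ _).trans
      (Nat.add_le_add_left ((Finset.card_union_le _ _).trans
      (Nat.add_le_add_left ((Finset.card_union_le _ _).trans
      (Nat.add_le_add_left (Finset.card_union_le _ _) _)) _)) _))
    exact_mod_cast this
  have hWr : (0 : ℝ) < W := by exact_mod_cast hW0
  have hLr : (0 : ℝ) < L := by exact_mod_cast hL0
  have hb1 : (B1.card : ℝ) ≤ (W : ℝ) ^ (m + 1) * L / 8 := by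
    have h1 : (B1.card : ℝ) ≤ ∑ p ∈ (Finset.Ioc D₀ M).filter Nat.Prime,
        (4 * d * g * ((W : ℝ) ^ (m + 1) * L)) * ((p : ℝ) ^ 2)⁻¹ := by
      refine le_trans (Nat.cast_le.mpr Finset.card_biUnion_le) ?_
      rw [Nat.cast_sum]
      refine Finset.sum_le_sum fun p hp => ?_
      rw [Finset.mem_filter, Finset.mem_Ioc] at hp
      obtain ⟨⟨hpD, hpM⟩, hp⟩ := hp
      have h2 := card_le_of_card_snd_le (V := U.filter fun a => (p : ℤ) ∣ I a)
        (Ω.filter fun x => (p : ℤ) ∣ I x.1 ∧ (p : ℤ) ∣ N x.1 x.2)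
        (fun x hx => Finset.mem_filter.mpr ⟨hΩU x (Finset.mem_filter.mp hx).1,
          (Finset.mem_filter.mp hx).2.1⟩)
        (fun a _ t ht => (Finset.card_le_card fun j hj => Finset.mem_filter.mpr
          ⟨hΩL _ (Finset.mem_filter.mp (ht j hj)).1, (Finset.mem_filter.mp (ht j hj)).2.2⟩).trans
          (hN p hp hpD a))
      have h3 := card_le_of_card_cons_le (W := W) (U.filter fun a => (p : ℤ) ∣ I a)
        (fun a ha => hUW a (Finset.mem_filter.mp ha).1)
        (fun b t ht => (Finset.card_le_card fun j hj => Finset.mem_filter.mpr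
          ⟨Finset.mem_range.mpr (by simpa using hUW _ (Finset.mem_filter.mp (ht j hj)).1 0),
          (Finset.mem_filter.mp (ht j hj)).2⟩).trans (hI p hp hpD b))
      have h4 : ((Ω.filter fun x => (p : ℤ) ∣ I x.1 ∧ (p : ℤ) ∣ N x.1 x.2).card : ℝ) ≤
          (W : ℝ) ^ m * (d * (W / p + 1 : ℕ)) * (g * (L / p + 1 : ℕ)) := by
        exact_mod_cast h2.trans (Nat.mul_le_mul_right _ h3)
      refine h4.trans ?_
      have hp0 : (0 : ℝ) < p := by exact_mod_cast hp.pos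
      calc (W : ℝ) ^ m * (d * (W / p + 1 : ℕ)) * (g * (L / p + 1 : ℕ))
          ≤ (W : ℝ) ^ m * (d * (2 * W / p)) * (g * (2 * L / p)) := by
            gcongr
            · exact div_add_one_le hp.pos (by omega)
            · exact div_add_one_le hp.pos (by omega)
        _ = _ := by field_simp; ring
    have h2 : ∑ p ∈ (Finset.Ioc D₀ M).filter Nat.Prime, ((p : ℝ) ^ 2)⁻¹ ≤ (D₀ : ℝ)⁻¹ := by
      refine (Finset.sum_le_sum_of_subset_of_nonneg (Finset.filter_subset _ _)
        fun _ _ _ => by positivity).trans ?_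
      refine (sum_Ioc_inv_sq_le_sub (by omega) hDM).trans ?_
      have : (0 : ℝ) ≤ (M : ℝ)⁻¹ := by positivity
      linarith
    rw [← Finset.mul_sum] at h1
    have hD1r : (0 : ℝ) < D₀ := by exact_mod_cast hD₁
    have hDr : (32 * d * g : ℝ) ≤ D₀ := by exact_mod_cast hD₀
    calc (B1.card : ℝ) ≤ _ := h1
      _ ≤ (4 * d * g * ((W : ℝ) ^ (m + 1) * L)) * (D₀ : ℝ)⁻¹ := by gcongr
      _ = (32 * d * g) / D₀ * (((W : ℝ) ^ (m + 1) * L) / 8) := by field_simp; ring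
      _ ≤ 1 * (((W : ℝ) ^ (m + 1) * L) / 8) := by
          gcongr; rw [div_le_one hD1r]; exact hDr
      _ = _ := one_mul _
  have hb2 : (B2.card : ℝ) ≤ (W : ℝ) ^ (m + 1) * L / 8 := by
    have h2 := card_le_of_card_snd_le (V := U.filter fun a => I a = 0) (c := L) B2
        (fun x hx => Finset.mem_filter.mpr ⟨hΩU x (Finset.mem_filter.mp hx).1,
          (Finset.mem_filter.mp hx).2.1⟩)
        (fun a _ t ht => (Finset.card_le_card fun j hj =>
          hΩL _ (Finset.mem_filter.mp (ht j hj)).1).trans (Finset.card_range L).le)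
    have h3 := card_le_of_card_cons_le (W := W) (U.filter fun a => I a = 0)
        (fun a ha => hUW a (Finset.mem_filter.mp ha).1)
        (fun b t ht => (Finset.card_le_card fun j hj => Finset.mem_filter.mpr
          ⟨Finset.mem_range.mpr (by simpa using hUW _ (Finset.mem_filter.mp (ht j hj)).1 0),
          (Finset.mem_filter.mp (ht j hj)).2⟩).trans (hI0 b))
    have h4 : (B2.card : ℝ) ≤ (W : ℝ) ^ m * d * L := by
      exact_mod_cast h2.trans (Nat.mul_le_mul_right _ h3)
    have h5 : (8 * d : ℝ) ≤ W := by exact_mod_cast hWd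
    calc (B2.card : ℝ) ≤ _ := h4
      _ = (W : ℝ) ^ m * L / 8 * (8 * d) := by ring
      _ ≤ (W : ℝ) ^ m * L / 8 * W := by gcongr
      _ = _ := by ring
  have hb3 : (B3.card : ℝ) ≤ (W : ℝ) ^ (m + 1) * L / 8 := by
    have h2 := card_le_of_card_snd_le (V := U.filter fun a => I a ≠ 0)
        (c := E * (g * (L / M + 1))) B3
        (fun x hx => Finset.mem_filter.mpr ⟨hΩU x (Finset.mem_filter.mp hx).1,
          (Finset.mem_filter.mp hx).2.1⟩) ?_
    · have h4 : (B3.card : ℝ) ≤ (W : ℝ) ^ (m + 1) * (E * (g * (L / M + 1 : ℕ))) := by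
        have h3 : (U.filter fun a => I a ≠ 0).card ≤ W ^ (m + 1) :=
          hUc ▸ Finset.card_filter_le _ _
        exact_mod_cast h2.trans (Nat.mul_le_mul_right _ h3)
      have hMr : (0 : ℝ) < M := by exact_mod_cast hM0
      have hEr : (16 * g * E : ℝ) ≤ M := by exact_mod_cast hE
      calc (B3.card : ℝ) ≤ _ := h4
        _ ≤ (W : ℝ) ^ (m + 1) * (E * (g * (2 * L / M))) := by
            gcongr; exact div_add_one_le hM0 hML
        _ = (16 * g * E) / M * ((W : ℝ) ^ (m + 1) * L / 8) := by field_simp; ring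
        _ ≤ 1 * (((W : ℝ) ^ (m + 1) * L) / 8) := by
            gcongr; rw [div_le_one hMr]; exact hEr
        _ = _ := one_mul _
    · intro a ha t ht
      obtain ⟨ha, h0⟩ := Finset.mem_filter.mp ha
      calc _ ≤ (((I a).natAbs.primeFactors.filter fun p => M < p).biUnion fun p =>
            (Finset.range L).filter fun j => (p : ℤ) ∣ N a j).card := by
            refine Finset.card_le_card fun j hj => ?_
            obtain ⟨hj, -, hR⟩ := Finset.mem_filter.mp (ht j hj)
            obtain ⟨p, hp, hpM, hpN⟩ := (hR3 _).mp hR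
            rw [Finset.mem_biUnion]
            exact ⟨p, Finset.mem_filter.mpr ⟨hp, hpM⟩, Finset.mem_filter.mpr ⟨hΩL _ hj, hpN⟩⟩
        _ ≤ ((I a).natAbs.primeFactors.filter fun p => M < p).card * (g * (L / M + 1)) := by
            refine Finset.card_biUnion_le_card_mul _ _ _ fun p hp => ?_
            rw [Finset.mem_filter] at hp
            refine (hN p (Nat.prime_of_mem_primeFactors hp.1) (by omega) a).trans ?_
            gcongr
            exact hp.2.le
        _ ≤ _ := by
            gcongr
            exact (Finset.card_filter_le _ _).trans
              (card_primeFactors_le_of_le_two_pow (by simpa using h0) (hIb a ha))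
  have hb4 : (B4.card : ℝ) ≤ (W : ℝ) ^ (m + 1) * L / 8 := by
    have h2 := card_le_of_card_snd_le (V := U) (c := k * (g * (L / P + 1))) B4
        (fun x hx => hΩU x (Finset.mem_filter.mp hx).1) ?_
    · have h4 : (B4.card : ℝ) ≤ (W : ℝ) ^ (m + 1) * (k * (g * (L / P + 1 : ℕ))) := by
        have h3 : U.card ≤ W ^ (m + 1) := hUc.le
        exact_mod_cast h2.trans (Nat.mul_le_mul_right _ h3)
      have hPr : (0 : ℝ) < P := by exact_mod_cast (by omega : 0 < P)
      have h5 : (16 * g * k : ℝ) ≤ P := by exact_mod_cast hP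
      have h6 : (16 * g * k : ℝ) ≤ L := by exact_mod_cast hL
      have h7 : ((L / P : ℕ) : ℝ) ≤ L / P := Nat.cast_div_le
      have h8 : (k * (g * (L / P + 1 : ℕ)) : ℝ) ≤ L / 8 := by
        push_cast
        have : (k * g * ((L / P : ℕ) : ℝ)) ≤ L / 16 := by
          calc (k * g * ((L / P : ℕ) : ℝ)) ≤ k * g * (L / P) := by gcongr
            _ = (16 * g * k) / P * (L / 16) := by field_simp
            _ ≤ 1 * (L / 16) := by gcongr; rw [div_le_one hPr]; exact h5
            _ = _ := one_mul _
        nlinarith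
      calc (B4.card : ℝ) ≤ _ := h4
        _ ≤ (W : ℝ) ^ (m + 1) * (L / 8) := by gcongr
        _ = _ := by ring
    · intro a ha t ht
      calc _ ≤ (S.biUnion fun p =>
            (Finset.range L).filter fun j => (p : ℤ) ∣ N a j).card := by
            refine Finset.card_le_card fun j hj => ?_
            obtain ⟨hj, hR⟩ := Finset.mem_filter.mp (ht j hj)
            obtain ⟨p, hp, hpN⟩ := (hR4 _).mp hR
            rw [Finset.mem_biUnion]
            exact ⟨p, hp, Finset.mem_filter.mpr ⟨hΩL _ hj, hpN⟩⟩
        _ ≤ S.card * (g * (L / P + 1)) := by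
            refine Finset.card_biUnion_le_card_mul _ _ _ fun p hp => ?_
            refine (hN p (hS p hp).1 (by have := (hS p hp).2; omega) a).trans ?_
            gcongr
            · omega
            · exact (hS p hp).2
        _ ≤ _ := by gcongr
  rw [hΩc] at hcard
  push_cast at hcard
  linarith

namespace NormData
variable {m : ℕ} (D : NormData m)

lemma exists_sg_bound : ∃ Λ : ℝ, 1 ≤ Λ ∧ ∀ (j : Fin (m + 2)) (A : Fin (m + 2) → ℤ) (s : ℝ),
    (∀ i, |(A i : ℝ)| ≤ s) → ‖D.sg j A‖ ≤ Λ * s := by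
  refine ⟨1 + ∑ j, ∑ i : Fin (m + 2), ‖D.θ j‖ ^ (i : ℕ), ?_, fun j A s hs => ?_⟩
  · have : 0 ≤ ∑ j, ∑ i : Fin (m + 2), ‖D.θ j‖ ^ (i : ℕ) := by positivity
    linarith
  have hs0 : 0 ≤ s := (abs_nonneg _).trans (hs 0)
  calc ‖D.sg j A‖ ≤ ∑ i : Fin (m + 2), s * ‖D.θ j‖ ^ (i : ℕ) := by
        refine (norm_sum_le _ _).trans (Finset.sum_le_sum fun i _ => ?_)
        rw [norm_mul, norm_pow, Complex.norm_intCast]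
        gcongr
        exact hs i
    _ = s * ∑ i : Fin (m + 2), ‖D.θ j‖ ^ (i : ℕ) := by rw [Finset.mul_sum]
    _ ≤ s * ∑ j, ∑ i : Fin (m + 2), ‖D.θ j‖ ^ (i : ℕ) := by
        refine mul_le_mul_of_nonneg_left ?_ hs0
        exact Finset.single_le_sum (f := fun j => ∑ i : Fin (m + 2), ‖D.θ j‖ ^ (i : ℕ))
          (fun _ _ => by positivity) (Finset.mem_univ j)
    _ ≤ _ := by linarith

lemma sg_add_smul (j : Fin (m + 2)) (K Q : ℤ) (B : Fin (m + 2) → ℤ) :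
    D.sg j (Pi.single 0 K + Q • B) = K + D.sg j (Q • B) := by
  rw [← emb_elt, elt_add, map_add, elt_single, emb_elt]
  simp

lemma sg_sub (j : Fin (m + 2)) (A B : Fin (m + 2) → ℤ) :
    D.sg j (A - B) = D.sg j A - D.sg j B := by
  simp only [sg, ← Finset.sum_sub_distrib, Pi.sub_apply, Int.cast_sub, sub_mul]

/-- A family of elements with norms in a short interval, each generating the kernel of an
evaluation. -/
structure Slab (Q : ℕ) (C T η : ℝ) (S : Finset ℕ) (𝒜 : Finset (Fin (m + 2) → ℤ))
    (ν : (Fin (m + 2) → ℤ) → ℤ) : Prop where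
  lower : ∀ A ∈ 𝒜, T ^ (m + 2) < |(D.nrm A : ℝ)|
  upper : ∀ A ∈ 𝒜, |(D.nrm A : ℝ)| ≤ T ^ (m + 2) * Real.exp η
  modEq : ∀ A ∈ 𝒜, (Q : ℤ) ∣ D.nrm A - 1
  not_dvd : ∀ A ∈ 𝒜, ∀ p ∈ S, ¬ (p : ℤ) ∣ D.nrm A
  dvd_eval : ∀ A ∈ 𝒜, D.nrm A ∣ D.G.eval (ν A)
  dvd_ev : ∀ A ∈ 𝒜, D.nrm A ∣ ev A (ν A)
  bound : ∀ A ∈ 𝒜, ∀ i, |(A i : ℝ)| ≤ C * T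
  narrow : ∀ A ∈ 𝒜, ∀ A' ∈ 𝒜, ∀ δ : ℝ, (∀ i, i ≠ 0 → |(A i - A' i : ℝ)| ≤ δ) →
    |(A 0 - A' 0 : ℝ)| ≤ C * (η * T + δ)

lemma eventually_slab_conditions {c₁ K₀ K₁ : ℝ} (hc : 0 < c₁) :
    ∃ T₀ : ℝ, 1 ≤ T₀ ∧ ∀ T ≥ T₀, K₀ + K₁ * Real.log T ≤ c₁ * T ^ (9 / 10 : ℝ) := by
  have h1 : (fun T : ℝ => K₀ + K₁ * Real.log T) =o[Filter.atTop] fun T : ℝ => T ^ (9 / 10 : ℝ) := by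
    refine Asymptotics.IsLittleO.add ?_ ?_
    · refine Asymptotics.isLittleO_const_left.mpr (Or.inr ?_)
      exact tendsto_norm_atTop_atTop.comp (tendsto_rpow_atTop (by norm_num))
    · exact (isLittleO_log_rpow_atTop (by norm_num)).const_mul_left _
  obtain ⟨T₀, h⟩ := Filter.eventually_atTop.mp (h1.bound hc)
  refine ⟨max T₀ 1, le_max_right _ _, fun T hT => ?_⟩
  have h2 := h T ((le_max_left _ _).trans hT)
  have hT1 : 1 ≤ T := (le_max_right _ _).trans hT
  rw [Real.norm_of_nonneg (by positivity : (0 : ℝ) ≤ T ^ (9 / 10 : ℝ))] at h2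
  exact (le_abs_self _).trans h2

set_option maxHeartbeats 2000000 in
lemma exists_slab {D₀ : ℕ} (hD₀ : 32 * (∑ i : Fin (m + 2), (i : ℕ)) * (m + 2) ≤ D₀) (hD₁ : 1 ≤ D₀) :
    ∃ c C : ℝ, 0 < c ∧ 0 < C ∧ ∀ k : ℕ, ∃ (T₀ : ℝ) (P : ℕ), 1 ≤ T₀ ∧ ∀ T ≥ T₀, ∀ η : ℝ,
      T ^ (-(1 / 10) : ℝ) ≤ η → η ≤ 1 / 2 → ∀ S : Finset ℕ, S.card ≤ k →
      (∀ p ∈ S, p.Prime ∧ P ≤ p) → ∃ 𝒜 ν, D.Slab D₀.factorial C T η S 𝒜 ν ∧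
        c * η * T ^ (m + 2) ≤ (𝒜.card : ℝ) := by
  set Q := D₀.factorial with hQ
  set g := m + 2 with hg
  set d := ∑ i : Fin (m + 2), (i : ℕ) with hd
  obtain ⟨Λ, hΛ1, hΛ⟩ := D.exists_sg_bound
  obtain ⟨CI, hCI1, hCI⟩ := D.exists_idx_bound
  have hQ1 : 1 ≤ Q := Nat.factorial_pos _
  have hQr : (1 : ℝ) ≤ Q := by exact_mod_cast hQ1
  have hQ0 : (0 : ℝ) < Q := by linarith
  have hQz : (Q : ℤ) ≠ 0 := Int.natCast_ne_zero.mpr (Nat.one_le_iff_ne_zero.mp hQ1)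
  have hΛ0 : 0 < Λ := by linarith
  have hg0 : (0 : ℝ) < g := by rw [hg]; positivity
  refine ⟨1 / (128 * Q * Λ) ^ (m + 1) * (1 / (20 * g * Q)) / 2, 24 + 2 * Λ, by positivity,
    by positivity, fun k => ?_⟩
  obtain ⟨T₁, hT₁1, hT₁⟩ := eventually_slab_conditions
    (c₁ := 1 / (64 * Q * Λ * (10 * g))) (K₀ := 2 * (1 + D₀ + 8 * d + 16 * g * k) + 2 * (16 * g *
      (Real.log CI / Real.log 2 + 1))) (K₁ := 2 * (16 * g * (g * g / Real.log 2))) (by positivity)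
  refine ⟨max T₁ (64 * Q * Λ), 16 * g * k + D₀ + 1, le_max_of_le_left hT₁1,
    fun T hT η hη hη2 S hSk hS => ?_⟩
  have hTT₁ : T₁ ≤ T := (le_max_left _ _).trans hT
  have hT64' : 64 * Q * Λ ≤ T := (le_max_right _ _).trans hT
  have hT1 : 1 ≤ T := hT₁1.trans hTT₁
  have hT0 : 0 < T := by linarith
  have hT64 : 64 * Q ≤ T := le_trans (by nlinarith) hT64'
  have hη0 : 0 < η := lt_of_lt_of_le (by positivity) hη
  have hηT : T ^ (9 / 10 : ℝ) ≤ η * T := by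
    calc T ^ (9 / 10 : ℝ) = T ^ (-(1 / 10) : ℝ) * T ^ (1 : ℝ) := by
          rw [← Real.rpow_add hT0]; norm_num
      _ = T ^ (-(1 / 10) : ℝ) * T := by rw [Real.rpow_one]
      _ ≤ _ := by gcongr
  set W := ⌊T / (64 * Q * Λ)⌋₊ with hW
  set L := ⌊η * T / (10 * g * Q)⌋₊ with hL
  set E := ⌈(Real.log CI + g * g * Real.log T) / Real.log 2⌉₊ with hE
  have hlogT : 0 ≤ Real.log T := Real.log_nonneg hT1
  have hlogC : 0 ≤ Real.log CI := Real.log_nonneg hCI1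
  have hlog2 : 0 < Real.log 2 := Real.log_pos (by norm_num)
  have hEle : (E : ℝ) ≤ (Real.log CI / Real.log 2 + 1) + g * g / Real.log 2 * Real.log T := by
    refine (Nat.ceil_lt_add_one (by positivity)).le.trans (le_of_eq ?_)
    field_simp; ring
  have hmain := hT₁ T hTT₁
  set X : ℝ := 1 / (64 * Q * Λ * (10 * g)) * T ^ (9 / 10 : ℝ) with hX
  have hX2 : 2 * (1 + D₀ + 8 * d + 16 * g * k + 16 * g * E : ℝ) ≤ X := by
    have : 16 * g * (E : ℝ) ≤ 16 * g * ((Real.log CI / Real.log 2 + 1) + g * g / Real.log 2 * Real.log T) := by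
      gcongr
    refine le_trans ?_ hmain
    linarith
  have hXW : X ≤ T / (64 * Q * Λ) := by
    rw [hX]
    have h2 : T ^ (9 / 10 : ℝ) ≤ T := by
      calc T ^ (9 / 10 : ℝ) ≤ T ^ (1 : ℝ) := Real.rpow_le_rpow_of_exponent_le hT1 (by norm_num)
        _ = T := Real.rpow_one T
    have h3 : (1 : ℝ) ≤ 10 * g := by
      have : (1 : ℝ) ≤ g := by exact_mod_cast (by omega : 1 ≤ g)
      linarith
    calc 1 / (64 * Q * Λ * (10 * g)) * T ^ (9 / 10 : ℝ) ≤ 1 / (64 * Q * Λ * 1) * T := by gcongr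
      _ = _ := by ring
  have hXL : X ≤ η * T / (10 * g * Q) := by
    rw [hX]
    calc 1 / (64 * Q * Λ * (10 * g)) * T ^ (9 / 10 : ℝ) ≤ 1 / (1 * Q * 1 * (10 * g)) * (η * T) := by
          gcongr
          norm_num
      _ = _ := by field_simp
  have hsum0 : (0 : ℝ) ≤ D₀ + 8 * d + 16 * g * k + 16 * g * E := by positivity
  have hWlow : T / (64 * Q * Λ) / 2 ≤ W := by
    have := Nat.lt_floor_add_one (T / (64 * Q * Λ))
    rw [← hW] at this
    linarith
  have hLlow : η * T / (10 * g * Q) / 2 ≤ L := by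
    have := Nat.lt_floor_add_one (η * T / (10 * g * Q))
    rw [← hL] at this
    linarith
  have hWX : (1 + D₀ + 8 * d + 16 * g * k + 16 * g * E) ≤ W := by
    have : (1 + D₀ + 8 * d + 16 * g * k + 16 * g * E : ℝ) ≤ W := by linarith
    exact_mod_cast this
  have hLX : (1 + D₀ + 8 * d + 16 * g * k + 16 * g * E) ≤ L := by
    have : (1 + D₀ + 8 * d + 16 * g * k + 16 * g * E : ℝ) ≤ L := by linarith
    exact_mod_cast this
  have hWup : (W : ℝ) ≤ T / (64 * Q * Λ) := Nat.floor_le (by positivity)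
  have hLup : (L : ℝ) ≤ η * T / (10 * g * Q) := Nat.floor_le (by positivity)
  have hWr : (1 : ℝ) ≤ W := by exact_mod_cast (by omega : 1 ≤ W)
  have hWT : (W : ℝ) ≤ T := hWup.trans (div_le_self hT0.le (by nlinarith))
  let B : (Fin (m + 1) → ℕ) → Fin (m + 2) → ℤ := fun a => Fin.cons 0 fun i => (a i : ℤ)
  set U := Fintype.piFinset fun _ : Fin (m + 1) => Finset.range W with hU
  have hUW : ∀ a ∈ U, ∀ i, a i < W := fun a ha i =>
    Finset.mem_range.mp (Fintype.mem_piFinset.mp ha i)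
  have hBb : ∀ a ∈ U, ∀ i, |(B a i : ℝ)| ≤ W := by
    intro a ha i
    refine Fin.cases ?_ (fun i => ?_) i
    · simp [B]
    · simp only [B, Fin.cons_succ, Int.cast_natCast, Nat.abs_cast]
      exact_mod_cast (hUW a ha i).le
  have hQB : ∀ a, ∀ i, (((Q : ℤ) • B a) i : ℝ) = Q * (B a i : ℝ) := by
    intro a i; simp
  have hsB : ∀ a ∈ U, ∀ j, ‖D.sg j ((Q : ℤ) • B a)‖ ≤ T / 64 := by
    intro a ha j
    refine (hΛ j _ (Q * W) fun i => ?_).trans ?_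
    · rw [hQB, abs_mul, abs_of_pos hQ0]
      have := hBb a ha i
      gcongr
    · calc Λ * (Q * W) ≤ Λ * (Q * (T / (64 * Q * Λ))) := by gcongr
        _ = T / 64 := by field_simp
  have hwin : ∀ a, ∃ κ : ℕ, a ∈ U → ∀ i < L,
      T ^ g < ∏ j, ‖((1 + Q * (κ + i) : ℝ) : ℂ) + D.sg j ((Q : ℤ) • B a)‖ ∧
      ∏ j, ‖((1 + Q * (κ + i) : ℝ) : ℂ) + D.sg j ((Q : ℤ) • B a)‖ ≤ T ^ g * Real.exp η ∧
      T / 4 ≤ 1 + Q * (κ + i) ∧ (1 + Q * (κ + i) : ℝ) ≤ 2 * T := by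
    intro a
    by_cases ha : a ∈ U
    · obtain ⟨κ, h⟩ := exists_window (n := g) (by omega) hQ1 hT64 hη0 hη2 hLup
        (fun j => D.sg j ((Q : ℤ) • B a)) (hsB a ha)
      exact ⟨κ, fun _ => h⟩
    · exact ⟨0, fun h => absurd h ha⟩
  choose κ hκ using hwin
  let A : (Fin (m + 1) → ℕ) × ℕ → Fin (m + 2) → ℤ := fun x =>
    Pi.single 0 (1 + (Q : ℤ) * (κ x.1 + x.2)) + (Q : ℤ) • B x.1
  have hA0 : ∀ x, A x 0 = 1 + (Q : ℤ) * (κ x.1 + x.2) := by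
    intro x; simp [A, B]
  have hAs : ∀ x (i : Fin (m + 1)), A x i.succ = Q * x.1 i := by
    intro x i; simp [A, B]
  have hnrm : ∀ x, (|D.nrm (A x)| : ℝ) =
      ∏ j, ‖((1 + Q * (κ x.1 + x.2) : ℝ) : ℂ) + D.sg j ((Q : ℤ) • B x.1)‖ := by
    intro x
    rw [abs_nrm]
    refine Finset.prod_congr rfl fun j _ => ?_
    rw [sg_add_smul]; push_cast; rfl
  have hD0Q : ∀ p : ℕ, p.Prime → D₀ < p → ¬ (p : ℤ) ∣ (Q : ℤ) := by
    intro p hp hpD h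
    rw [Int.natCast_dvd_natCast, hQ, hp.dvd_factorial] at h
    omega
  have hmod : ∀ x, (Q : ℤ) ∣ D.nrm (A x) - 1 := by
    intro x
    refine D.nrm_modEq_one ⟨κ x.1 + x.2, by rw [hA0]; ring⟩ fun i hi => ?_
    obtain ⟨i, rfl⟩ := Fin.exists_succ_eq_of_ne_zero hi
    exact ⟨x.1 i, by rw [hAs]⟩
  have hcons : ∀ (b : Fin m → ℕ) (t : ℕ), B (Fin.cons t b) = B (Fin.cons 0 b) + Pi.single 1 (t : ℤ) := by
    intro b t
    funext i
    refine Fin.cases ?_ (fun i => ?_) i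
    · simp [B]
    · refine Fin.cases ?_ (fun i => ?_) i
      · simp [B]
      · have : (i.succ.succ : Fin (m + 2)) ≠ 1 := by
          rw [← Fin.succ_zero_eq_one, Ne, Fin.succ_inj]; exact Fin.succ_ne_zero _
        simp [B, this]
  have hcount := card_good_ge (m := m) (g := g) (d := d) (D₀ := D₀) (M := min W L) (W := W) (L := L)
    (E := E) (k := k) (P := 16 * g * k + D₀ + 1) (fun a j => D.nrm (A (a, j))) (fun a => D.idx (B a))
    (by omega) ?_ ?_ ?_ ?_ (by rw [mul_assoc] at hD₀ ⊢; exact hD₀) hD₁ (by rw [le_min_iff]; constructor <;> omega) (min_le_left _ _)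
    (min_le_right _ _) (by omega) (by rw [le_min_iff]; constructor <;> omega) S hSk hS (by omega) (by omega) (by omega)
  · set Gd := (U ×ˢ Finset.range L).filter fun x => (∀ p : ℕ, p.Prime → D₀ < p →
      (p : ℤ) ∣ D.nrm (A (x.1, x.2)) → ¬ (p : ℤ) ∣ D.idx (B x.1)) ∧
      ∀ p ∈ S, ¬ (p : ℤ) ∣ D.nrm (A (x.1, x.2)) with hGd
    have hGdm : ∀ x ∈ Gd, x.1 ∈ U ∧ x.2 < L ∧ (∀ p : ℕ, p.Prime → D₀ < p →
      (p : ℤ) ∣ D.nrm (A x) → ¬ (p : ℤ) ∣ D.idx (B x.1)) ∧ ∀ p ∈ S, ¬ (p : ℤ) ∣ D.nrm (A x) := by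
      intro x hx
      rw [hGd, Finset.mem_filter, Finset.mem_product, Finset.mem_range] at hx
      exact ⟨hx.1.1, hx.1.2, hx.2⟩
    have hcopQ : ∀ x, IsCoprime (D.nrm (A x)) (Q : ℤ) := by
      intro x
      obtain ⟨b, hb⟩ := hmod x
      exact ⟨1, -b, by linarith⟩
    have hroot : ∀ A' : Fin (m + 2) → ℤ, ∃ ν : ℤ, A' ∈ Gd.image A → D.elt A' ∣ D.rt - ν := by
      intro A'
      by_cases h : A' ∈ Gd.image A
      · rw [Finset.mem_image] at h
        obtain ⟨x, hx, rfl⟩ := h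
        obtain ⟨ν, hν⟩ := D.exists_root_of_coprime (A := A x) (B := B x.1) rfl (hcopQ x) (by
          rw [Int.isCoprime_iff_gcd_eq_one]
          by_contra hne
          obtain ⟨p, hp, hpd⟩ := Nat.exists_prime_and_dvd hne
          have h1 : (p : ℤ) ∣ D.nrm (A x) := (Int.natCast_dvd_natCast.mpr hpd).trans (Int.gcd_dvd_left _ _)
          have h2 : (p : ℤ) ∣ D.idx (B x.1) := (Int.natCast_dvd_natCast.mpr hpd).trans (Int.gcd_dvd_right _ _)
          refine (hGdm x hx).2.2.1 p hp ?_ h1 h2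
          by_contra hle
          have h3 : (p : ℤ) ∣ (Q : ℤ) :=
            Int.natCast_dvd_natCast.mpr (hp.dvd_factorial.mpr (not_lt.mp hle))
          have h4 := (hcopQ x).isUnit_of_dvd' h1 h3
          exact hp.one_lt.ne' (by simpa [Int.isUnit_iff_natAbs_eq] using h4))
        exact ⟨ν, fun _ => hν⟩
      · exact ⟨0, fun h' => absurd h' h⟩
    choose ν hν using hroot
    have hAinj : Function.Injective A := by
      intro x y e
      have h1 : x.1 = y.1 := by
        funext i
        have := congrFun e i.succ
        rw [hAs, hAs] at this
        have := mul_left_cancel₀ hQz this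
        exact_mod_cast this
      have h2 := congrFun e 0
      rw [hA0, hA0, h1] at h2
      have h3 := mul_left_cancel₀ hQz (add_left_cancel h2)
      exact Prod.ext h1 (by exact_mod_cast add_left_cancel h3)
    refine ⟨Gd.image A, ν, ⟨?_, ?_, ?_, ?_, ?_, ?_, ?_, ?_⟩, ?_⟩
    · rw [Finset.forall_mem_image]
      intro x hx
      have h := hGdm x hx
      rw [hnrm]; exact (hκ x.1 h.1 x.2 h.2.1).1
    · rw [Finset.forall_mem_image]
      intro x hx
      have h := hGdm x hx
      rw [hnrm]; exact (hκ x.1 h.1 x.2 h.2.1).2.1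
    · rw [Finset.forall_mem_image]
      exact fun x _ => hmod x
    · rw [Finset.forall_mem_image]
      exact fun x hx => (hGdm x hx).2.2.2
    · exact fun A' hA' => (D.nrm_dvd_of_dvd (hν A' hA')).1
    · exact fun A' hA' => (D.nrm_dvd_of_dvd (hν A' hA')).2
    · rw [Finset.forall_mem_image]
      intro x hx i
      have h := hGdm x hx
      refine Fin.cases ?_ (fun i => ?_) i
      · rw [hA0]
        have h1 := hκ x.1 h.1 x.2 h.2.1
        push_cast
        rw [abs_of_pos (by positivity)]
        have h2 := h1.2.2.2
        have h3 := mul_pos hΛ0 hT0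
        linarith
      · rw [hAs]
        push_cast
        rw [abs_of_nonneg (by positivity)]
        have h1 : (x.1 i : ℝ) ≤ T / (64 * Q * Λ) :=
          le_trans (by exact_mod_cast (hUW _ h.1 i).le) hWup
        calc (Q : ℝ) * x.1 i ≤ Q * (T / (64 * Q * Λ)) := by gcongr
          _ = T / (64 * Λ) := by field_simp
          _ ≤ T := div_le_self hT0.le (by linarith)
          _ ≤ _ := by
            have h3 := mul_pos hΛ0 hT0
            linarith
    · rw [Finset.forall_mem_image]
      intro x hx
      rw [Finset.forall_mem_image]
      intro y hy δ hδ
      have hδ0 : 0 ≤ δ := (abs_nonneg _).trans (hδ 1 (by simp))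
      have hx' := hGdm x hx
      have hy' := hGdm y hy
      have hδs : ∀ j, ‖D.sg j ((Q : ℤ) • B x.1) - D.sg j ((Q : ℤ) • B y.1)‖ ≤ Λ * δ := by
        intro j
        rw [← sg_sub]
        refine hΛ j _ _ fun i => ?_
        refine Fin.cases ?_ (fun i => ?_) i
        · simpa [B] using hδ0
        · have := hδ i.succ (Fin.succ_ne_zero i)
          rw [hAs, hAs] at this
          simpa [B] using this
      have hδs' : ∀ j, ‖D.sg j ((Q : ℤ) • B y.1) - D.sg j ((Q : ℤ) • B x.1)‖ ≤ Λ * δ := by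
        intro j; rw [norm_sub_rev]; exact hδs j
      have hxk := hκ x.1 hx'.1 x.2 hx'.2.1
      have hyk := hκ y.1 hy'.1 y.2 hy'.2.1
      have hx0 : (A x 0 : ℝ) = 1 + Q * (κ x.1 + x.2) := by rw [hA0]; push_cast; ring
      have hy0 : (A y 0 : ℝ) = 1 + Q * (κ y.1 + y.2) := by rw [hA0]; push_cast; ring
      rw [← hx0] at hxk
      rw [← hy0] at hyk
      have hfin : 2 * (Λ * δ) + 24 * η * T ≤ (24 + 2 * Λ) * (η * T + δ) := by
        have : 0 ≤ Λ * (η * T) := by positivity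
        nlinarith
      refine le_trans ?_ hfin
      rcases le_total (A x 0 : ℝ) (A y 0 : ℝ) with hle | hle
      · rw [abs_sub_comm, abs_of_nonneg (by linarith)]
        exact abs_sub_le_of_prod (by omega) hT0 hη0 hη2 _ _ (hsB x.1 hx'.1) hδs (by positivity)
          hxk.2.2.1 hxk.2.2.2 hxk.1 hyk.2.1 hle
      · rw [abs_of_nonneg (by linarith)]
        exact abs_sub_le_of_prod (by omega) hT0 hη0 hη2 _ _ (hsB y.1 hy'.1) hδs' (by positivity)
          hyk.2.2.1 hyk.2.2.2 hyk.1 hxk.2.1 hle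
    · rw [Finset.card_image_of_injective _ hAinj]
      refine le_trans ?_ hcount
      calc 1 / (128 * Q * Λ) ^ (m + 1) * (1 / (20 * g * Q)) / 2 * η * T ^ (m + 2)
          = (T / (64 * Q * Λ) / 2) ^ (m + 1) * (η * T / (10 * g * Q) / 2) / 2 := by
            rw [div_div, div_div _ _ (2 : ℝ), div_pow]
            field_simp
            ring
        _ ≤ _ := by gcongr
  · intro p hp hpD a
    obtain ⟨f, hf, hfd, hfe⟩ := D.exists_nrm_poly ((Q : ℤ) • B a)
    have := card_filter_dvd_eval_le hf hp (hD0Q p hp hpD) (1 + Q * κ a) L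
    rw [hfd] at this
    refine le_trans (Finset.card_le_card fun j hj => ?_) this
    rw [Finset.mem_filter] at hj ⊢
    refine ⟨hj.1, ?_⟩
    rw [← hfe]
    have e : (Q : ℤ) • B a + Pi.single 0 (1 + (Q : ℤ) * κ a + Q * j) = A (a, j) := by
      simp only [A]
      rw [mul_add, ← add_assoc]
      exact add_comm _ _
    rw [e]; exact hj.2
  · intro p hp hpD b
    obtain ⟨f, hf, hfd, hfe⟩ := D.exists_idx_poly (B (Fin.cons 0 b))
    have := card_filter_dvd_eval_le hf hp (q := 1) (fun h => hp.one_lt.ne' (by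
      simpa using Int.natAbs_dvd_natAbs.mpr h)) 0 W
    rw [hfd] at this
    refine le_trans (Finset.card_le_card fun j hj => ?_) this
    rw [Finset.mem_filter] at hj ⊢
    refine ⟨hj.1, ?_⟩
    rw [zero_add, one_mul, ← hfe, ← hcons]
    exact hj.2
  · intro b
    obtain ⟨f, hf, hfd, hfe⟩ := D.exists_idx_poly (B (Fin.cons 0 b))
    rw [← hd] at hfd
    rw [← hfd]
    have h1 := (Multiset.toFinset_card_le f.roots).trans (Polynomial.card_roots' f)
    refine le_trans ?_ h1
    refine Finset.card_le_card_of_injOn (fun t : ℕ => (t : ℤ)) (fun t ht => ?_)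
      (fun _ _ _ _ e => Nat.cast_injective (R := ℤ) e)
    rw [Finset.mem_coe, Finset.mem_filter] at ht
    rw [Finset.mem_coe, Multiset.mem_toFinset, Polynomial.mem_roots hf.ne_zero, Polynomial.IsRoot,
      ← hfe, ← hcons]
    exact ht.2
  · intro a ha
    have h1 := hCI (B a) W hWr (hBb a ha)
    have h2 : CI * (W : ℝ) ^ (g * g) ≤ 2 ^ E := by
      calc CI * (W : ℝ) ^ (g * g) ≤ CI * T ^ (g * g) := by gcongr
        _ = Real.exp (Real.log CI + g * g * Real.log T) := by
          rw [Real.exp_add, Real.exp_log (by linarith)]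
          congr 1
          rw [← Nat.cast_mul, Real.exp_nat_mul, Real.exp_log hT0]
        _ ≤ Real.exp (E * Real.log 2) := by
          gcongr
          have := Nat.le_ceil ((Real.log CI + g * g * Real.log T) / Real.log 2)
          rwa [← hE, div_le_iff₀ hlog2] at this
        _ = 2 ^ E := by rw [Real.exp_nat_mul, Real.exp_log (by norm_num)]
    have h3 := h1.trans h2
    have h4 : (((D.idx (B a)).natAbs : ℕ) : ℝ) ≤ ((2 ^ E : ℕ) : ℝ) := by
      rw [Nat.cast_natAbs]; push_cast; exact h3
    exact_mod_cast h4

end NormData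

lemma abs_floor_sub_floor_le {a b R : ℝ} (h : |a - b| ≤ R) : |((⌊a⌋ - ⌊b⌋ : ℤ) : ℝ)| ≤ R + 1 := by
  rw [abs_le] at h ⊢
  push_cast
  constructor <;> linarith [Int.floor_le a, Int.floor_le b, Int.lt_floor_add_one a, Int.lt_floor_add_one b]

lemma card_int_le_of_abs_sub_le {t : Finset ℤ} {R : ℝ} (hR : 0 ≤ R) (c : ℤ)
    (h : ∀ x ∈ t, |((x - c : ℤ) : ℝ)| ≤ R) : (t.card : ℝ) ≤ 2 * R + 1 := by
  have h1 : t ⊆ Finset.Icc (c - ⌊R⌋) (c + ⌊R⌋) := by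
    intro x hx
    have := abs_le.mp (h x hx)
    have h2 : x - c ≤ ⌊R⌋ := Int.le_floor.mpr this.2
    have h3 : c - x ≤ ⌊R⌋ := Int.le_floor.mpr (by push_cast at this ⊢; linarith)
    rw [Finset.mem_Icc]; constructor <;> linarith
  have h2 := Finset.card_le_card h1
  rw [Int.card_Icc] at h2
  have h3 : 0 ≤ ⌊R⌋ := Int.floor_nonneg.mpr hR
  have h4 : ((t.card : ℤ) : ℝ) ≤ ((2 * ⌊R⌋ + 1 : ℤ) : ℝ) := by
    exact_mod_cast (by omega : (t.card : ℤ) ≤ 2 * ⌊R⌋ + 1)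
  push_cast at h4
  linarith [Int.floor_le R]

lemma card_le_mul_card_fibers {α β : Type*} [DecidableEq β] {s : Finset α} {t : Finset β} (f : α → β) {K : ℝ}
    (hf : ∀ x ∈ s, f x ∈ t) (h : ∀ b ∈ t, ((s.filter fun x => f x = b).card : ℝ) ≤ K) :
    (s.card : ℝ) ≤ K * t.card := by
  rw [Finset.card_eq_sum_card_fiberwise hf]
  push_cast
  calc _ ≤ ∑ b ∈ t, K := Finset.sum_le_sum h
    _ = _ := by simp [mul_comm]

namespace NormData
variable {m : ℕ} (D : NormData m)

lemma ev_sub (A B : Fin (m + 2) → ℤ) (μ : ℤ) : ev (A - B) μ = ev A μ - ev B μ := by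
  simp only [ev, ← Finset.sum_sub_distrib, Pi.sub_apply, sub_mul]

lemma eq_of_abs_sub_lt {Λ : ℝ} (hΛ : ∀ (j : Fin (m + 2)) (A : Fin (m + 2) → ℤ) (s : ℝ),
    (∀ i, |(A i : ℝ)| ≤ s) → ‖D.sg j A‖ ≤ Λ * s) {h : ℕ} {μ : ℤ} (hμ : (h : ℤ) ∣ D.G.eval μ)
    {A B : Fin (m + 2) → ℤ} (hA : (h : ℤ) ∣ ev A μ) (hB : (h : ℤ) ∣ ev B μ) {s : ℝ}
    (hs : (Λ * s) ^ (m + 2) < h) (hAB : ∀ i, |(A i - B i : ℝ)| ≤ s) : A = B := by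
  by_contra hne
  have h1 : A - B ≠ 0 := sub_ne_zero.mpr hne
  have h2 := D.nrm_ne_zero h1
  have h3 : (h : ℤ) ∣ D.nrm (A - B) := D.dvd_nrm hμ (by rw [ev_sub]; exact dvd_sub hA hB)
  have h4 : (h : ℤ) ≤ |D.nrm (A - B)| := Int.le_of_dvd (abs_pos.mpr h2) ((dvd_abs _ _).mpr h3)
  have h5 : (|D.nrm (A - B)| : ℝ) ≤ (Λ * s) ^ (m + 2) := by
    rw [abs_nrm]
    calc _ ≤ ∏ _j : Fin (m + 2), (Λ * s) := Finset.prod_le_prod (fun _ _ => norm_nonneg _)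
          fun j _ => hΛ j _ _ fun i => by simpa using hAB i
      _ = _ := by simp
  have h6 : (h : ℝ) ≤ |(D.nrm (A - B) : ℝ)| := by
    rw [← Int.cast_abs]; exact_mod_cast h4
  linarith

lemma card_slab_filter_dvd_le {C : ℝ} (hC : 0 < C) : ∃ C' : ℝ, 0 < C' ∧ ∀ (Q : ℕ) (T η : ℝ) (S : Finset ℕ)
    (𝒜 : Finset (Fin (m + 2) → ℤ)) (ν : (Fin (m + 2) → ℤ) → ℤ), D.Slab Q C T η S 𝒜 ν → 0 < T →
    ∀ (h : ℕ) (μ : ℤ), 0 < h → (h : ℤ) ∣ D.G.eval μ → ∀ ω : ℝ, 0 < ω → η ≤ ω → ω ≤ 1 →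
    (h : ℝ) ≤ 2 * (ω * T) ^ (m + 2) →
    ((𝒜.filter fun A => (h : ℤ) ∣ ev A μ).card : ℝ) ≤ C' * (ω * T ^ (m + 2) / h) := by
  obtain ⟨Λ, hΛ1, hΛ⟩ := D.exists_sg_bound
  have hΛ0 : 0 < Λ := by linarith
  set K : ℝ := 4 * C + 5 with hK
  refine ⟨(K * (2 * Λ)) ^ (m + 2), by positivity, fun Q T η S 𝒜 ν hsl hT h μ hh hμ ω hω hηω hω1 hhω => ?_⟩
  set r : ℝ := (h : ℝ) ^ (1 / (m + 2 : ℝ)) with hr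
  have hh0 : (0 : ℝ) < h := by exact_mod_cast hh
  have hr0 : 0 < r := by positivity
  have hrp : r ^ (m + 2) = h := by
    rw [hr, ← Real.rpow_natCast, ← Real.rpow_mul hh0.le]
    push_cast
    rw [one_div_mul_cancel (by positivity), Real.rpow_one]
  have hrω : r ≤ 2 * (ω * T) := by
    refine le_of_pow_le_pow_left₀ (n := m + 2) (by omega) (by positivity) ?_
    rw [hrp, mul_pow]
    refine hhω.trans ?_
    gcongr
    exact le_self_pow₀ (by norm_num) (by omega)
  set s : ℝ := r / (2 * Λ) with hs
  have hs0 : 0 < s := by positivity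
  have hsω : s ≤ ω * T := by
    rw [hs, div_le_iff₀ (by positivity)]
    have : 0 < ω * T := by positivity
    nlinarith
  have hωT : ω * T ≤ T := by nlinarith
  have hsT : s ≤ T := hsω.trans hωT
  have hsh : (Λ * s) ^ (m + 2) < h := by
    have : Λ * s = r / 2 := by rw [hs]; field_simp
    rw [this, ← hrp]
    exact pow_lt_pow_left₀ (by linarith) (by positivity) (by omega)
  set 𝒮 := 𝒜.filter fun A => (h : ℤ) ∣ ev A μ with h𝒮
  have hinj : ∀ A ∈ 𝒮, ∀ B ∈ 𝒮, (∀ i, ⌊(A i : ℝ) / s⌋ = ⌊(B i : ℝ) / s⌋) → A = B := by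
    intro A hA B hB hAB
    refine D.eq_of_abs_sub_lt hΛ hμ (Finset.mem_filter.mp hA).2 (Finset.mem_filter.mp hB).2 hsh fun i => ?_
    have := (Int.abs_sub_lt_one_of_floor_eq_floor (hAB i)).le
    rw [← sub_div, abs_div, abs_of_pos hs0, div_le_one hs0] at this
    exact this
  have hTs : 1 ≤ T / s := by rw [le_div_iff₀ hs0]; linarith
  have hωTs : 1 ≤ ω * T / s := by rw [le_div_iff₀ hs0]; linarith
  let I : Finset ℤ := Finset.Icc (-⌊C * T / s + 1⌋) ⌊C * T / s + 1⌋
  have hI : (I.card : ℝ) ≤ K * (T / s) := by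
    have h1 := card_int_le_of_abs_sub_le (t := I) (R := C * T / s + 1) (by positivity) 0 ?_
    · rw [mul_div_assoc] at h1
      have : 0 < C * (T / s) := by positivity
      nlinarith
    · intro x hx
      rw [Finset.mem_Icc] at hx
      have h1 : (x : ℝ) ≤ ⌊C * T / s + 1⌋ := by exact_mod_cast hx.2
      have h2 : -((⌊C * T / s + 1⌋ : ℤ) : ℝ) ≤ (x : ℝ) := by exact_mod_cast hx.1
      have := Int.floor_le (C * T / s + 1)
      rw [sub_zero, abs_le]; constructor <;> linarith
  have hmain := card_le_mul_card_fibers (s := 𝒮) (t := Fintype.piFinset fun _ : Fin (m + 1) => I)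
    (K := K * (ω * T / s)) (fun A => fun i : Fin (m + 1) => ⌊(A i.succ : ℝ) / s⌋) ?_ ?_
  · rw [Fintype.card_piFinset_const] at hmain
    push_cast at hmain
    calc (𝒮.card : ℝ) ≤ _ := hmain
      _ ≤ K * (ω * T / s) * (K * (T / s)) ^ (m + 1) := by gcongr
      _ = K ^ (m + 2) * ω * T ^ (m + 2) / s ^ (m + 2) := by
          rw [mul_pow, div_pow]; field_simp; ring
      _ = K ^ (m + 2) * ω * T ^ (m + 2) * (2 * Λ) ^ (m + 2) / h := by
          rw [hs, div_pow, hrp]; field_simp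
      _ = (K * (2 * Λ)) ^ (m + 2) * (ω * T ^ (m + 2) / h) := by rw [mul_pow K (2 * Λ)]; ring
  · intro A hA
    rw [Fintype.mem_piFinset]
    intro i
    have h1 := hsl.bound A (Finset.mem_filter.mp hA).1 i.succ
    have h2 : |(A i.succ : ℝ) / s| ≤ C * T / s := by
      rw [abs_div, abs_of_pos hs0]; gcongr
    have h3 := abs_le.mp h2
    rw [Finset.mem_Icc]
    constructor
    · rw [neg_le]
      refine Int.le_floor.mpr ?_
      push_cast
      linarith [Int.lt_floor_add_one ((A i.succ : ℝ) / s)]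
    · exact Int.floor_le_floor (by linarith)
  · intro b _
    rcases (𝒮.filter fun A => (fun i : Fin (m + 1) => ⌊(A i.succ : ℝ) / s⌋) = b).eq_empty_or_nonempty with he | ⟨A₀, hA₀⟩
    · rw [he]; simp; positivity
    · rw [Finset.mem_filter] at hA₀
      have e : (𝒮.filter fun A => (fun i : Fin (m + 1) => ⌊(A i.succ : ℝ) / s⌋) = b).card =
          ((𝒮.filter fun A => (fun i : Fin (m + 1) => ⌊(A i.succ : ℝ) / s⌋) = b).image
            fun A => ⌊(A 0 : ℝ) / s⌋).card := by
        refine (Finset.card_image_of_injOn fun A hA B hB hAB => ?_).symm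
        rw [Finset.mem_coe, Finset.mem_filter] at hA hB
        refine hinj A hA.1 B hB.1 fun i => ?_
        refine Fin.cases hAB (fun i => ?_) i
        exact (congrFun hA.2 i).trans (congrFun hB.2 i).symm
      rw [e]
      have h1 := card_int_le_of_abs_sub_le (R := C * (η * T + s) / s + 1)
        (t := (𝒮.filter fun A => (fun i : Fin (m + 1) => ⌊(A i.succ : ℝ) / s⌋) = b).image
            fun A => ⌊(A 0 : ℝ) / s⌋) ?_ ⌊(A₀ 0 : ℝ) / s⌋ ?_
      · refine h1.trans ?_
        have h2 : C * (η * T + s) / s ≤ C * (2 * (ω * T)) / s := by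
          gcongr
          nlinarith
        have h3 : C * (2 * (ω * T)) / s = 2 * C * (ω * T / s) := by ring
        rw [h3] at h2
        rw [hK]
        linarith
      · have h2 : 0 ≤ C * (η * T + s) := by
          have := hsl.narrow A₀ (Finset.mem_filter.mp hA₀.1).1 A₀ (Finset.mem_filter.mp hA₀.1).1 s
            (fun i _ => by simp [hs0.le])
          simpa using this
        positivity
      · rw [Finset.forall_mem_image]
        intro A hA
        rw [Finset.mem_filter] at hA
        refine abs_floor_sub_floor_le ?_
        rw [← sub_div, abs_div, abs_of_pos hs0]
        gcongr
        refine hsl.narrow A (Finset.mem_filter.mp hA.1).1 A₀ (Finset.mem_filter.mp hA₀.1).1 s fun i hi => ?_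
        obtain ⟨i, rfl⟩ := Fin.exists_succ_eq_of_ne_zero hi
        have h4 : ⌊(A i.succ : ℝ) / s⌋ = ⌊(A₀ i.succ : ℝ) / s⌋ :=
          (congrFun hA.2 i).trans (congrFun hA₀.2 i).symm
        have := (Int.abs_sub_lt_one_of_floor_eq_floor h4).le
        rw [← sub_div, abs_div, abs_of_pos hs0, div_le_one hs0] at this
        exact this

end NormData

lemma polyRho_eq (F : Polynomial ℤ) (d : ℕ) :
    polyRho F d = ((Finset.range d).filter fun n : ℕ => (d : ℤ) ∣ F.eval (n : ℤ)).card := by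
  have : polyRho F d = (((Finset.range d).image (Nat.cast : ℕ → ℤ)).filter fun n => (d : ℤ) ∣ F.eval n).card := by
    simp [polyRho]
    congr!
  rw [this, Finset.filter_image, Finset.card_image_of_injective _ Nat.cast_injective]

/-- All prime factors of `n` exceed `D₀`. -/
def Rough (D₀ n : ℕ) : Prop := ∀ p : ℕ, p.Prime → p ∣ n → D₀ < p

lemma Rough.of_dvd {D₀ m n : ℕ} (h : Rough D₀ n) (hd : m ∣ n) : Rough D₀ m :=
  fun p hp hpm => h p hp (hpm.trans hd)

/-- An integer polynomial without integer roots, all of whose roots modulo primes exceeding `D₀`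
are simple, for which the squarefree divisors are bounded on average, and which has many
well distributed divisors in short intervals. -/
structure GoodPoly (F : Polynomial ℤ) (D₀ : ℕ) : Prop where
  two_le : 2 ≤ F.natDegree
  eval_ne_zero : ∀ n : ℤ, F.eval n ≠ 0
  pow_le : F.natDegree ^ (8 * F.natDegree) ≤ D₀
  simple : ∀ p : ℕ, p.Prime → D₀ < p → ∀ n : ℤ, (p : ℤ) ∣ F.eval n → ¬ (p : ℤ) ∣ F.derivative.eval n
  lead : ∀ p : ℕ, p.Prime → D₀ < p → ¬ (p : ℤ) ∣ F.leadingCoeff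
  average : ∃ C : ℝ, 0 < C ∧ ∀ N : ℕ,
    ∑ a ∈ (Finset.Icc 1 N).filter (fun a => Squarefree a ∧ Rough D₀ a), (polyRho F a : ℝ) ≤ C * N
  slab : ∃ c C : ℝ, 0 < c ∧ 0 < C ∧ ∀ k : ℕ, ∃ (U₀ : ℝ) (P : ℕ), 1 ≤ U₀ ∧ ∀ U ≥ U₀, ∀ η : ℝ,
    U ^ (-(1 / (10 * F.natDegree)) : ℝ) ≤ η → η ≤ 1 / 2 → ∀ S : Finset ℕ, S.card ≤ k →
    (∀ p ∈ S, p.Prime ∧ P ≤ p) → ∃ (ι : Type) (𝒜 : Finset ι) (a : ι → ℕ) (n : ι → ℤ),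
      (∀ i ∈ 𝒜, U < a i ∧ (a i : ℝ) ≤ U * Real.exp η ∧ Rough D₀ (a i) ∧ (∀ p ∈ S, ¬ p ∣ a i) ∧
        (a i : ℤ) ∣ F.eval (n i)) ∧
      c * η * U ≤ (𝒜.card : ℝ) ∧
      ∀ (h : ℕ) (μ : ℤ), 0 < h → Rough D₀ h → (h : ℤ) ∣ F.eval μ → ∀ ω : ℝ, 0 < ω → η ≤ ω → ω ≤ 1 →
        (h : ℝ) ≤ 2 * ω ^ F.natDegree * U →
        ((𝒜.filter fun i => h ∣ a i ∧ (h : ℤ) ∣ n i - μ).card : ℝ) ≤ C * (ω * U / h)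

namespace GoodPoly
variable {F : Polynomial ℤ} {D₀ : ℕ} (H : GoodPoly F D₀)
include H

lemma dvd_of_eval {d p : ℕ} (hp : p.Prime) (hpD : D₀ < p) (hpd : p ∣ d) {μ μ' : ℤ}
    (h : ((d * p : ℕ) : ℤ) ∣ F.eval μ) (h' : ((d * p : ℕ) : ℤ) ∣ F.eval μ') (hd : (d : ℤ) ∣ μ - μ') (hd0 : 0 < d) :
    ((d * p : ℕ) : ℤ) ∣ μ - μ' := by
  obtain ⟨e, he⟩ := hd
  obtain ⟨k, hk⟩ := Polynomial.binomExpansion F μ' (d * e)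
  rw [show μ' + (d : ℤ) * e = μ by rw [← he]; ring] at hk
  obtain ⟨d', rfl⟩ := hpd
  have h1 : ((p * d' * p : ℕ) : ℤ) ∣ (p * d' : ℕ) * (F.derivative.eval μ' * e + k * (p * d' : ℕ) * e ^ 2) := by
    refine (dvd_sub h h').trans (dvd_of_eq ?_)
    rw [hk]
    push_cast
    ring
  push_cast at h1
  have hne : (p * d' : ℤ) ≠ 0 := by exact_mod_cast hd0.ne'
  have h2 := (mul_dvd_mul_iff_left hne).mp h1
  have h3 : (p : ℤ) ∣ F.derivative.eval μ' * e := by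
    refine (dvd_add_left ?_).mp h2
    exact ⟨k * d' * e ^ 2, by ring⟩
  have h4 : (p : ℤ) ∣ F.eval μ' := dvd_trans ⟨p * d', by push_cast; ring⟩ h'
  have h5 := ((Nat.prime_iff_prime_int.mp hp).dvd_or_dvd h3).resolve_left (H.simple p hp hpD μ' h4)
  rw [he]; push_cast
  exact mul_dvd_mul_left _ h5

lemma card_roots_le {p : ℕ} (hp : p.Prime) (hpD : D₀ < p) (s : Finset (ZMod p))
    (hs : ∀ x ∈ s, ∃ n : ℤ, (n : ZMod p) = x ∧ (p : ℤ) ∣ F.eval n) : s.card ≤ F.natDegree := by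
  have := Fact.mk hp
  set f := F.map (Int.castRingHom (ZMod p)) with hf
  have hf0 : f ≠ 0 := by
    intro h0
    have := congrArg (fun q => q.coeff F.natDegree) h0
    simp only [hf, Polynomial.coeff_map, Polynomial.coeff_zero, eq_intCast] at this
    rw [ZMod.intCast_zmod_eq_zero_iff_dvd] at this
    exact H.lead p hp hpD this
  have h1 : s ⊆ f.roots.toFinset := by
    intro x hx
    obtain ⟨n, rfl, hn⟩ := hs x hx
    rw [Multiset.mem_toFinset, Polynomial.mem_roots hf0, Polynomial.IsRoot.def, hf]
    have : Polynomial.eval ((Int.castRingHom (ZMod p)) n) (F.map (Int.castRingHom (ZMod p))) =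
      (Int.castRingHom (ZMod p)) (F.eval n) := Polynomial.eval_map_apply _ _
    rw [eq_intCast, eq_intCast] at this
    rw [this, ZMod.intCast_zmod_eq_zero_iff_dvd]; exact hn
  calc s.card ≤ f.roots.toFinset.card := Finset.card_le_card h1
    _ ≤ f.roots.card := Multiset.toFinset_card_le _
    _ ≤ f.natDegree := Polynomial.card_roots' _
    _ ≤ F.natDegree := Polynomial.natDegree_map_le

lemma card_lift_le {d p : ℕ} (hd : 0 < d) (hp : p.Prime) (hpD : D₀ < p) (ν : ℤ) :
    ((Finset.range (d * p)).filter fun μ : ℕ => ((d * p : ℕ) : ℤ) ∣ F.eval (μ : ℤ) ∧ (d : ℤ) ∣ (μ : ℤ) - ν).card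
      ≤ F.natDegree := by
  have hmod : ∀ a b : ℕ, a < d * p → b < d * p → ((d * p : ℕ) : ℤ) ∣ (a : ℤ) - b → a = b := by
    intro a b ha hb hab
    have := (Nat.modEq_iff_dvd.mpr hab)
    exact (Nat.ModEq.eq_of_lt_of_lt this hb ha).symm
  by_cases hpd : p ∣ d
  · refine le_trans (Finset.card_le_one.mpr ?_) (by have := H.two_le; omega)
    intro a ha b hb
    rw [Finset.mem_filter, Finset.mem_range] at ha hb
    refine hmod a b ha.1 hb.1 (H.dvd_of_eval hp hpD hpd ha.2.1 hb.2.1 ?_ hd)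
    have := dvd_sub ha.2.2 hb.2.2
    simpa using this
  · rw [← Finset.card_image_of_injOn (f := fun μ : ℕ => (μ : ZMod p))]
    · refine H.card_roots_le hp hpD _ ?_
      rw [Finset.forall_mem_image]
      intro a ha
      rw [Finset.mem_filter] at ha
      exact ⟨a, by simp, dvd_trans ⟨d, by push_cast; ring⟩ ha.2.1⟩
    · intro a ha b hb hab
      rw [Finset.mem_coe, Finset.mem_filter, Finset.mem_range] at ha hb
      refine hmod a b ha.1 hb.1 ?_
      have h1 : (d : ℤ) ∣ (a : ℤ) - b := by simpa using dvd_sub ha.2.2 hb.2.2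
      have h2 : (p : ℤ) ∣ (a : ℤ) - b := by
        rw [← ZMod.intCast_zmod_eq_zero_iff_dvd]
        push_cast
        simp only at hab
        rw [hab, sub_self]
      push_cast
      refine IsCoprime.mul_dvd ?_ h1 h2
      rw [Nat.isCoprime_iff_coprime]
      exact ((Nat.Prime.coprime_iff_not_dvd hp).mpr hpd).symm

lemma natDegree_le_rpow {p : ℕ} (hpD : D₀ < p) :
    (F.natDegree : ℝ) ≤ (p : ℝ) ^ (1 / (8 * F.natDegree) : ℝ) := by
  have h0 := H.two_le
  have h1 : ((F.natDegree : ℝ)) ^ (8 * F.natDegree) ≤ p := by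
    exact_mod_cast H.pow_le.trans hpD.le
  have h2 : (0 : ℝ) < F.natDegree := by exact_mod_cast (by omega : 0 < F.natDegree)
  calc (F.natDegree : ℝ) = ((F.natDegree : ℝ) ^ (8 * F.natDegree)) ^ (1 / (8 * F.natDegree) : ℝ) := by
        rw [← Real.rpow_natCast, ← Real.rpow_mul h2.le]
        push_cast
        rw [mul_one_div_cancel (by positivity), Real.rpow_one]
    _ ≤ _ := Real.rpow_le_rpow (by positivity) h1 (by positivity)

lemma card_fiber_le (j : ℕ) : ∀ (d : ℕ) (ν : ℤ), 0 < d → 0 < j → Rough D₀ j →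
    (((Finset.range (d * j)).filter fun μ : ℕ => ((d * j : ℕ) : ℤ) ∣ F.eval (μ : ℤ) ∧
      (d : ℤ) ∣ (μ : ℤ) - ν).card : ℝ) ≤ (j : ℝ) ^ (1 / (8 * F.natDegree) : ℝ) := by
  induction j using induction_on_primes with
  | zero => intro d ν _ h; omega
  | one =>
    intro d ν hd _ _
    rw [Nat.cast_one, Real.one_rpow]
    have : ((Finset.range (d * 1)).filter fun μ : ℕ => ((d * 1 : ℕ) : ℤ) ∣ F.eval (μ : ℤ) ∧
      (d : ℤ) ∣ (μ : ℤ) - ν).card ≤ 1 := by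
      refine Finset.card_le_one.mpr fun a ha b hb => ?_
      rw [Finset.mem_filter, Finset.mem_range, mul_one] at ha hb
      have h1 : (d : ℤ) ∣ (a : ℤ) - b := by simpa using dvd_sub ha.2.2 hb.2.2
      exact (Nat.ModEq.eq_of_lt_of_lt (Nat.modEq_iff_dvd.mpr h1) hb.1 ha.1).symm
    exact_mod_cast this
  | prime_mul p a hp ih =>
    intro d ν hd hj hR
    have ha : 0 < a := Nat.pos_of_mul_pos_left hj
    have hpD : D₀ < p := hR p hp (dvd_mul_right _ _)
    have hdp : 0 < d * p := Nat.mul_pos hd hp.pos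
    have key := card_le_mul_card_fibers
      (s := (Finset.range (d * (p * a))).filter fun μ : ℕ => ((d * (p * a) : ℕ) : ℤ) ∣ F.eval (μ : ℤ) ∧
        (d : ℤ) ∣ (μ : ℤ) - ν)
      (t := (Finset.range (d * p)).filter fun μ : ℕ => ((d * p : ℕ) : ℤ) ∣ F.eval (μ : ℤ) ∧
        (d : ℤ) ∣ (μ : ℤ) - ν) (K := (a : ℝ) ^ (1 / (8 * F.natDegree) : ℝ)) (fun μ => μ % (d * p)) ?_ ?_
    · have h1 : (((Finset.range (d * p)).filter fun μ : ℕ => ((d * p : ℕ) : ℤ) ∣ F.eval (μ : ℤ) ∧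
        (d : ℤ) ∣ (μ : ℤ) - ν).card : ℝ) ≤ (p : ℝ) ^ (1 / (8 * F.natDegree) : ℝ) :=
        le_trans (by exact_mod_cast H.card_lift_le hd hp hpD ν) (H.natDegree_le_rpow hpD)
      refine key.trans ?_
      rw [mul_comm p a, Nat.cast_mul a p, Real.mul_rpow (Nat.cast_nonneg a) (Nat.cast_nonneg p)]
      exact mul_le_mul_of_nonneg_left h1 (by positivity)
    · intro μ hμ
      rw [Finset.mem_filter, Finset.mem_range] at hμ ⊢
      have h1 : ((d * p : ℕ) : ℤ) ∣ (μ : ℤ) - ((μ % (d * p) : ℕ) : ℤ) := by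
        rw [Int.natCast_mod]; exact Int.dvd_self_sub_emod
      refine ⟨Nat.mod_lt _ hdp, ?_, ?_⟩
      · have h2 : ((d * p : ℕ) : ℤ) ∣ F.eval (μ : ℤ) := dvd_trans ⟨a, by push_cast; ring⟩ hμ.2.1
        have h3 := h1.trans (Polynomial.sub_dvd_eval_sub (μ : ℤ) ((μ % (d * p) : ℕ) : ℤ) F)
        exact (dvd_sub_right h2).mp h3
      · have h2 : (d : ℤ) ∣ (μ : ℤ) - ((μ % (d * p) : ℕ) : ℤ) := dvd_trans ⟨p, by push_cast; ring⟩ h1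
        have := dvd_sub hμ.2.2 h2
        simpa using this
    · intro b hb
      refine le_trans ?_ (ih (d * p) b hdp ha (hR.of_dvd (dvd_mul_left _ _)))
      refine Nat.cast_le.mpr (Finset.card_le_card fun μ hμ => ?_)
      rw [Finset.mem_filter, Finset.mem_filter, Finset.mem_range] at hμ
      rw [Finset.mem_filter, Finset.mem_range, mul_assoc]
      refine ⟨hμ.1.1, hμ.1.2.1, ?_⟩
      rw [← hμ.2, Int.natCast_mod]; exact Int.dvd_self_sub_emod

lemma rho_le_rpow {n : ℕ} (hn : 0 < n) (hR : Rough D₀ n) :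
    (polyRho F n : ℝ) ≤ (n : ℝ) ^ (1 / (8 * F.natDegree) : ℝ) := by
  have := H.card_fiber_le n 1 0 one_pos hn hR
  simpa [polyRho_eq] using this

lemma rho_mul_le {d j : ℕ} (hd : 0 < d) (hj : 0 < j) (hR : Rough D₀ j) :
    (polyRho F (d * j) : ℝ) ≤ (j : ℝ) ^ (1 / (8 * F.natDegree) : ℝ) * polyRho F d := by
  rw [polyRho_eq, polyRho_eq]
  refine card_le_mul_card_fibers (fun μ => μ % d) ?_ ?_
  · intro μ hμ
    rw [Finset.mem_filter, Finset.mem_range] at hμ ⊢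
    refine ⟨Nat.mod_lt _ hd, ?_⟩
    have h1 : (d : ℤ) ∣ (μ : ℤ) - ((μ % d : ℕ) : ℤ) := by
      rw [Int.natCast_mod]; exact Int.dvd_self_sub_emod
    have h2 : (d : ℤ) ∣ F.eval (μ : ℤ) := dvd_trans ⟨j, by push_cast; ring⟩ hμ.2
    exact (dvd_sub_right h2).mp (h1.trans (Polynomial.sub_dvd_eval_sub (μ : ℤ) ((μ % d : ℕ) : ℤ) F))
  · intro b _
    refine le_trans ?_ (H.card_fiber_le j d b hd hj hR)
    refine Nat.cast_le.mpr (Finset.card_le_card fun μ hμ => ?_)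
    rw [Finset.mem_filter, Finset.mem_filter] at hμ
    rw [Finset.mem_filter]
    refine ⟨hμ.1.1, hμ.1.2, ?_⟩
    rw [← hμ.2, Int.natCast_mod]; exact Int.dvd_self_sub_emod

lemma rho_prime_le {p : ℕ} (hp : p.Prime) (hpD : D₀ < p) : polyRho F p ≤ F.natDegree := by
  have := H.card_lift_le one_pos hp hpD 0
  simpa [polyRho_eq] using this

lemma exists_root_mul_prime {d p : ℕ} (hd : 0 < d) (hp : p.Prime) (hpD : D₀ < p)
    (h : ∃ μ : ℤ, (d : ℤ) ∣ F.eval μ) (h' : ∃ μ : ℤ, (p : ℤ) ∣ F.eval μ) :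
    ∃ μ : ℤ, ((d * p : ℕ) : ℤ) ∣ F.eval μ := by
  obtain ⟨μ, hμ⟩ := h
  obtain ⟨ν, hν⟩ := h'
  by_cases hpd : p ∣ d
  · have hpμ : (p : ℤ) ∣ F.eval μ := dvd_trans (by exact_mod_cast hpd) hμ
    have hs := H.simple p hp hpD μ hpμ
    obtain ⟨q, hq⟩ := hμ
    have hco : IsCoprime (F.derivative.eval μ) (p : ℤ) :=
      ((Nat.prime_iff_prime_int.mp hp).coprime_iff_not_dvd.mpr hs).symm
    obtain ⟨u, v, huv⟩ := hco
    obtain ⟨k, hk⟩ := Polynomial.binomExpansion F μ (d * (-(q * u)))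
    refine ⟨μ + d * (-(q * u)), ?_⟩
    rw [hk, hq]
    obtain ⟨d', rfl⟩ := hpd
    have e : ((p * d' : ℕ) : ℤ) * q + F.derivative.eval μ * (((p * d' : ℕ) : ℤ) * (-(q * u))) =
      ((p * d' * p : ℕ) : ℤ) * (q * v) := by
      push_cast
      linear_combination (-(p * d' * q) : ℤ) * huv
    rw [e]
    refine dvd_add (dvd_mul_right _ _) ⟨k * d' * (q * u) ^ 2, by push_cast; ring⟩
  · have hco : IsCoprime (d : ℤ) (p : ℤ) := by
      rw [Nat.isCoprime_iff_coprime]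
      exact ((Nat.Prime.coprime_iff_not_dvd hp).mpr hpd).symm
    obtain ⟨u, v, huv⟩ := hco
    refine ⟨μ * (v * p) + ν * (u * d), ?_⟩
    push_cast
    refine IsCoprime.mul_dvd ⟨u, v, huv⟩ ?_ ?_
    · have h1 : (d : ℤ) ∣ (μ * (v * p) + ν * (u * d)) - μ := ⟨(ν - μ) * u, by linear_combination (μ : ℤ) * huv⟩
      exact (dvd_sub_left hμ).mp (h1.trans (Polynomial.sub_dvd_eval_sub _ _ F))
    · have h1 : (p : ℤ) ∣ (μ * (v * p) + ν * (u * d)) - ν := ⟨(μ - ν) * v, by linear_combination (ν : ℤ) * huv⟩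
      exact (dvd_sub_left hν).mp (h1.trans (Polynomial.sub_dvd_eval_sub _ _ F))

end GoodPoly

lemma polyRho_mul_of_coprime (F : Polynomial ℤ) {a b : ℕ} (ha : 0 < a) (hb : 0 < b) (hab : a.Coprime b) :
    polyRho F (a * b) = polyRho F a * polyRho F b := by
  rw [polyRho_eq, polyRho_eq, polyRho_eq, ← Finset.card_product]
  have hco : IsCoprime (a : ℤ) (b : ℤ) := Nat.isCoprime_iff_coprime.mpr hab
  have hev : ∀ (c x y : ℕ), x ≡ y [MOD c] → (c : ℤ) ∣ F.eval (y : ℤ) → (c : ℤ) ∣ F.eval (x : ℤ) := by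
    intro c x y hxy hy
    have h1 : (c : ℤ) ∣ (x : ℤ) - y := Nat.modEq_iff_dvd.mp hxy.symm
    exact (dvd_sub_left hy).mp (h1.trans (Polynomial.sub_dvd_eval_sub _ _ F))
  refine Finset.card_bij (fun n _ => (n % a, n % b)) ?_ ?_ ?_
  · intro n hn
    rw [Finset.mem_filter, Finset.mem_range] at hn
    rw [Finset.mem_product, Finset.mem_filter, Finset.mem_filter, Finset.mem_range, Finset.mem_range]
    push_cast at hn
    exact ⟨⟨Nat.mod_lt _ ha, hev a _ n (Nat.mod_modEq n a) (dvd_trans (dvd_mul_right _ _) hn.2)⟩,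
      ⟨Nat.mod_lt _ hb, hev b _ n (Nat.mod_modEq n b) (dvd_trans (dvd_mul_left _ _) hn.2)⟩⟩
  · intro n hn n' hn' h
    rw [Finset.mem_filter, Finset.mem_range] at hn hn'
    rw [Prod.mk.injEq] at h
    have : n ≡ n' [MOD a * b] := (Nat.modEq_and_modEq_iff_modEq_mul hab).mp h
    exact Nat.ModEq.eq_of_lt_of_lt this hn.1 hn'.1
  · rintro ⟨r, s⟩ h
    rw [Finset.mem_product, Finset.mem_filter, Finset.mem_filter, Finset.mem_range, Finset.mem_range] at h
    obtain ⟨k, hk1, hk2⟩ := Nat.chineseRemainder hab r s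
    have e1 : k % (a * b) ≡ r [MOD a] := ((Nat.mod_modEq k (a * b)).of_mul_right b).trans hk1
    have e2 : k % (a * b) ≡ s [MOD b] := ((Nat.mod_modEq k (a * b)).of_mul_left a).trans hk2
    refine ⟨k % (a * b), ?_, ?_⟩
    · rw [Finset.mem_filter, Finset.mem_range]
      refine ⟨Nat.mod_lt _ (Nat.mul_pos ha hb), ?_⟩
      push_cast
      have h3 := hev a _ r e1 h.1.2
      have h4 := hev b _ s e2 h.2.2
      push_cast at h3 h4
      exact hco.mul_dvd h3 h4
    · rw [Prod.mk.injEq]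
      exact ⟨Nat.mod_eq_of_modEq e1 h.1.1, Nat.mod_eq_of_modEq e2 h.2.1⟩

open Polynomial in
lemma irreducible_map_rat {F : Polynomial ℤ} (hF : Irreducible F) (hdeg : 2 ≤ F.natDegree) :
    Irreducible (F.map (Int.castRingHom ℚ)) :=
  (IsPrimitive.Int.irreducible_iff_irreducible_map_cast (hF.isPrimitive (by omega))).mp hF

lemma exists_common_multiple {F : Polynomial ℤ} (hF : Irreducible F) (hdeg : 2 ≤ F.natDegree) :
    ∃ r : ℤ, r ≠ 0 ∧ ∀ d n : ℤ, d ∣ F.eval n → d ∣ F.derivative.eval n → d ∣ r := by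
  have h1 := irreducible_map_rat hF hdeg
  have h2 := h1.separable
  have hinj : Function.Injective (Int.castRingHom ℚ) := Int.cast_injective
  have h3 : (F.map (Int.castRingHom ℚ)).resultant (F.derivative.map (Int.castRingHom ℚ)) ≠ 0 := by
    refine Polynomial.resultant_ne_zero _ _ ?_
    rw [Polynomial.separable_def, Polynomial.derivative_map] at h2
    exact h2
  rw [Polynomial.natDegree_map_eq_of_injective hinj, Polynomial.natDegree_map_eq_of_injective hinj,
    Polynomial.resultant_map_map] at h3
  obtain ⟨p, q, -, -, h⟩ := Polynomial.exists_mul_add_mul_eq_C_resultant F F.derivative le_rfl le_rfl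
    (Or.inl (by omega))
  refine ⟨F.resultant F.derivative, fun h0 => h3 (by rw [h0, map_zero]), fun d n hd hd' => ?_⟩
  have := congrArg (Polynomial.eval n) h
  simp only [Polynomial.eval_add, Polynomial.eval_mul, Polynomial.eval_C] at this
  rw [← this]
  exact dvd_add (hd.mul_right _) (hd'.mul_right _)

lemma eval_ne_zero_of_irreducible {F : Polynomial ℤ} (hF : Irreducible F) (hdeg : 2 ≤ F.natDegree) (n : ℤ) :
    F.eval n ≠ 0 := by
  intro h
  have h1 := Polynomial.dvd_iff_isRoot.mpr h
  have h2 := (Polynomial.irreducible_X_sub_C n).associated_of_dvd hF h1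
  obtain ⟨u, hu⟩ := h2
  have h3 := Polynomial.natDegree_mul' (p := Polynomial.X - Polynomial.C n) (q := (u : Polynomial ℤ))
  obtain ⟨v, hv, hv'⟩ := Polynomial.isUnit_iff.mp u.isUnit
  rw [← hu, ← hv'] at hdeg
  have := Polynomial.natDegree_mul_C_le (Polynomial.X - Polynomial.C n) v
  rw [Polynomial.natDegree_X_sub_C] at this
  omega

lemma exists_normData {F : Polynomial ℤ} (hF : Irreducible F) {m : ℕ} (hdeg : F.natDegree = m + 2) :
    ∃ D : NormData m, ∀ n : ℤ, D.G.eval (F.leadingCoeff * n) = F.leadingCoeff ^ (m + 1) * F.eval n := by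
  have hF0 : F ≠ 0 := hF.ne_zero
  have h1 := irreducible_map_rat hF (by omega)
  have h2 := h1.separable
  have hl : (F.leadingCoeff : ℂ) ≠ 0 := by exact_mod_cast Polynomial.leadingCoeff_ne_zero.mpr hF0
  set fC := (F.map (Int.castRingHom ℚ)).map (algebraMap ℚ ℂ) with hfC
  have hnd : fC.roots.Nodup := Polynomial.nodup_roots h2.map
  have hcard : fC.roots.toFinset.card = m + 2 := by
    rw [Multiset.toFinset_card_of_nodup hnd, IsAlgClosed.card_roots_eq_natDegree, hfC, Polynomial.natDegree_map,
      Polynomial.natDegree_map_eq_of_injective Int.cast_injective, hdeg]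
  let e := Finset.equivFinOfCardEq hcard
  have hroot : ∀ j, fC.eval (e.symm j : ℂ) = 0 := fun j => by
    have := (e.symm j).2
    rw [Multiset.mem_toFinset] at this
    exact Polynomial.isRoot_of_mem_roots this
  have hrt : ∀ w : ℂ, fC.eval w = Polynomial.eval₂ (Int.castRingHom ℂ) w F := fun w => by
    rw [hfC, Polynomial.map_map, Polynomial.eval_map]
    congr 1
  have hrt' : ∀ w : ℂ, fC.eval w = Polynomial.aeval w (F.map (Int.castRingHom ℚ)) := fun w => by
    rw [hfC, Polynomial.eval_map_algebraMap]
  have hroot' : ∀ j, Polynomial.eval₂ (Int.castRingHom ℂ) (e.symm j : ℂ) F = 0 := fun j => by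
    rw [← hrt]; exact hroot j
  refine ⟨⟨F.integralNormalization, Polynomial.monic_integralNormalization hF0, ?_,
    fun j => F.leadingCoeff * (e.symm j : ℂ), ?_, ?_, ?_⟩, ?_⟩
  · rw [Polynomial.natDegree_integralNormalization, hdeg]
  · intro i j hij
    exact e.symm.injective (Subtype.ext (mul_left_cancel₀ hl hij))
  · intro j
    have := Polynomial.integralNormalization_eval₂_leadingCoeff_mul (p := F) (by omega) (Int.castRingHom ℂ)
      (e.symm j : ℂ)
    rw [hroot', mul_zero, eq_intCast] at this
    exact this
  · intro A hA j h0
    let b : Polynomial ℚ := ∑ i : Fin (m + 2), Polynomial.monomial (i : ℕ) ((A i : ℚ) * (F.leadingCoeff : ℚ) ^ (i : ℕ))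
    have hbc : ∀ i : Fin (m + 2), b.coeff i = (A i : ℚ) * (F.leadingCoeff : ℚ) ^ (i : ℕ) := by
      intro i
      simp only [b, Polynomial.finsetSum_coeff, Polynomial.coeff_monomial]
      rw [Finset.sum_eq_single i]
      · simp
      · intro k _ hk
        rw [if_neg]
        exact fun h => hk (Fin.ext h)
      · simp
    have hb0 : b ≠ 0 := by
      intro hb
      apply hA
      funext i
      have := hbc i
      rw [hb, Polynomial.coeff_zero] at this
      have h3 : (F.leadingCoeff : ℚ) ^ (i : ℕ) ≠ 0 :=
        pow_ne_zero _ (by exact_mod_cast Polynomial.leadingCoeff_ne_zero.mpr hF0)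
      have := (mul_eq_zero.mp this.symm).resolve_right h3
      exact_mod_cast this
    have hbdeg : b.degree < (m + 2 : ℕ) := by
      refine lt_of_le_of_lt (Polynomial.degree_sum_le _ _) ?_
      rw [Finset.sup_lt_iff (by exact_mod_cast WithBot.bot_lt_coe (m + 2))]
      intro i _
      exact lt_of_le_of_lt (Polynomial.degree_monomial_le _ _) (by exact_mod_cast i.2)
    have hbz : Polynomial.aeval (e.symm j : ℂ) b = 0 := by
      simp only [b, map_sum, Polynomial.aeval_monomial]
      rw [← h0]
      refine Finset.sum_congr rfl fun i _ => ?_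
      simp [mul_pow]; ring
    have hco : IsCoprime (F.map (Int.castRingHom ℚ)) b := by
      rw [h1.coprime_iff_not_dvd]
      intro hd
      have := Polynomial.degree_le_of_dvd hd hb0
      rw [Polynomial.degree_map_eq_of_injective Int.cast_injective, Polynomial.degree_eq_natDegree hF0, hdeg] at this
      exact absurd hbdeg (not_lt.mpr this)
    obtain ⟨u, v, huv⟩ := hco
    have := congrArg (Polynomial.aeval (e.symm j : ℂ)) huv
    have h4 : Polynomial.aeval (e.symm j : ℂ) (F.map (Int.castRingHom ℚ)) = 0 := by
      rw [← hrt']; exact hroot j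
    rw [map_add, map_mul, map_mul, hbz, h4, mul_zero, mul_zero, add_zero, map_one] at this
    exact zero_ne_one this
  · intro n
    have := Polynomial.integralNormalization_eval₂_leadingCoeff_mul (p := F) (by omega) (RingHom.id ℤ) n
    rw [hdeg] at this
    simpa using this

lemma exists_nat_root (g a : ℕ) (hg : 0 < g) : ∃ r : ℕ, r ^ g ≤ a ∧ a < (r + 1) ^ g := by
  have hex : ∃ r : ℕ, a < (r + 1) ^ g := ⟨a, (Nat.lt_succ_self a).trans_le (Nat.le_self_pow hg.ne' _)⟩
  refine ⟨Nat.find hex, ?_, Nat.find_spec hex⟩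
  rcases Nat.eq_zero_or_pos (Nat.find hex) with h | h
  · rw [h, zero_pow hg.ne']; omega
  · have := Nat.find_min hex (m := Nat.find hex - 1) (by omega)
    rw [Nat.sub_add_cancel h] at this
    omega

namespace NormData
variable {m : ℕ} (D : NormData m)

lemma sub_dvd_ev_sub (A : Fin (m + 2) → ℤ) (μ ν : ℤ) : μ - ν ∣ ev A μ - ev A ν := by
  simp only [ev, ← Finset.sum_sub_distrib, ← mul_sub]
  exact Finset.dvd_sum fun i _ => (sub_dvd_pow_sub_pow μ ν i).mul_left _

lemma exists_small_vec {a r : ℕ} (ha : 0 < a) (hr : a < (r + 1) ^ (m + 2)) (μ : ℤ) :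
    ∃ A : Fin (m + 2) → ℤ, A ≠ 0 ∧ (∀ i, |A i| ≤ r) ∧ (a : ℤ) ∣ ev A μ := by
  have : NeZero a := ⟨ha.ne'⟩
  obtain ⟨B, hB, B', hB', hne, heq⟩ := Finset.exists_ne_map_eq_of_card_lt_of_maps_to
    (s := Fintype.piFinset fun _ : Fin (m + 2) => Finset.range (r + 1)) (t := (Finset.univ : Finset (ZMod a)))
    (f := fun B => ((ev (fun i => (B i : ℤ)) μ : ℤ) : ZMod a)) (by
      rw [Fintype.card_piFinset_const, Finset.card_univ, ZMod.card, Finset.card_range]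
      exact hr) (fun _ _ => Finset.mem_coe.mpr (Finset.mem_univ _))
  rw [Fintype.mem_piFinset] at hB hB'
  refine ⟨(fun i => (B i : ℤ)) - fun i => (B' i : ℤ), ?_, ?_, ?_⟩
  · intro h
    refine hne (funext fun i => ?_)
    have := congrFun h i
    simp only [Pi.sub_apply, Pi.zero_apply] at this
    omega
  · intro i
    have h1 := Finset.mem_range.mp (hB i)
    have h2 := Finset.mem_range.mp (hB' i)
    simp only [Pi.sub_apply]
    rw [abs_le]; omega
  · rw [ev_sub, ← ZMod.intCast_zmod_eq_zero_iff_dvd]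
    push_cast
    rw [sub_eq_zero]
    exact heq

lemma natAbs_nrm_le {Λ : ℝ} (hΛ : ∀ (j : Fin (m + 2)) (A : Fin (m + 2) → ℤ) (s : ℝ),
    (∀ i, |(A i : ℝ)| ≤ s) → ‖D.sg j A‖ ≤ Λ * s) {A : Fin (m + 2) → ℤ} {r : ℕ} (hA : ∀ i, |A i| ≤ r) :
    ((D.nrm A).natAbs : ℝ) ≤ Λ ^ (m + 2) * (r : ℝ) ^ (m + 2) := by
  rw [Nat.cast_natAbs, Int.cast_abs, abs_nrm, ← mul_pow]
  calc _ ≤ ∏ _j : Fin (m + 2), (Λ * r) := Finset.prod_le_prod (fun _ _ => norm_nonneg _)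
        fun j _ => hΛ j _ _ fun i => by exact_mod_cast hA i
    _ = _ := by simp

variable {F : Polynomial ℤ} {ℓ : ℤ} {D₀ : ℕ}

lemma average (hDF : ∀ n : ℤ, D.G.eval (ℓ * n) = ℓ ^ (m + 1) * F.eval n)
    (hℓ : ∀ p : ℕ, p.Prime → D₀ < p → ¬ (p : ℤ) ∣ ℓ) : ∃ C : ℝ, 0 < C ∧ ∀ N : ℕ,
    ∑ a ∈ (Finset.Icc 1 N).filter (fun a => Squarefree a ∧ Rough D₀ a), (polyRho F a : ℝ) ≤ C * N := by
  obtain ⟨Λ, hΛ1, hΛ⟩ := D.exists_sg_bound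
  set M : ℕ := ⌊Λ ^ (m + 2)⌋₊ with hM
  choose r hr1 hr2 using fun a : ℕ => exists_nat_root (m + 2) a (by omega)
  have hA : ∀ (a : ℕ) (ν : ℕ), ∃ A : Fin (m + 2) → ℤ, 0 < a →
      (A ≠ 0 ∧ (∀ i, |A i| ≤ r a) ∧ (a : ℤ) ∣ ev A (ℓ * ν)) := fun a ν => by
    by_cases ha : 0 < a
    · obtain ⟨A, h⟩ := exists_small_vec (m := m) ha (hr2 a) (ℓ * ν)
      exact ⟨A, fun _ => h⟩
    · exact ⟨0, fun h => absurd h ha⟩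
  choose A hA using hA
  have hdvdG : ∀ (d : ℤ) (ν : ℤ), d ∣ F.eval ν → d ∣ D.G.eval (ℓ * ν) := fun d ν h => by
    rw [hDF]; exact h.mul_left _
  have hq : ∀ a ν : ℕ, 0 < a → (a : ℤ) ∣ F.eval (ν : ℤ) → ∃ q : ℕ, (D.nrm (A a ν)).natAbs = a * q ∧ 0 < q ∧ q ≤ M := by
    intro a ν ha hν
    obtain ⟨h1, h2, h3⟩ := hA a ν ha
    have h4 := D.dvd_nrm (hdvdG a ν hν) h3
    obtain ⟨q, hq⟩ := Int.natCast_dvd.mp h4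
    have h5 : (D.nrm (A a ν)).natAbs ≠ 0 := Int.natAbs_ne_zero.mpr (D.nrm_ne_zero h1)
    refine ⟨q, hq, Nat.pos_of_ne_zero fun h => h5 (by rw [hq, h, mul_zero]), Nat.le_floor ?_⟩
    have h6 := D.natAbs_nrm_le hΛ h2
    rw [hq] at h6
    have h7 : ((r a : ℝ)) ^ (m + 2) ≤ a := by exact_mod_cast hr1 a
    have h8 : (0 : ℝ) < a := by exact_mod_cast ha
    have h9 : ((a * q : ℕ) : ℝ) ≤ Λ ^ (m + 2) * a := h6.trans (by gcongr)
    push_cast at h9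
    nlinarith
  refine ⟨3 ^ (m + 2) * (M + 1) * (M + 1), by positivity, fun N => ?_⟩
  rcases Nat.eq_zero_or_pos N with rfl | hN
  · simp
  set 𝒯 := ((Finset.Icc 1 N).filter (fun a => Squarefree a ∧ Rough D₀ a)).sigma
    (fun a => (Finset.range a).filter fun n : ℕ => (a : ℤ) ∣ F.eval (n : ℤ)) with h𝒯
  have e1 : ∑ a ∈ (Finset.Icc 1 N).filter (fun a => Squarefree a ∧ Rough D₀ a), (polyRho F a : ℝ) = 𝒯.card := by
    rw [h𝒯, Finset.card_sigma, Nat.cast_sum]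
    exact Finset.sum_congr rfl fun a _ => by rw [polyRho_eq]
  rw [e1]
  have h𝒯m : ∀ x ∈ 𝒯, 0 < x.1 ∧ x.1 ≤ N ∧ Squarefree x.1 ∧ Rough D₀ x.1 ∧ x.2 < x.1 ∧ (x.1 : ℤ) ∣ F.eval (x.2 : ℤ) := by
    intro x hx
    rw [h𝒯, Finset.mem_sigma, Finset.mem_filter, Finset.mem_filter, Finset.mem_Icc, Finset.mem_range] at hx
    exact ⟨hx.1.1.1, hx.1.1.2, hx.1.2.1, hx.1.2.2, hx.2.1, hx.2.2⟩
  let f : (Σ _ : ℕ, ℕ) → (Fin (m + 2) → ℤ) × ℕ × ℕ := fun x =>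
    (A x.1 x.2, (D.nrm (A x.1 x.2)).natAbs / x.1, x.2 % ((D.nrm (A x.1 x.2)).natAbs / x.1))
  have hcard : 𝒯.card ≤ ((Fintype.piFinset fun _ : Fin (m + 2) => Finset.Icc (-(r N : ℤ)) (r N)) ×ˢ
      (Finset.range (M + 1) ×ˢ Finset.range (M + 1))).card := by
    refine Finset.card_le_card_of_injOn f ?_ ?_
    · intro x hx
      obtain ⟨h1, h2, h3, h4, h5, h6⟩ := h𝒯m x hx
      obtain ⟨q, hq1, hq2, hq3⟩ := hq x.1 x.2 h1 h6
      have hrr : r x.1 ≤ r N := by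
        have : (r x.1) ^ (m + 2) < (r N + 1) ^ (m + 2) := ((hr1 _).trans h2).trans_lt (hr2 N)
        exact Nat.lt_succ_iff.mp (lt_of_pow_lt_pow_left' _ this)
      have hdiv : (D.nrm (A x.1 x.2)).natAbs / x.1 = q := by rw [hq1]; exact Nat.mul_div_cancel_left _ h1
      simp only [f, Finset.coe_product, Set.mem_prod, Finset.mem_coe, Finset.mem_range, Fintype.mem_piFinset,
        Finset.mem_Icc, hdiv]
      refine ⟨fun i => abs_le.mp (((hA x.1 x.2 h1).2.1 i).trans (by exact_mod_cast hrr)), by omega, ?_⟩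
      have := Nat.mod_lt x.2 hq2
      omega
    · intro x hx y hy hxy
      obtain ⟨h1, h2, h3, h4, h5, h6⟩ := h𝒯m x hx
      obtain ⟨h1', h2', h3', h4', h5', h6'⟩ := h𝒯m y hy
      obtain ⟨q, hq1, hq2, hq3⟩ := hq x.1 x.2 h1 h6
      obtain ⟨q', hq1', hq2', hq3'⟩ := hq y.1 y.2 h1' h6'
      have hdiv : (D.nrm (A x.1 x.2)).natAbs / x.1 = q := by rw [hq1]; exact Nat.mul_div_cancel_left _ h1
      have hdiv' : (D.nrm (A y.1 y.2)).natAbs / y.1 = q' := by rw [hq1']; exact Nat.mul_div_cancel_left _ h1'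
      simp only [f, Prod.mk.injEq, hdiv, hdiv'] at hxy
      obtain ⟨hA1, hq, hmod⟩ := hxy
      subst hq
      have ha : x.1 = y.1 := by
        have := hq1
        rw [hA1, hq1'] at this
        exact (Nat.eq_of_mul_eq_mul_right hq2 this).symm
      have hdvd : (x.1 : ℤ) ∣ (x.2 : ℤ) - y.2 := by
        have h7 : x.1 ∣ ((x.2 : ℤ) - y.2).natAbs := by
          rw [← Nat.prod_primeFactors_of_squarefree h3]
          refine Finset.prod_primes_dvd _ (fun p hp => (Nat.prime_of_mem_primeFactors hp).prime) fun p hpm => ?_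
          have hp := Nat.prime_of_mem_primeFactors hpm
          have hpx := Nat.dvd_of_mem_primeFactors hpm
          rw [← Int.natCast_dvd]
          by_cases hpq : p ∣ q
          · exact (Int.natCast_dvd_natCast.mpr hpq).trans (Nat.modEq_iff_dvd.mp (show y.2 ≡ x.2 [MOD q] from hmod.symm))
          · by_contra hpn
            have hpx' : (p : ℤ) ∣ (x.1 : ℤ) := Int.natCast_dvd_natCast.mpr hpx
            have hpy' : (p : ℤ) ∣ (y.1 : ℤ) := Int.natCast_dvd_natCast.mpr (ha ▸ hpx)
            have h9 := D.sq_dvd_nrm hp (hpy'.trans (hdvdG _ _ h6')) (hpx'.trans (hdvdG _ _ h6))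
              (A := A x.1 x.2) (hA1 ▸ hpy'.trans (hA y.1 y.2 h1').2.2) (hpx'.trans (hA x.1 x.2 h1).2.2)
              (by
                rw [← mul_sub]
                intro h
                rcases (Nat.prime_iff_prime_int.mp hp).dvd_or_dvd h with h | h
                · exact hℓ p hp (h4 p hp hpx) h
                · exact hpn h)
            have h10 : p ^ 2 ∣ x.1 * q := by
              rw [← hq1]
              exact Int.natCast_dvd.mp (by push_cast; exact h9)
            have h11 : p ^ 2 ∣ x.1 := (Nat.Coprime.pow_left 2 ((Nat.Prime.coprime_iff_not_dvd hp).mpr hpq)).dvd_of_dvd_mul_right h10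
            have := h3 p (by rwa [← sq])
            exact hp.one_lt.ne' (Nat.isUnit_iff.mp this)
        exact Int.natCast_dvd.mpr h7
      have h8 : x.2 = y.2 :=
        (Nat.ModEq.eq_of_lt_of_lt (Nat.modEq_iff_dvd.mpr hdvd) (ha ▸ h5') h5).symm
      exact Sigma.ext ha (heq_of_eq h8)
  rw [Finset.card_product, Finset.card_product, Fintype.card_piFinset_const, Int.card_Icc, Finset.card_range] at hcard
  have h1r : 1 ≤ r N := by
    by_contra h
    have : r N = 0 := by omega
    have h2 := hr2 N
    rw [this] at h2
    simp at h2
    omega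
  have h2 : ((r N : ℤ) + 1 - -(r N : ℤ)).toNat ≤ 3 * r N := by omega
  have h3 : 𝒯.card ≤ (3 * r N) ^ (m + 2) * ((M + 1) * (M + 1)) :=
    hcard.trans (Nat.mul_le_mul_right _ (Nat.pow_le_pow_left h2 _))
  calc (𝒯.card : ℝ) ≤ (((3 * r N) ^ (m + 2) * ((M + 1) * (M + 1)) : ℕ) : ℝ) := by exact_mod_cast h3
    _ = 3 ^ (m + 2) * (M + 1) * (M + 1) * ((r N ^ (m + 2) : ℕ) : ℝ) := by push_cast; ring
    _ ≤ _ := by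
      gcongr
      exact hr1 N

end NormData

lemma isCoprime_of_rough {D₀ a : ℕ} {ℓ : ℤ} (hℓ : ∀ p : ℕ, p.Prime → D₀ < p → ¬ (p : ℤ) ∣ ℓ) (ha : Rough D₀ a) :
    IsCoprime (a : ℤ) ℓ := by
  rw [Int.isCoprime_iff_nat_coprime, Int.natAbs_natCast]
  exact Nat.coprime_of_dvd fun p hp hpa hpl => hℓ p hp (ha p hp hpa) (Int.natCast_dvd.mpr hpl)

lemma not_dvd_of_natAbs_le {D₀ : ℕ} {r : ℤ} (hr : r ≠ 0) (h : r.natAbs ≤ D₀) {p : ℕ} (hp : D₀ < p) :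
    ¬ (p : ℤ) ∣ r := fun hd => by
  have := Nat.le_of_dvd (Int.natAbs_pos.mpr hr) (Int.natCast_dvd.mp hd)
  omega

namespace NormData
variable {m : ℕ} (D : NormData m) {F : Polynomial ℤ} {ℓ : ℤ} {D₀ : ℕ}

lemma exists_family (hDF : ∀ n : ℤ, D.G.eval (ℓ * n) = ℓ ^ (m + 1) * F.eval n)
    (hℓ : ∀ p : ℕ, p.Prime → D₀ < p → ¬ (p : ℤ) ∣ ℓ) (hF : F.natDegree = m + 2)
    (hD₀ : 32 * (∑ i : Fin (m + 2), (i : ℕ)) * (m + 2) ≤ D₀) (hD₁ : 1 ≤ D₀) :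
    ∃ c C : ℝ, 0 < c ∧ 0 < C ∧ ∀ k : ℕ, ∃ (U₀ : ℝ) (P : ℕ), 1 ≤ U₀ ∧ ∀ U ≥ U₀, ∀ η : ℝ,
    U ^ (-(1 / (10 * F.natDegree)) : ℝ) ≤ η → η ≤ 1 / 2 → ∀ S : Finset ℕ, S.card ≤ k →
    (∀ p ∈ S, p.Prime ∧ P ≤ p) → ∃ (ι : Type) (𝒜 : Finset ι) (a : ι → ℕ) (n : ι → ℤ),
      (∀ i ∈ 𝒜, U < a i ∧ (a i : ℝ) ≤ U * Real.exp η ∧ Rough D₀ (a i) ∧ (∀ p ∈ S, ¬ p ∣ a i) ∧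
        (a i : ℤ) ∣ F.eval (n i)) ∧
      c * η * U ≤ (𝒜.card : ℝ) ∧
      ∀ (h : ℕ) (μ : ℤ), 0 < h → Rough D₀ h → (h : ℤ) ∣ F.eval μ → ∀ ω : ℝ, 0 < ω → η ≤ ω → ω ≤ 1 →
        (h : ℝ) ≤ 2 * ω ^ F.natDegree * U →
        ((𝒜.filter fun i => h ∣ a i ∧ (h : ℤ) ∣ n i - μ).card : ℝ) ≤ C * (ω * U / h) := by
  obtain ⟨c, C, hc, hC, hslab⟩ := D.exists_slab hD₀ hD₁
  obtain ⟨C', hC', hcell⟩ := D.card_slab_filter_dvd_le hC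
  refine ⟨c, C', hc, hC', fun k => ?_⟩
  obtain ⟨T₀, P, hT₀, h⟩ := hslab k
  refine ⟨T₀ ^ (m + 2), P, one_le_pow₀ hT₀, fun U hU η hη hη2 S hS hSP => ?_⟩
  have hU0 : 0 < U := lt_of_lt_of_le (by positivity) hU
  set T : ℝ := U ^ (1 / (m + 2 : ℝ)) with hT
  have hTU : T ^ (m + 2) = U := by
    rw [hT, ← Real.rpow_natCast, ← Real.rpow_mul hU0.le]
    push_cast
    rw [one_div_mul_cancel (by positivity), Real.rpow_one]
  have hTpos : 0 < T := Real.rpow_pos_of_pos hU0 _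
  have hTT : T₀ ≤ T := by
    by_contra hlt
    have := pow_lt_pow_left₀ (not_le.mp hlt) hTpos.le (by omega : m + 2 ≠ 0)
    rw [hTU] at this
    linarith
  have hTη : T ^ (-(1 / 10) : ℝ) ≤ η := by
    refine le_of_eq_of_le ?_ hη
    rw [hT, ← Real.rpow_mul hU0.le, hF]
    congr 1
    push_cast
    field_simp
  obtain ⟨𝒜, ν, hsl, hcard⟩ := h T hTT η hTη hη2 S hS hSP
  have habs : ∀ A, (((D.nrm A).natAbs : ℕ) : ℝ) = |(D.nrm A : ℝ)| := fun A => by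
    rw [Nat.cast_natAbs, Int.cast_abs]
  have hrough : ∀ A ∈ 𝒜, Rough D₀ (D.nrm A).natAbs := fun A hA p hp hpd => by
    by_contra hlt
    have h1 : (p : ℤ) ∣ (D₀.factorial : ℤ) := Int.natCast_dvd_natCast.mpr (hp.dvd_factorial.mpr (not_lt.mp hlt))
    have h2 := h1.trans (hsl.modEq A hA)
    have h3 := dvd_sub (Int.natCast_dvd.mpr hpd) h2
    rw [sub_sub_cancel] at h3
    exact hp.one_lt.ne' (Nat.dvd_one.mp (by exact_mod_cast h3))
  have hinv : ∀ A, ∃ n : ℤ, A ∈ 𝒜 → ((D.nrm A).natAbs : ℤ) ∣ ν A - ℓ * n := fun A => by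
    by_cases hA : A ∈ 𝒜
    · obtain ⟨u, v, huv⟩ := isCoprime_of_rough hℓ (hrough A hA)
      refine ⟨v * ν A, fun _ => ⟨u * ν A, ?_⟩⟩
      linear_combination (-ν A) * huv
    · exact ⟨0, fun h => absurd h hA⟩
  choose n hn using hinv
  refine ⟨_, 𝒜, fun A => (D.nrm A).natAbs, n, fun A hA => ⟨?_, ?_, hrough A hA, ?_, ?_⟩, ?_, ?_⟩
  · rw [habs, ← hTU]; exact hsl.lower A hA
  · rw [habs, ← hTU]; exact hsl.upper A hA
  · exact fun p hp h => hsl.not_dvd A hA p hp (Int.natCast_dvd.mpr h)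
  · have h1 : ((D.nrm A).natAbs : ℤ) ∣ D.G.eval (ν A) := Int.natAbs_dvd.mpr (hsl.dvd_eval A hA)
    have h2 := ((hn A hA).trans (Polynomial.sub_dvd_eval_sub (ν A) (ℓ * n A) D.G))
    have h3 := (dvd_sub_right h1).mp h2
    rw [hDF] at h3
    exact ((isCoprime_of_rough hℓ (hrough A hA)).pow_right).dvd_of_dvd_mul_left h3
  · rw [← hTU]; exact hcard
  · intro h μ hh hR hμ ω hω hηω hω1 hhω
    have h1 := hcell _ T η S 𝒜 ν hsl hTpos h (ℓ * μ) hh (by rw [hDF]; exact hμ.mul_left _) ω hω hηω hω1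
      (by rw [mul_pow, hTU, ← mul_assoc, ← hF]; exact hhω)
    rw [hTU] at h1
    refine le_trans ?_ h1
    norm_cast
    refine Finset.card_le_card fun A hA => ?_
    rw [Finset.mem_filter] at hA ⊢
    obtain ⟨hA, hhA, hhn⟩ := hA
    refine ⟨hA, ?_⟩
    have hhA' : (h : ℤ) ∣ ((D.nrm A).natAbs : ℤ) := Int.natCast_dvd_natCast.mpr hhA
    have h2 : (h : ℤ) ∣ ev A (ν A) := hhA'.trans (Int.natAbs_dvd.mpr (hsl.dvd_ev A hA))
    have h3 : (h : ℤ) ∣ ν A - ℓ * μ := by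
      have := dvd_add (hhA'.trans (hn A hA)) (hhn.mul_left ℓ)
      rwa [show ν A - ℓ * n A + ℓ * (n A - μ) = ν A - ℓ * μ by ring] at this
    exact (dvd_sub_right h2).mp (h3.trans (sub_dvd_ev_sub A _ _))

end NormData

lemma exists_goodPoly {F : Polynomial ℤ} (hF : Irreducible F) (hdeg : 2 ≤ F.natDegree) :
    ∃ D₀ : ℕ, 2 ≤ D₀ ∧ GoodPoly F D₀ := by
  obtain ⟨m, hm⟩ : ∃ m, F.natDegree = m + 2 := ⟨F.natDegree - 2, by omega⟩
  obtain ⟨D, hD⟩ := exists_normData hF hm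
  obtain ⟨r, hr, hrd⟩ := exists_common_multiple hF hdeg
  set ℓ := F.leadingCoeff with hℓ
  have hℓ0 : ℓ ≠ 0 := Polynomial.leadingCoeff_ne_zero.mpr hF.ne_zero
  set D₀ := 2 + r.natAbs + ℓ.natAbs + 32 * (∑ i : Fin (m + 2), (i : ℕ)) * (m + 2) +
    F.natDegree ^ (8 * F.natDegree) with hD₀
  have hℓ' : ∀ p : ℕ, p.Prime → D₀ < p → ¬ (p : ℤ) ∣ ℓ := fun p _ hp =>
    not_dvd_of_natAbs_le hℓ0 (by omega) hp
  refine ⟨D₀, by omega, hdeg, eval_ne_zero_of_irreducible hF hdeg, by omega, ?_, hℓ', D.average hD hℓ',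
    D.exists_family hD hℓ' hm (by omega) (by omega)⟩
  intro p _ hp n h1 h2
  exact not_dvd_of_natAbs_le hr (by omega) hp (hrd p n h1 h2)

lemma sum_div_le {f : ℕ → ℝ} {C : ℝ} (hC : 0 ≤ C) (h : ∀ N : ℕ, ∑ n ∈ Finset.Icc 1 N, f n ≤ C * N) {N : ℕ} (hN : 1 ≤ N) :
    ∑ n ∈ Finset.Icc 1 N, f n / n ≤ C * (2 + Real.log N) := by
  have key : ∀ N : ℕ, ∑ n ∈ Finset.Icc 1 N, f n / n ≤
      (∑ n ∈ Finset.Icc 1 N, f n) / N + C * ∑ n ∈ Finset.Icc 1 N, (1 : ℝ) / n := by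
    intro N
    induction N with
    | zero => simp
    | succ N ih =>
      rw [Finset.sum_Icc_succ_top (by omega), Finset.sum_Icc_succ_top (by omega), Finset.sum_Icc_succ_top (by omega)]
      set S := ∑ n ∈ Finset.Icc 1 N, f n with hS
      rcases Nat.eq_zero_or_pos N with rfl | hN
      · simp at ih hS ⊢
        rw [hS]; simp; exact hC
      · have hN' : (0 : ℝ) < N := by exact_mod_cast hN
        have h1 : S / N ≤ S / (N + 1 : ℝ) + C / (N + 1 : ℝ) := by
          rw [← add_div, div_le_div_iff₀ hN' (by positivity)]
          have := h N
          nlinarith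
        push_cast
        rw [add_div, mul_add, mul_one_div]
        linarith
  have hN' : (0 : ℝ) < N := by exact_mod_cast hN
  have h1 := key N
  have h2 : (∑ n ∈ Finset.Icc 1 N, f n) / N ≤ C := by
    rw [div_le_iff₀ hN']; exact h N
  have h3 : ∑ n ∈ Finset.Icc 1 N, (1 : ℝ) / n ≤ 1 + Real.log N := by
    have := harmonic_le_one_add_log N
    rw [harmonic_eq_sum_Icc] at this
    push_cast at this
    simpa using this
  nlinarith

lemma sum_powerset_prod_mul_sum_le (P : Finset ℕ) (w ℓ : ℕ → ℝ) (hw : ∀ p ∈ P, 0 ≤ w p) (hℓ : ∀ p ∈ P, 0 ≤ ℓ p) :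
    ∑ B ∈ P.powerset, (∏ p ∈ B, w p) * ∑ p ∈ B, ℓ p ≤ (∏ p ∈ P, (1 + w p)) * ∑ p ∈ P, w p * ℓ p := by
  induction P using Finset.induction_on with
  | empty => simp
  | insert q P hq ih =>
    have ih' := ih (fun p hp => hw p (Finset.mem_insert_of_mem hp)) fun p hp => hℓ p (Finset.mem_insert_of_mem hp)
    have hw' := hw q (Finset.mem_insert_self _ _)
    have hℓ' := hℓ q (Finset.mem_insert_self _ _)
    rw [Finset.sum_powerset_insert hq, Finset.prod_insert hq, Finset.sum_insert hq]
    have h1 : ∑ B ∈ P.powerset, (∏ p ∈ insert q B, w p) * ∑ p ∈ insert q B, ℓ p =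
        w q * ℓ q * (∏ p ∈ P, (1 + w p)) + w q * ∑ B ∈ P.powerset, (∏ p ∈ B, w p) * ∑ p ∈ B, ℓ p := by
      rw [Finset.prod_one_add, Finset.mul_sum, Finset.mul_sum, ← Finset.sum_add_distrib]
      refine Finset.sum_congr rfl fun B hB => ?_
      have : q ∉ B := fun h => hq (Finset.mem_powerset.mp hB h)
      rw [Finset.prod_insert this, Finset.sum_insert this]
      ring
    rw [h1]
    have h2 : 0 ≤ ∏ p ∈ P, (1 + w p) := Finset.prod_nonneg fun p hp => by
      have := hw p (Finset.mem_insert_of_mem hp)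
      linarith
    nlinarith [mul_le_mul_of_nonneg_left ih' hw', mul_nonneg (mul_nonneg hw' hw') (mul_nonneg hℓ' h2)]

/-- The primes in the interval `(s, t]`. -/
noncomputable def primesIn (s t : ℝ) : Finset ℕ :=
  (Finset.range (⌊t⌋₊ + 1)).filter fun p => p.Prime ∧ s < p

lemma mem_primesIn {s t : ℝ} {p : ℕ} : p ∈ primesIn s t ↔ p.Prime ∧ s < p ∧ (p : ℝ) ≤ t := by
  rw [primesIn, Finset.mem_filter, Finset.mem_range, Nat.lt_succ_iff]
  constructor
  · rintro ⟨h1, h2, h3⟩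
    exact ⟨h2, h3, (Nat.le_floor_iff' h2.ne_zero).mp h1⟩
  · rintro ⟨h1, h2, h3⟩
    exact ⟨(Nat.le_floor_iff' h1.ne_zero).mpr h3, h1, h2⟩

lemma primesIn_subset {s s' t t' : ℝ} (hs : s' ≤ s) (ht : t ≤ t') : primesIn s t ⊆ primesIn s' t' := fun p hp => by
  rw [mem_primesIn] at hp ⊢
  exact ⟨hp.1, by linarith, by linarith⟩

lemma prod_primesIn_mul {s u t : ℝ} (hs : s ≤ u) (hu : u ≤ t) (f : ℕ → ℝ) :
    (∏ p ∈ primesIn s u, f p) * ∏ p ∈ primesIn u t, f p = ∏ p ∈ primesIn s t, f p := by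
  rw [← Finset.prod_union]
  · refine Finset.prod_congr ?_ fun _ _ => rfl
    ext p
    simp only [Finset.mem_union, mem_primesIn]
    constructor
    · rintro (⟨h1, h2, h3⟩ | ⟨h1, h2, h3⟩)
      · exact ⟨h1, h2, h3.trans hu⟩
      · exact ⟨h1, hs.trans_lt h2, h3⟩
    · rintro ⟨h1, h2, h3⟩
      rcases le_or_gt (p : ℝ) u with h | h
      · exact Or.inl ⟨h1, h2, h⟩
      · exact Or.inr ⟨h1, h, h3⟩
  · rw [Finset.disjoint_left]
    intro p h1 h2
    rw [mem_primesIn] at h1 h2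
    linarith

lemma exists_sum_log_div_le : ∃ C : ℝ, 0 < C ∧ ∀ t : ℝ, 2 ≤ t →
    ∑ p ∈ primesIn 0 t, Real.log p / p ≤ C * Real.log t := by
  refine ⟨Real.log 4 * 4, by positivity, fun t ht => ?_⟩
  have h1 : ∀ N : ℕ, ∑ n ∈ Finset.Icc 1 N, (if n.Prime then Real.log n else 0) ≤ Real.log 4 * N := by
    intro N
    have := Chebyshev.theta_le_log4_mul_x (x := N) (by positivity)
    rw [Chebyshev.theta, Nat.floor_natCast, Finset.sum_filter] at this
    refine le_of_eq_of_le ?_ this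
    refine Finset.sum_congr ?_ fun _ _ => rfl
    ext; simp; omega
  have h2 := sum_div_le (by positivity) h1 (N := ⌊t⌋₊) (Nat.le_floor (by norm_num; linarith))
  have h3 : ∑ p ∈ primesIn 0 t, Real.log p / p ≤
      ∑ n ∈ Finset.Icc 1 ⌊t⌋₊, (if n.Prime then Real.log n else 0) / n := by
    refine le_of_eq_of_le ?_ (Finset.sum_le_sum_of_subset_of_nonneg (s := primesIn 0 t) ?_ ?_)
    · refine Finset.sum_congr rfl fun p hp => ?_
      rw [if_pos (mem_primesIn.mp hp).1]
    · intro p hp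
      rw [mem_primesIn] at hp
      rw [Finset.mem_Icc]
      exact ⟨hp.1.one_lt.le, Nat.le_floor hp.2.2⟩
    · intro n hn _
      have : 1 ≤ n := (Finset.mem_Icc.mp hn).1
      have : (1 : ℝ) ≤ n := by exact_mod_cast this
      split_ifs
      · have := Real.log_nonneg this
        positivity
      · simp
  have h4 : Real.log ⌊t⌋₊ ≤ Real.log t := Real.log_le_log
    (by exact_mod_cast Nat.floor_pos.mpr (by linarith)) (Nat.floor_le (by linarith))
  have h5 : (0.69 : ℝ) ≤ Real.log t := by
    have := Real.log_le_log (by norm_num) ht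
    have := Real.log_two_gt_d9
    linarith
  have h6 : (0 : ℝ) ≤ Real.log 4 := by positivity
  calc _ ≤ _ := h3.trans h2
    _ ≤ Real.log 4 * (4 * Real.log t) := by gcongr; linarith
    _ = _ := by ring

/-- The squarefree integers with all prime factors in `(s, t]`. -/
noncomputable def psfFin (s t : ℝ) : Finset ℕ := (primesIn s t).powerset.image fun B => ∏ p ∈ B, p

lemma prime_of_mem_powerset {s t : ℝ} {B : Finset ℕ} (hB : B ∈ (primesIn s t).powerset) : ∀ p ∈ B, p.Prime :=
  fun _ hp => (mem_primesIn.mp (Finset.mem_powerset.mp hB hp)).1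

lemma mem_psfFin {s t : ℝ} {a : ℕ} : a ∈ psfFin s t ↔
    0 < a ∧ Squarefree a ∧ ∀ p : ℕ, p.Prime → p ∣ a → s < (p : ℝ) ∧ (p : ℝ) ≤ t := by
  rw [psfFin, Finset.mem_image]
  constructor
  · rintro ⟨B, hB, rfl⟩
    have hp := prime_of_mem_powerset hB
    refine ⟨Finset.prod_pos fun p h => (hp p h).pos, ?_, fun p hpp hpd => ?_⟩
    · refine Finset.squarefree_prod_of_pairwise_isCoprime (fun p h q h' hpq => ?_) fun p h => (hp p h).prime.squarefree
      exact Nat.coprime_iff_isRelPrime.mp ((Nat.coprime_primes (hp p h) (hp q h')).mpr hpq)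
    · obtain ⟨q, hq, hpq⟩ := (hpp.prime.dvd_finsetProd_iff _).mp hpd
      rw [(Nat.prime_dvd_prime_iff_eq hpp (hp q hq)).mp hpq]
      exact (mem_primesIn.mp (Finset.mem_powerset.mp hB hq)).2
  · rintro ⟨h1, h2, h3⟩
    refine ⟨a.primeFactors, Finset.mem_powerset.mpr fun p hp => ?_, Nat.prod_primeFactors_of_squarefree h2⟩
    rw [mem_primesIn]
    exact ⟨Nat.prime_of_mem_primeFactors hp, h3 p (Nat.prime_of_mem_primeFactors hp) (Nat.dvd_of_mem_primeFactors hp)⟩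

lemma sum_psfFin (s t : ℝ) (G : ℕ → ℝ) :
    ∑ a ∈ psfFin s t, G a = ∑ B ∈ (primesIn s t).powerset, G (∏ p ∈ B, p) := by
  rw [psfFin, Finset.sum_image]
  intro B hB B' hB' h
  simp only at h
  rw [← Nat.primeFactors_prod (prime_of_mem_powerset hB), h, Nat.primeFactors_prod (prime_of_mem_powerset hB')]

lemma polyRho_one (F : Polynomial ℤ) : polyRho F 1 = 1 := by simp [polyRho_eq]

lemma polyRho_prod (F : Polynomial ℤ) {B : Finset ℕ} (hB : ∀ p ∈ B, p.Prime) :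
    polyRho F (∏ p ∈ B, p) = ∏ p ∈ B, polyRho F p := by
  induction B using Finset.induction_on with
  | empty => simp [polyRho_one]
  | insert q B hq ih =>
    have hB' : ∀ p ∈ B, p.Prime := fun p hp => hB p (Finset.mem_insert_of_mem hp)
    have hq' := hB q (Finset.mem_insert_self _ _)
    rw [Finset.prod_insert hq, Finset.prod_insert hq, polyRho_mul_of_coprime F hq'.pos
      (Finset.prod_pos fun p h => (hB' p h).pos), ih hB']
    refine Nat.Coprime.prod_right fun p hp => (Nat.coprime_primes hq' (hB' p hp)).mpr ?_
    rintro rfl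
    exact hq hp

lemma rho_div_prod (F : Polynomial ℤ) {B : Finset ℕ} (hB : ∀ p ∈ B, p.Prime) :
    (polyRho F (∏ p ∈ B, p) : ℝ) / ((∏ p ∈ B, p : ℕ) : ℝ) = ∏ p ∈ B, ((polyRho F p : ℝ) / p) := by
  rw [polyRho_prod F hB, Finset.prod_div_distrib]
  push_cast
  rfl

lemma prod_one_add_rho (F : Polynomial ℤ) (s t : ℝ) :
    ∏ p ∈ primesIn s t, (1 + (polyRho F p : ℝ) / p) = ∑ a ∈ psfFin s t, (polyRho F a : ℝ) / a := by
  rw [sum_psfFin, Finset.prod_one_add]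
  exact Finset.sum_congr rfl fun B hB => (rho_div_prod F (prime_of_mem_powerset hB)).symm

lemma log_ge_of_two_le {t : ℝ} (ht : 2 ≤ t) : (0.69 : ℝ) ≤ Real.log t := by
  have := Real.log_le_log (by norm_num) ht
  have := Real.log_two_gt_d9
  linarith

namespace GoodPoly
variable {F : Polynomial ℤ} {D₀ : ℕ} (H : GoodPoly F D₀)
include H

lemma sum_rho_log_le : ∃ C : ℝ, 0 < C ∧ ∀ t : ℝ, 2 ≤ t →
    ∑ p ∈ primesIn D₀ t, (polyRho F p : ℝ) / p * Real.log p ≤ C * Real.log t := by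
  obtain ⟨C, hC, h⟩ := exists_sum_log_div_le
  refine ⟨F.natDegree * C, by have := H.two_le; positivity, fun t ht => ?_⟩
  calc _ ≤ ∑ p ∈ primesIn D₀ t, (F.natDegree : ℝ) * (Real.log p / p) := Finset.sum_le_sum fun p hp => ?_
    _ ≤ ∑ p ∈ primesIn 0 t, (F.natDegree : ℝ) * (Real.log p / p) :=
        Finset.sum_le_sum_of_subset_of_nonneg (primesIn_subset (by positivity) le_rfl) fun p hp _ => by positivity
    _ ≤ _ := by
        rw [← Finset.mul_sum, mul_assoc]
        exact mul_le_mul_of_nonneg_left (h t ht) (by positivity)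
  rw [mem_primesIn] at hp
  have h1 : (polyRho F p : ℝ) ≤ F.natDegree := by
    exact_mod_cast H.rho_prime_le hp.1 (by exact_mod_cast hp.2.1)
  have h2 : 0 ≤ Real.log p := by positivity
  rw [div_mul_eq_mul_div, mul_div_assoc]
  gcongr

lemma prod_rho_le : ∃ C : ℝ, 0 < C ∧ ∀ t : ℝ, 2 ≤ t →
    ∏ p ∈ primesIn D₀ t, (1 + (polyRho F p : ℝ) / p) ≤ C * Real.log t := by
  obtain ⟨C₁, hC₁, h1⟩ := H.sum_rho_log_le
  obtain ⟨C, hC, hav⟩ := H.average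
  refine ⟨2 * (C * (2 / 0.69 + 2 * C₁)), by positivity, fun t ht => ?_⟩
  have hlt := log_ge_of_two_le ht
  set L := C₁ * Real.log t with hL
  have hL0 : 0 < L := by positivity
  set V := ∏ p ∈ primesIn D₀ t, (1 + (polyRho F p : ℝ) / p) with hV
  have hV0 : 0 ≤ V := by positivity
  have hVs := prod_one_add_rho F D₀ t
  have hmark : ∑ a ∈ psfFin D₀ t, (polyRho F a : ℝ) / a * Real.log a ≤ V * L := by
    have h2 := sum_powerset_prod_mul_sum_le (primesIn D₀ t) (fun p => (polyRho F p : ℝ) / p) (fun p => Real.log p)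
      (fun p _ => by positivity) (fun p _ => by positivity)
    rw [sum_psfFin]
    refine le_trans (le_of_eq ?_) (h2.trans (mul_le_mul_of_nonneg_left (h1 t ht) hV0))
    refine Finset.sum_congr rfl fun B hB => ?_
    have hp := prime_of_mem_powerset hB
    rw [rho_div_prod F hp]
    push_cast
    rw [Real.log_prod fun p h => by have := (hp p h).pos; positivity]
  set N := ⌊Real.exp (2 * L)⌋₊ with hN
  have hN1 : 1 ≤ N := Nat.le_floor (by rw [Nat.cast_one]; exact Real.one_le_exp (by positivity))
  have hsmall : ∑ a ∈ (psfFin D₀ t).filter (fun a : ℕ => Real.log a ≤ 2 * L), (polyRho F a : ℝ) / a ≤ C * (2 + 2 * L) := by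
    have h3 := sum_div_le (f := fun a => if Squarefree a ∧ Rough D₀ a then (polyRho F a : ℝ) else 0) hC.le
      (fun N => by rw [← Finset.sum_filter]; exact hav N) hN1
    have h4 : Real.log N ≤ 2 * L := by
      rw [← Real.log_exp (2 * L)]
      exact Real.log_le_log (by exact_mod_cast hN1) (Nat.floor_le (by positivity))
    refine le_trans ?_ (h3.trans (by gcongr))
    refine le_of_eq_of_le (Finset.sum_congr rfl fun a ha => ?_)
      (Finset.sum_le_sum_of_subset_of_nonneg (s := (psfFin D₀ t).filter (fun a : ℕ => Real.log a ≤ 2 * L)) ?_ ?_)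
    · rw [Finset.mem_filter, mem_psfFin] at ha
      rw [if_pos]
      exact ⟨ha.1.2.1, fun p hp hpd => by exact_mod_cast (ha.1.2.2 p hp hpd).1⟩
    · intro a ha
      rw [Finset.mem_filter, mem_psfFin] at ha
      have ha0 : (0 : ℝ) < a := by exact_mod_cast ha.1.1
      exact Finset.mem_Icc.mpr ⟨ha.1.1, Nat.le_floor (by rw [← Real.log_le_iff_le_exp ha0]; exact ha.2)⟩
    · intro a _ _
      split_ifs <;> positivity
  have hbig : ∑ a ∈ (psfFin D₀ t).filter (fun a : ℕ => ¬ Real.log a ≤ 2 * L), (polyRho F a : ℝ) / a * (2 * L) ≤ V * L := by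
    refine le_trans ?_ hmark
    refine (Finset.sum_le_sum fun a ha => ?_).trans (Finset.sum_le_sum_of_subset_of_nonneg (Finset.filter_subset _ _) ?_)
    · have := (Finset.mem_filter.mp ha).2
      gcongr
      linarith
    · intro a _ _
      positivity
  rw [← Finset.sum_mul] at hbig
  have hsplit := Finset.sum_filter_add_sum_filter_not (psfFin D₀ t) (fun a : ℕ => Real.log a ≤ 2 * L)
    (fun a => (polyRho F a : ℝ) / a)
  rw [← hVs] at hsplit
  have hbig' : ∑ a ∈ (psfFin D₀ t).filter (fun a : ℕ => ¬ Real.log a ≤ 2 * L), (polyRho F a : ℝ) / a ≤ V / 2 := by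
    rw [← mul_assoc] at hbig
    have := le_of_mul_le_mul_right hbig hL0
    linarith
  have h5 : V ≤ 2 * (C * (2 + 2 * L)) := by linarith
  refine h5.trans ?_
  rw [hL, mul_assoc, mul_assoc]
  gcongr
  have : 2 ≤ 2 / 0.69 * Real.log t := by
    rw [div_mul_eq_mul_div, le_div_iff₀ (by norm_num)]; linarith
  linarith

lemma sum_rough_le : ∃ C : ℝ, 0 < C ∧ ∀ N : ℕ,
    ∑ a ∈ (Finset.Icc 1 N).filter (fun a => Rough D₀ a), (polyRho F a : ℝ) / a ≤
      C * ∏ p ∈ primesIn D₀ N, (1 + (polyRho F p : ℝ) / p) := by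
  have hsum : Summable fun q : ℕ => 1 / (q : ℝ) ^ (3 / 2 : ℝ) :=
    Real.summable_one_div_nat_rpow.mpr (by norm_num)
  refine ⟨(∑' q : ℕ, 1 / (q : ℝ) ^ (3 / 2 : ℝ)) + 1, add_pos_of_nonneg_of_pos (tsum_nonneg fun q => by positivity) one_pos, fun N => ?_⟩
  choose s q hs hq hsq hsf using fun (a : ℕ) (ha : 0 < a) => Nat.sq_mul_squarefree_of_pos ha
  set I := (Finset.Icc 1 N).filter (fun a => Rough D₀ a) with hI
  have hIm : ∀ a ∈ I, 0 < a ∧ a ≤ N ∧ Rough D₀ a := fun a ha => by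
    rw [hI, Finset.mem_filter, Finset.mem_Icc] at ha
    exact ⟨ha.1.1, ha.1.2, ha.2⟩
  set G : ℕ × ℕ → ℝ := fun x => (polyRho F x.1 : ℝ) / x.1 * (1 / (x.2 : ℝ) ^ (3 / 2 : ℝ)) with hG
  have h1 : ∑ a ∈ I, (polyRho F a : ℝ) / a ≤ ∑ x ∈ psfFin D₀ N ×ˢ Finset.range (N + 1), G x := by
    have hval : ∀ a (ha : 0 < a), Rough D₀ a → (polyRho F a : ℝ) / a ≤ G (s a ha, q a ha) := by
      intro a ha hR
      have e := hsq a ha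
      have hs0 := hs a ha
      have hq0 := hq a ha
      set s' := s a ha
      set q' := q a ha
      have h2 := H.rho_mul_le hs0 (pow_pos hq0 2) (hR.of_dvd (Dvd.intro _ e))
      rw [mul_comm, e] at h2
      have hq1 : (1 : ℝ) ≤ q' := by exact_mod_cast hq0
      have hs1 : (1 : ℝ) ≤ s' := by exact_mod_cast hs0
      have h3 : ((q' ^ 2 : ℕ) : ℝ) ^ (1 / (8 * F.natDegree) : ℝ) ≤ (q' : ℝ) ^ (1 / 2 : ℝ) := by
        push_cast
        rw [← Real.rpow_natCast, ← Real.rpow_mul (by positivity)]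
        refine Real.rpow_le_rpow_of_exponent_le hq1 ?_
        have : (2 : ℝ) ≤ F.natDegree := by exact_mod_cast H.two_le
        rw [mul_one_div, div_le_div_iff₀ (by positivity) (by norm_num)]
        push_cast
        linarith
      have h4 : (a : ℝ) = (q' : ℝ) ^ (1 / 2 : ℝ) * (q' : ℝ) ^ (3 / 2 : ℝ) * s' := by
        rw [← Real.rpow_add (by positivity), ← e]
        push_cast
        norm_num
      have h5 : (polyRho F a : ℝ) ≤ (q' : ℝ) ^ (1 / 2 : ℝ) * polyRho F s' :=
        h2.trans (mul_le_mul_of_nonneg_right h3 (by positivity))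
      rw [hG]
      simp only
      rw [div_mul_div_comm, mul_one, div_le_div_iff₀ (by positivity) (by positivity), h4]
      calc _ ≤ ((q' : ℝ) ^ (1 / 2 : ℝ) * polyRho F s') * (↑s' * (q' : ℝ) ^ (3 / 2 : ℝ)) := by gcongr
        _ = _ := by ring
    calc _ ≤ ∑ a ∈ I.attach, G (s a (hIm a a.2).1, q a (hIm a a.2).1) := by
          rw [← Finset.sum_attach]
          exact Finset.sum_le_sum fun a _ => hval _ _ (hIm a a.2).2.2
      _ = ∑ x ∈ Finset.image (fun a : {x // x ∈ I} => (s a (hIm a a.2).1, q a (hIm a a.2).1)) I.attach, G x := by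
          rw [Finset.sum_image]
          intro a _ b _ hab
          simp only [Prod.mk.injEq] at hab
          refine Subtype.ext ?_
          rw [← hsq a (hIm a a.2).1, ← hsq b (hIm b b.2).1, hab.1, hab.2]
      _ ≤ _ := by
          refine Finset.sum_le_sum_of_subset_of_nonneg ?_ fun x _ _ => by positivity
          intro x hx
          obtain ⟨a, -, rfl⟩ := Finset.mem_image.mp hx
          obtain ⟨h0, hN, hR⟩ := hIm a a.2
          have hd1 : s a h0 ∣ a := Dvd.intro_left _ (hsq a h0)
          have hd2 : q a h0 ∣ a := (dvd_pow_self _ two_ne_zero).trans (Dvd.intro _ (hsq a h0))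
          rw [Finset.mem_product, Finset.mem_range, mem_psfFin]
          refine ⟨⟨hs _ _, hsf _ _, fun p hp hpd => ⟨by exact_mod_cast hR p hp (hpd.trans hd1), ?_⟩⟩, ?_⟩
          · exact_mod_cast (Nat.le_of_dvd h0 (hpd.trans hd1)).trans hN
          · exact Nat.lt_succ_of_le ((Nat.le_of_dvd h0 hd2).trans hN)
  refine h1.trans ?_
  rw [hG, Finset.sum_product, prod_one_add_rho]
  simp only
  rw [← Finset.sum_mul_sum, mul_comm]
  refine mul_le_mul_of_nonneg_right ?_ (Finset.sum_nonneg fun _ _ => by positivity)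
  have := hsum.sum_le_tsum (Finset.range (N + 1)) fun q _ => by positivity
  linarith

end GoodPoly

lemma exp_half_le_two : Real.exp (1 / 2) ≤ 2 := by
  have h1 : Real.exp (1 / 2) ^ 2 = Real.exp 1 := by
    rw [← Real.exp_nat_mul]; norm_num
  have h2 := Real.exp_one_lt_d9
  nlinarith [Real.exp_pos (1 / 2)]

namespace GoodPoly
variable {F : Polynomial ℤ} {D₀ : ℕ} (H : GoodPoly F D₀)
include H

lemma exists_dyadic_ge : ∃ (c : ℝ) (j₀ : ℕ), 0 < c ∧ ∀ j : ℕ, j₀ ≤ j →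
    c ≤ ∑ a ∈ (Finset.Ioc (2 ^ j) (2 ^ (j + 1))).filter (fun a => Rough D₀ a), (polyRho F a : ℝ) / a := by
  obtain ⟨c, C, hc, hC, hslab⟩ := H.slab
  obtain ⟨U₀, P, hU₀, h⟩ := hslab 0
  obtain ⟨j₁, hj₁⟩ := pow_unbounded_of_one_lt U₀ (one_lt_two : (1 : ℝ) < 2)
  have hg : 0 < F.natDegree := by have := H.two_le; omega
  have hg' : (0 : ℝ) < F.natDegree := by exact_mod_cast hg
  refine ⟨c / (4 * C), max j₁ (10 * F.natDegree), by positivity, fun j hj => ?_⟩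
  set U : ℝ := 2 ^ j with hU
  have hU0 : 0 < U := by positivity
  obtain ⟨ι, 𝒜, a, n, hA, hcard, hcell⟩ := h U (hj₁.le.trans (pow_le_pow_right₀ one_le_two ((le_max_left _ _).trans hj)))
    (1 / 2) (by
      rw [hU, ← Real.rpow_natCast, ← Real.rpow_mul (by norm_num), one_div (2 : ℝ), ← Real.rpow_neg_one]
      refine Real.rpow_le_rpow_of_exponent_le one_le_two ?_
      have : (10 * F.natDegree : ℝ) ≤ j := by exact_mod_cast (le_max_right _ _).trans hj
      rw [mul_neg, mul_one_div, neg_le_neg_iff, le_div_iff₀ (by positivity)]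
      linarith) le_rfl ∅ (by simp) (by simp)
  have hA2 : ∀ i ∈ 𝒜, (a i : ℝ) ≤ 2 * U := fun i hi => by
    have := (hA i hi).2.1
    nlinarith [exp_half_le_two]
  set I := (Finset.Ioc (2 ^ j) (2 ^ (j + 1))).filter (fun a => Rough D₀ a) with hI
  set t := I.sigma fun a => (Finset.range a).filter fun n : ℕ => (a : ℤ) ∣ F.eval (n : ℤ) with ht
  have hapos : ∀ i ∈ 𝒜, (0 : ℤ) < a i := fun i hi => by
    have : (0 : ℝ) < a i := hU0.trans (hA i hi).1
    exact_mod_cast this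
  have hfib := card_le_mul_card_fibers (s := 𝒜) (t := t) (fun i => (⟨a i, (n i % a i).toNat⟩ : Σ _ : ℕ, ℕ))
    (K := C) (by
      intro i hi
      obtain ⟨h1, h2, h3, -, h5⟩ := hA i hi
      have hm0 := Int.emod_nonneg (n i) (hapos i hi).ne'
      rw [ht, Finset.mem_sigma, hI, Finset.mem_filter, Finset.mem_Ioc, Finset.mem_filter, Finset.mem_range]
      refine ⟨⟨⟨by rw [hU] at h1; exact_mod_cast h1, ?_⟩, h3⟩, ?_, ?_⟩
      · have := hA2 i hi
        rw [hU, ← pow_succ'] at this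
        exact_mod_cast this
      · have := Int.emod_lt_of_pos (n i) (hapos i hi)
        simp only
        omega
      · simp only
        rw [Int.toNat_of_nonneg hm0]
        have h6 : (a i : ℤ) ∣ n i - n i % a i := Int.dvd_self_sub_emod
        exact (dvd_sub_right h5).mp (h6.trans (Polynomial.sub_dvd_eval_sub _ _ F)))
    (by
      rintro ⟨b, r⟩ hb
      rw [ht, Finset.mem_sigma, hI, Finset.mem_filter, Finset.mem_Ioc, Finset.mem_filter, Finset.mem_range] at hb
      obtain ⟨⟨⟨h1, h2⟩, h3⟩, h4, h5⟩ := hb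
      simp only at h1 h2 h3 h4 h5
      have hb0 : 0 < b := lt_of_le_of_lt (Nat.zero_le _) h1
      have h1' : U < b := by rw [hU]; exact_mod_cast h1
      have h2' : (b : ℝ) ≤ 2 * U := by rw [hU, ← pow_succ']; exact_mod_cast h2
      have h6 := hcell b r hb0 h3 h5 1 one_pos (by norm_num) le_rfl (by rw [one_pow, mul_one]; exact h2')
      have h7 : C * (1 * U / b) ≤ C := by
        rw [one_mul]
        have : U / b ≤ 1 := by rw [div_le_one (by positivity)]; exact h1'.le
        nlinarith
      refine le_trans ?_ (h6.trans h7)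
      norm_cast
      refine Finset.card_le_card fun i hi => ?_
      rw [Finset.mem_filter] at hi ⊢
      obtain ⟨hi, he⟩ := hi
      have e1 : a i = b := congrArg Sigma.fst he
      have e2 : (n i % a i).toNat = r := by
        have := he
        rw [Sigma.mk.injEq] at this
        exact eq_of_heq this.2
      refine ⟨hi, by rw [e1], ?_⟩
      have hm0 := Int.emod_nonneg (n i) (hapos i hi).ne'
      rw [← e2, Int.toNat_of_nonneg hm0, ← e1]
      exact Int.dvd_self_sub_emod)
  have h8 : (t.card : ℝ) ≤ 2 * U * ∑ a ∈ I, (polyRho F a : ℝ) / a := by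
    rw [ht, Finset.card_sigma, Nat.cast_sum, Finset.mul_sum]
    refine Finset.sum_le_sum fun b hb => ?_
    rw [hI, Finset.mem_filter, Finset.mem_Ioc] at hb
    have hb0 : 0 < b := lt_of_le_of_lt (Nat.zero_le _) hb.1.1
    have h2' : (b : ℝ) ≤ 2 * U := by rw [hU, ← pow_succ']; exact_mod_cast hb.1.2
    rw [← polyRho_eq, mul_div_assoc', le_div_iff₀ (by positivity), mul_comm]
    gcongr
  have h9 : c * (1 / 2) * U ≤ C * (2 * U * ∑ a ∈ I, (polyRho F a : ℝ) / a) :=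
    hcard.trans (hfib.trans (mul_le_mul_of_nonneg_left h8 hC.le))
  rw [div_le_iff₀ (by positivity)]
  have : c * (1 / 2) * U ≤ (2 * C * ∑ a ∈ I, (polyRho F a : ℝ) / a) * U := by linarith
  have := le_of_mul_le_mul_right this hU0
  linarith

lemma prod_rho_ge : ∃ c : ℝ, 0 < c ∧ ∀ t : ℝ, 1 ≤ t →
    c * Real.log t ≤ ∏ p ∈ primesIn D₀ t, (1 + (polyRho F p : ℝ) / p) := by
  obtain ⟨c, j₀, hc, h⟩ := H.exists_dyadic_ge
  obtain ⟨C, hC, hr⟩ := H.sum_rough_le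
  have h1 : ∀ N : ℕ, c * (N - j₀) ≤
      ∑ a ∈ (Finset.Icc 1 (2 ^ N)).filter (fun a => Rough D₀ a), (polyRho F a : ℝ) / a := by
    intro N
    induction N with
    | zero =>
      refine le_trans ?_ (Finset.sum_nonneg fun _ _ => by positivity)
      have : (0 : ℝ) ≤ j₀ := by positivity
      push_cast
      nlinarith
    | succ N ih =>
      by_cases hN : j₀ ≤ N
      · have h2 := h N hN
        have h3 : Finset.Icc 1 (2 ^ (N + 1)) = Finset.Icc 1 (2 ^ N) ∪ Finset.Ioc (2 ^ N) (2 ^ (N + 1)) := by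
          have e1 : 2 ^ N ≤ 2 ^ (N + 1) := Nat.pow_le_pow_right (by norm_num) (by omega)
          have e2 : 1 ≤ 2 ^ N := Nat.one_le_two_pow
          ext x
          simp only [Finset.mem_union, Finset.mem_Icc, Finset.mem_Ioc]
          omega
        rw [h3, Finset.filter_union, Finset.sum_union]
        · push_cast
          linarith
        · refine Finset.disjoint_filter_filter ?_
          rw [Finset.disjoint_left]
          intro x hx hx'
          rw [Finset.mem_Icc] at hx
          rw [Finset.mem_Ioc] at hx'
          omega
      · refine le_trans ?_ (Finset.sum_nonneg fun _ _ => by positivity)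
        have : ((N + 1 : ℕ) : ℝ) ≤ j₀ := by exact_mod_cast (by omega)
        nlinarith
  refine ⟨1 / (C / c + j₀ + 1), by positivity, fun t ht => ?_⟩
  set V := ∏ p ∈ primesIn D₀ t, (1 + (polyRho F p : ℝ) / p) with hV
  have hV1 : 1 ≤ V := Finset.one_le_prod fun p _ => by
    have : 0 ≤ (polyRho F p : ℝ) / p := by positivity
    linarith
  set N := Nat.log 2 ⌊t⌋₊ with hN
  have hf : ⌊t⌋₊ ≠ 0 := (Nat.floor_pos.mpr ht).ne'
  have h2 : ((2 ^ N : ℕ) : ℝ) ≤ t := by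
    refine le_trans ?_ (Nat.floor_le (by linarith))
    exact_mod_cast Nat.pow_log_le_self 2 hf
  have h3 : t ≤ 2 ^ (N + 1) := by
    have h4 : ⌊t⌋₊ + 1 ≤ 2 ^ (N + 1) := Nat.lt_pow_succ_log_self one_lt_two _
    refine (Nat.lt_floor_add_one t).le.trans ?_
    exact_mod_cast h4
  have h4 : Real.log t ≤ N + 1 := by
    have := Real.log_le_log (by linarith) h3
    rw [Real.log_pow] at this
    have h5 := Real.log_two_lt_d9
    push_cast at this
    have h6 : (0 : ℝ) ≤ N := by positivity
    nlinarith
  have h5 : c * (N - j₀) ≤ C * V := by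
    refine (h1 N).trans ((hr _).trans (mul_le_mul_of_nonneg_left ?_ hC.le))
    refine Finset.prod_le_prod_of_subset_of_one_le (primesIn_subset le_rfl h2) (fun p _ => by positivity) fun p _ _ => ?_
    have : 0 ≤ (polyRho F p : ℝ) / p := by positivity
    linarith
  rw [one_div_mul_eq_div, div_le_iff₀ (by positivity)]
  have h6 : (N : ℝ) - j₀ ≤ C / c * V := by
    rw [div_mul_eq_mul_div, le_div_iff₀ hc]; linarith
  have h7 : (j₀ : ℝ) ≤ j₀ * V := by nlinarith [(by positivity : (0 : ℝ) ≤ j₀)]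
  nlinarith

lemma sum_rough_le_log : ∃ C : ℝ, 0 < C ∧ ∀ N : ℕ, 2 ≤ N →
    ∑ a ∈ (Finset.Icc 1 N).filter (fun a => Rough D₀ a), (polyRho F a : ℝ) / a ≤ C * Real.log N := by
  obtain ⟨C, hC, h⟩ := H.sum_rough_le
  obtain ⟨C', hC', h'⟩ := H.prod_rho_le
  refine ⟨C * C', by positivity, fun N hN => (h N).trans ?_⟩
  rw [mul_assoc]
  exact mul_le_mul_of_nonneg_left (h' N (by exact_mod_cast hN)) hC.le

end GoodPoly

lemma sq_sum_card_le {ι : Type*} (I : Finset ι) (X Y : Finset ℕ) (R : ι → ℕ → Prop) [∀ i n, Decidable (R i n)]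
    (hY : ∀ n ∈ X, ∀ i ∈ I, R i n → n ∈ Y) :
    (∑ i ∈ I, ((X.filter fun n => R i n).card : ℝ)) ^ 2 ≤
      (Y.card : ℝ) * ∑ i ∈ I, ∑ j ∈ I, ((X.filter fun n => R i n ∧ R j n).card : ℝ) := by
  have h2 : ∑ i ∈ I, ((X.filter fun n => R i n).card : ℝ) =
      ∑ n ∈ X ∩ Y, ∑ i ∈ I, (if R i n then (1 : ℝ) else 0) := by
    rw [Finset.sum_comm]
    refine Finset.sum_congr rfl fun i hi => ?_
    rw [Finset.sum_boole]
    congr 2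
    ext n
    simp only [Finset.mem_filter, Finset.mem_inter]
    exact ⟨fun h => ⟨⟨h.1, hY n h.1 i hi h.2⟩, h.2⟩, fun h => ⟨h.1.1, h.2⟩⟩
  have h3 : ∑ i ∈ I, ∑ j ∈ I, ((X.filter fun n => R i n ∧ R j n).card : ℝ) =
      ∑ n ∈ X, (∑ i ∈ I, (if R i n then (1 : ℝ) else 0)) ^ 2 := by
    calc _ = ∑ i ∈ I, ∑ j ∈ I, ∑ n ∈ X, (if R i n then (1 : ℝ) else 0) * (if R j n then (1 : ℝ) else 0) := by
          refine Finset.sum_congr rfl fun i _ => Finset.sum_congr rfl fun j _ => ?_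
          rw [← Finset.sum_boole]
          refine Finset.sum_congr rfl fun n _ => ?_
          by_cases hi : R i n <;> by_cases hj : R j n <;> simp [hi, hj]
      _ = ∑ n ∈ X, ∑ i ∈ I, ∑ j ∈ I, (if R i n then (1 : ℝ) else 0) * (if R j n then (1 : ℝ) else 0) := by
          rw [Finset.sum_comm]
          rw [Finset.sum_congr rfl fun j _ => Finset.sum_comm]
          rw [Finset.sum_comm]
          refine Finset.sum_congr rfl fun n _ => Finset.sum_comm
      _ = _ := by
          refine Finset.sum_congr rfl fun n _ => ?_
          rw [sq, Finset.sum_mul_sum]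
  rw [h2, h3]
  calc _ ≤ ((X ∩ Y).card : ℝ) * ∑ n ∈ X ∩ Y, (∑ i ∈ I, (if R i n then (1 : ℝ) else 0)) ^ 2 :=
        sq_sum_le_card_mul_sum_sq
    _ ≤ (Y.card : ℝ) * ∑ n ∈ X ∩ Y, (∑ i ∈ I, (if R i n then (1 : ℝ) else 0)) ^ 2 := by
        refine mul_le_mul_of_nonneg_right ?_ (by positivity)
        exact_mod_cast Finset.card_le_card Finset.inter_subset_right
    _ ≤ _ := by
      refine mul_le_mul_of_nonneg_left ?_ (by positivity)
      exact Finset.sum_le_sum_of_subset_of_nonneg Finset.inter_subset_left fun n _ _ => by positivity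

/-- The integers in `(x/2, x]`. -/
noncomputable def upperHalf (x : ℝ) : Finset ℕ := Finset.Ioc ⌊x / 2⌋₊ ⌊x⌋₊

lemma mem_upperHalf {x : ℝ} (hx : 0 ≤ x) {n : ℕ} : n ∈ upperHalf x ↔ x / 2 < n ∧ (n : ℝ) ≤ x := by
  rw [upperHalf, Finset.mem_Ioc, Nat.floor_lt (by positivity), Nat.le_floor_iff hx]

lemma card_upperHalf_filter {x : ℝ} (hx : 0 ≤ x) {b : ℕ} (hb : 0 < b) (ν : ℤ) :
    x / (2 * b) - 2 ≤ ((upperHalf x).filter fun n : ℕ => (b : ℤ) ∣ n - ν).card ∧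
      (((upperHalf x).filter fun n : ℕ => (b : ℤ) ∣ n - ν).card : ℝ) ≤ x / (2 * b) + 2 := by
  have hb' : (0 : ℤ) < b := by exact_mod_cast hb
  have hbr : (1 : ℝ) ≤ b := by exact_mod_cast hb
  obtain ⟨v, hv⟩ : ∃ v : ℕ, (v : ℤ) = ν % b := ⟨(ν % b).toNat, Int.toNat_of_nonneg (Int.emod_nonneg _ hb'.ne')⟩
  have h1 : (upperHalf x).filter (fun n : ℕ => (b : ℤ) ∣ n - ν) =
      (Finset.Ioc ⌊x / 2⌋₊ ⌊x⌋₊).filter (fun n => n ≡ v [MOD b]) := by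
    refine Finset.filter_congr fun n _ => ?_
    rw [← Int.natCast_modEq_iff, hv, Int.ModEq, Int.emod_emod_of_dvd _ dvd_rfl, ← Int.ModEq, Int.modEq_comm,
      Int.modEq_iff_dvd]
  have h2 := Nat.Ioc_filter_modEq_card ⌊x / 2⌋₊ ⌊x⌋₊ hb v
  rw [h1]
  set N := ((Finset.Ioc ⌊x / 2⌋₊ ⌊x⌋₊).filter (fun n => n ≡ v [MOD b])).card with hN
  set q1 : ℚ := ((⌊x⌋₊ : ℚ) - v) / b with hq1
  set q2 : ℚ := ((⌊x / 2⌋₊ : ℚ) - v) / b with hq2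
  have e1 : ((N : ℤ) : ℝ) = max ((⌊q1⌋ : ℝ) - ⌊q2⌋) 0 := by
    rw [h2]; push_cast; rfl
  rw [Int.cast_natCast] at e1
  have f1 : (⌊q1⌋ : ℝ) ≤ (q1 : ℝ) := by exact_mod_cast Int.floor_le q1
  have f2 : (q1 : ℝ) < ⌊q1⌋ + 1 := by exact_mod_cast Int.lt_floor_add_one q1
  have f3 : (⌊q2⌋ : ℝ) ≤ (q2 : ℝ) := by exact_mod_cast Int.floor_le q2
  have f4 : (q2 : ℝ) < ⌊q2⌋ + 1 := by exact_mod_cast Int.lt_floor_add_one q2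
  have f5 : (q1 : ℝ) - q2 = ((⌊x⌋₊ : ℝ) - ⌊x / 2⌋₊) / b := by rw [hq1, hq2]; push_cast; ring
  have g1 := Nat.floor_le hx
  have g2 := Nat.lt_floor_add_one x
  have g3 := Nat.floor_le (by positivity : 0 ≤ x / 2)
  have g4 := Nat.lt_floor_add_one (x / 2)
  have i1 : (1 : ℝ) / b ≤ 1 := by rw [div_le_one (by positivity)]; exact hbr
  have i2 : x / (2 * b) - 1 / b ≤ (q1 : ℝ) - q2 := by
    rw [f5, ← div_div, ← sub_div]; exact div_le_div_of_nonneg_right (by linarith) (by positivity)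
  have i3 : (q1 : ℝ) - q2 ≤ x / (2 * b) + 1 / b := by
    rw [f5, ← div_div, ← add_div]; exact div_le_div_of_nonneg_right (by linarith) (by positivity)
  constructor
  · rw [e1]; exact le_trans (by linarith) (le_max_left _ _)
  · rw [e1]
    refine max_le (by linarith) (by positivity)

lemma sq_sum_le_card_mul {ι : Type*} (I : Finset ι) {x : ℝ} (b : ι → ℕ) (ν : ι → ℤ) (hx : 0 < x) (hb : ∀ i ∈ I, 0 < b i)
    (hbx : ∀ i ∈ I, 8 * (b i : ℝ) ≤ x) (hlcm : ∀ i ∈ I, ∀ j ∈ I, ((Nat.lcm (b i) (b j) : ℕ) : ℝ) ≤ x)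
    {Y : Finset ℕ} (hY : ∀ n ∈ upperHalf x, ∀ i ∈ I, (b i : ℤ) ∣ n - ν i → n ∈ Y) :
    (∑ i ∈ I, x / (4 * b i)) ^ 2 ≤ (Y.card : ℝ) *
      (3 * x * ∑ i ∈ I, ∑ j ∈ I, if ((Nat.gcd (b i) (b j) : ℕ) : ℤ) ∣ ν i - ν j then
        1 / ((Nat.lcm (b i) (b j) : ℕ) : ℝ) else 0) := by
  have h1 : ∑ i ∈ I, x / (4 * b i) ≤ ∑ i ∈ I, (((upperHalf x).filter fun n : ℕ => (b i : ℤ) ∣ n - ν i).card : ℝ) := by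
    refine Finset.sum_le_sum fun i hi => ?_
    have hbi : (0 : ℝ) < b i := by exact_mod_cast hb i hi
    refine le_trans ?_ (card_upperHalf_filter hx.le (hb i hi) (ν i)).1
    have h2 : x / (2 * b i) = 2 * (x / (4 * b i)) := by field_simp; ring
    have h3 : 2 ≤ x / (4 * b i) := by
      rw [le_div_iff₀ (by positivity)]; have := hbx i hi; linarith
    linarith
  have h0 : 0 ≤ ∑ i ∈ I, x / (4 * b i) := Finset.sum_nonneg fun i _ => by positivity
  refine (pow_le_pow_left₀ h0 h1 2).trans ((sq_sum_card_le I (upperHalf x) Y _ hY).trans ?_)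
  refine mul_le_mul_of_nonneg_left ?_ (by positivity)
  rw [Finset.mul_sum]
  refine Finset.sum_le_sum fun i hi => ?_
  rw [Finset.mul_sum]
  refine Finset.sum_le_sum fun j hj => ?_
  split_ifs with hc
  · have hl0 : 0 < Nat.lcm (b i) (b j) := Nat.lcm_pos (hb i hi) (hb j hj)
    have hl : (0 : ℝ) < (Nat.lcm (b i) (b j) : ℕ) := by exact_mod_cast hl0
    have hlx := hlcm i hi j hj
    rcases Finset.eq_empty_or_nonempty ((upperHalf x).filter fun n : ℕ => (b i : ℤ) ∣ n - ν i ∧ (b j : ℤ) ∣ n - ν j) with he | ⟨n₀, hn₀⟩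
    · rw [he]; simp; positivity
    · rw [Finset.mem_filter] at hn₀
      refine le_trans ?_ ((card_upperHalf_filter hx.le hl0 (n₀ : ℤ)).2.trans ?_)
      · refine Nat.cast_le.mpr (Finset.card_le_card fun n hn => ?_)
        rw [Finset.mem_filter] at hn ⊢
        refine ⟨hn.1, ?_⟩
        have h2 := dvd_sub hn.2.1 hn₀.2.1
        have h3 := dvd_sub hn.2.2 hn₀.2.2
        rw [sub_sub_sub_cancel_right] at h2 h3
        have h4 : ((Int.lcm (b i : ℤ) (b j : ℤ) : ℕ) : ℤ) ∣ (n : ℤ) - n₀ := Int.coe_lcm_dvd h2 h3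
        rwa [Int.lcm_natCast_natCast] at h4
      · have h2 : x / (2 * ((Nat.lcm (b i) (b j) : ℕ) : ℝ)) = x / ((Nat.lcm (b i) (b j) : ℕ) : ℝ) / 2 := by field_simp
        have h3 : 1 ≤ x / ((Nat.lcm (b i) (b j) : ℕ) : ℝ) := by rw [le_div_iff₀ hl]; linarith
        rw [mul_one_div, mul_div_assoc]
        linarith
  · rw [mul_zero]
    norm_cast
    rw [Nat.le_zero, Finset.card_eq_zero, Finset.filter_eq_empty_iff]
    rintro n - ⟨h2, h3⟩
    apply hc
    have e1 : ((Nat.gcd (b i) (b j) : ℕ) : ℤ) ∣ n - ν i := (Int.natCast_dvd_natCast.mpr (Nat.gcd_dvd_left _ _)).trans h2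
    have e2 : ((Nat.gcd (b i) (b j) : ℕ) : ℤ) ∣ n - ν j := (Int.natCast_dvd_natCast.mpr (Nat.gcd_dvd_right _ _)).trans h3
    have := dvd_sub e2 e1
    rwa [sub_sub_sub_cancel_left] at this

/-- A family of divisors in the slab `(U, U e^η]`, together with roots, that is well distributed in
residue classes. -/
structure IsSlab (F : Polynomial ℤ) (D₀ : ℕ) (U η C : ℝ) {ι : Type} (𝒜 : Finset ι) (a : ι → ℕ) (n : ι → ℤ) : Prop where
  lt : ∀ i ∈ 𝒜, U < a i
  le : ∀ i ∈ 𝒜, (a i : ℝ) ≤ U * exp η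
  rough : ∀ i ∈ 𝒜, Rough D₀ (a i)
  dvd : ∀ i ∈ 𝒜, (a i : ℤ) ∣ F.eval (n i)
  count : ∀ (h : ℕ) (μ : ℤ), 0 < h → Rough D₀ h → (h : ℤ) ∣ F.eval μ → ∀ ω, 0 < ω → η ≤ ω → ω ≤ 1 →
    (h : ℝ) ≤ 2 * ω ^ F.natDegree * U →
    ((𝒜.filter fun i => h ∣ a i ∧ (h : ℤ) ∣ n i - μ).card : ℝ) ≤ C * (ω * U / h)

lemma dvd_eval_of_dvd_sub (F : Polynomial ℤ) {h m ν : ℤ} (h1 : h ∣ m - ν) (h2 : h ∣ F.eval m) : h ∣ F.eval ν := by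
  have h3 : h ∣ F.eval m - F.eval ν := h1.trans (Polynomial.sub_dvd_eval_sub m ν F)
  have := dvd_sub h2 h3
  rwa [sub_sub_cancel] at this

namespace IsSlab
variable {F : Polynomial ℤ} {D₀ : ℕ} {U η C : ℝ} {ι : Type} {𝒜 : Finset ι} {a : ι → ℕ} {n : ι → ℤ}

lemma card_dvd_le (H : IsSlab F D₀ U η C 𝒜 a n) (hη : 0 < η) (hη1 : η ≤ 1) {h : ℕ} (h0 : 0 < h) (hR : Rough D₀ h)
    (hh : (h : ℝ) ≤ 2 * η ^ F.natDegree * U) :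
    ((𝒜.filter fun i => h ∣ a i).card : ℝ) ≤ C * (η * U / h) * (polyRho F h : ℝ) := by
  have h0' : (0 : ℤ) < h := by exact_mod_cast h0
  rw [polyRho_eq]
  have key : ∀ i, ((n i % h).toNat : ℤ) = n i % h := fun i => Int.toNat_of_nonneg (Int.emod_nonneg _ h0'.ne')
  have key2 : ∀ i, (h : ℤ) ∣ n i - ((n i % h).toNat : ℤ) := fun i => by
    rw [key]; exact Int.dvd_self_sub_emod
  refine card_le_mul_card_fibers (fun i => (n i % h).toNat) ?_ ?_
  · intro i hi
    rw [Finset.mem_filter] at hi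
    rw [Finset.mem_filter, Finset.mem_range]
    constructor
    · have := Int.emod_lt_of_pos (n i) h0'
      rw [← key] at this; exact_mod_cast this
    · exact dvd_eval_of_dvd_sub F (key2 i) ((Int.natCast_dvd_natCast.mpr hi.2).trans (H.dvd i hi.1))
  · intro v hv
    rw [Finset.mem_filter] at hv
    refine le_trans ?_ (H.count h v h0 hR hv.2 η hη le_rfl hη1 hh)
    refine Nat.cast_le.mpr (Finset.card_le_card fun i hi => ?_)
    rw [Finset.mem_filter, Finset.mem_filter] at hi
    rw [Finset.mem_filter]
    refine ⟨hi.1.1, hi.1.2, ?_⟩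
    rw [← hi.2]; exact key2 i


lemma sum_gcd_small_le (H : IsSlab F D₀ U η C 𝒜 a n) (hC : 0 ≤ C) (hU : 0 ≤ U) (hη : 0 < η) (hη1 : η ≤ 1)
    (ha : ∀ i ∈ 𝒜, 0 < a i) :
    ∑ i ∈ 𝒜, ∑ j ∈ 𝒜, (if ((Nat.gcd (a i) (a j) : ℕ) : ℤ) ∣ n j - n i ∧ ((Nat.gcd (a i) (a j) : ℕ) : ℝ) ≤ η ^ F.natDegree * U
      then ((Nat.gcd (a i) (a j) : ℕ) : ℝ) else 0) ≤
      (C * (η * U)) ^ 2 * ∑ h ∈ (Finset.Icc 1 ⌊U⌋₊).filter (Rough D₀), (polyRho F h : ℝ) / h := by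
  set S := (Finset.Icc 1 ⌊U⌋₊).filter (Rough D₀) with hS
  set T := S.filter (fun h : ℕ => (h : ℝ) ≤ η ^ F.natDegree * U) with hT
  have hpow : η ^ F.natDegree * U ≤ U := by
    have := pow_le_one₀ (n := F.natDegree) hη.le hη1
    nlinarith
  have step1 : ∀ i ∈ 𝒜, ∀ j ∈ 𝒜, (if ((Nat.gcd (a i) (a j) : ℕ) : ℤ) ∣ n j - n i ∧ ((Nat.gcd (a i) (a j) : ℕ) : ℝ) ≤ η ^ F.natDegree * U
      then ((Nat.gcd (a i) (a j) : ℕ) : ℝ) else 0) ≤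
      ∑ h ∈ T, (if h ∣ a i then (if h ∣ a j ∧ (h : ℤ) ∣ n j - n i then (h : ℝ) else 0) else 0) := by
    intro i hi j hj
    have nn : ∀ h ∈ T, (0 : ℝ) ≤ (if h ∣ a i then (if h ∣ a j ∧ (h : ℤ) ∣ n j - n i then (h : ℝ) else 0) else 0) := by
      intro h _
      split_ifs <;> positivity
    split_ifs with hc
    · have hg0 : 0 < Nat.gcd (a i) (a j) := Nat.gcd_pos_of_pos_left _ (ha i hi)
      have hmem : Nat.gcd (a i) (a j) ∈ T := by
        rw [hT, hS, Finset.mem_filter, Finset.mem_filter, Finset.mem_Icc]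
        exact ⟨⟨⟨hg0, Nat.le_floor (hc.2.trans hpow)⟩, (H.rough i hi).of_dvd (Nat.gcd_dvd_left _ _)⟩, hc.2⟩
      refine le_trans (le_of_eq ?_) (Finset.single_le_sum nn hmem)
      rw [if_pos (Nat.gcd_dvd_left _ _), if_pos ⟨Nat.gcd_dvd_right _ _, hc.1⟩]
    · exact Finset.sum_nonneg nn
  have step2 : ∀ h ∈ T, ∀ i ∈ 𝒜, ∑ j ∈ 𝒜, (if h ∣ a i then (if h ∣ a j ∧ (h : ℤ) ∣ n j - n i then (h : ℝ) else 0) else 0) ≤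
      (if h ∣ a i then C * (η * U) else 0) := by
    intro h hh i hi
    rw [hT, hS, Finset.mem_filter, Finset.mem_filter, Finset.mem_Icc] at hh
    have h0 : 0 < h := hh.1.1.1
    have h0r : (0 : ℝ) < h := by exact_mod_cast h0
    split_ifs with hd
    · have e : ∑ j ∈ 𝒜, (if h ∣ a j ∧ (h : ℤ) ∣ n j - n i then (h : ℝ) else 0) =
          ((𝒜.filter fun j => h ∣ a j ∧ (h : ℤ) ∣ n j - n i).card : ℝ) * h := by
        rw [← Finset.sum_filter, Finset.sum_const, nsmul_eq_mul]
      rw [e]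
      have := H.count h (n i) h0 hh.1.2 ((Int.natCast_dvd_natCast.mpr hd).trans (H.dvd i hi)) η hη le_rfl hη1
        (hh.2.trans (by nlinarith [pow_pos hη F.natDegree, mul_nonneg (pow_pos hη F.natDegree).le hU]))
      calc _ ≤ C * (η * U / h) * h := mul_le_mul_of_nonneg_right this h0r.le
        _ = _ := by field_simp
    · simp
  calc _ ≤ ∑ i ∈ 𝒜, ∑ j ∈ 𝒜, ∑ h ∈ T, (if h ∣ a i then (if h ∣ a j ∧ (h : ℤ) ∣ n j - n i then (h : ℝ) else 0) else 0) :=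
        Finset.sum_le_sum fun i hi => Finset.sum_le_sum fun j hj => step1 i hi j hj
    _ = ∑ h ∈ T, ∑ i ∈ 𝒜, ∑ j ∈ 𝒜, (if h ∣ a i then (if h ∣ a j ∧ (h : ℤ) ∣ n j - n i then (h : ℝ) else 0) else 0) := by
        rw [Finset.sum_congr rfl fun i _ => Finset.sum_comm, Finset.sum_comm]
    _ ≤ ∑ h ∈ T, (C * (η * U)) ^ 2 * ((polyRho F h : ℝ) / h) := by
        refine Finset.sum_le_sum fun h hh => ?_
        refine (Finset.sum_le_sum fun i hi => step2 h hh i hi).trans ?_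
        rw [hT, hS, Finset.mem_filter, Finset.mem_filter, Finset.mem_Icc] at hh
        rw [← Finset.sum_filter, Finset.sum_const, nsmul_eq_mul]
        have := H.card_dvd_le hη hη1 hh.1.1.1 hh.1.2
          (hh.2.trans (by nlinarith [pow_pos hη F.natDegree, mul_nonneg (pow_pos hη F.natDegree).le hU]))
        calc _ ≤ C * (η * U / h) * (polyRho F h : ℝ) * (C * (η * U)) :=
              mul_le_mul_of_nonneg_right this (by positivity)
          _ = _ := by ring
    _ ≤ _ := by
        rw [← Finset.mul_sum]
        refine mul_le_mul_of_nonneg_left ?_ (by positivity)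
        exact Finset.sum_le_sum_of_subset_of_nonneg (Finset.filter_subset _ _) fun h _ _ => by positivity


lemma card_ratio_le (H : IsSlab F D₀ U η C 𝒜 a n) (G : GoodPoly F D₀) (hU : 1 ≤ U) (hC : 0 ≤ C) (hη0 : 0 < η) (hη1 : η ≤ 1 / 2)
    {h l : ℕ} (h0 : 0 < h) (l0 : 0 < l) (hlR : Rough D₀ l) (ν : ℤ) :
    ((𝒜.filter fun j => a j = h * l ∧ (h : ℤ) ∣ n j - ν).card : ℝ) ≤ C * (l : ℝ) ^ (1 / (8 * F.natDegree) : ℝ) := by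
  rcases Finset.eq_empty_or_nonempty (𝒜.filter fun j => a j = h * l ∧ (h : ℤ) ∣ n j - ν) with he | ⟨j₀, hj₀⟩
  · rw [he]; simp; positivity
  rw [Finset.mem_filter] at hj₀
  have hm0 : 0 < h * l := Nat.mul_pos h0 l0
  have hm0' : (0 : ℤ) < ((h * l : ℕ) : ℤ) := by exact_mod_cast hm0
  have hR : Rough D₀ (h * l) := hj₀.2.1 ▸ H.rough j₀ hj₀.1
  have hU1 : U < ((h * l : ℕ) : ℝ) := hj₀.2.1 ▸ H.lt j₀ hj₀.1
  have hU2 : ((h * l : ℕ) : ℝ) ≤ 2 * U := by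
    have := H.le j₀ hj₀.1
    rw [hj₀.2.1] at this
    have h2 : exp η ≤ 2 := (exp_le_exp.mpr hη1).trans exp_half_le_two
    nlinarith
  refine le_trans ?_ (mul_le_mul_of_nonneg_left (G.card_fiber_le l h ν h0 l0 hlR) hC)
  have key : ∀ i, ((n i % ((h * l : ℕ) : ℤ)).toNat : ℤ) = n i % ((h * l : ℕ) : ℤ) := fun i => Int.toNat_of_nonneg (Int.emod_nonneg _ hm0'.ne')
  have key2 : ∀ i, ((h * l : ℕ) : ℤ) ∣ n i - ((n i % ((h * l : ℕ) : ℤ)).toNat : ℤ) := fun i => by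
    rw [key]; exact Int.dvd_self_sub_emod
  have hdl : (h : ℤ) ∣ ((h * l : ℕ) : ℤ) := by exact_mod_cast Dvd.intro l rfl
  refine card_le_mul_card_fibers (fun i => (n i % ((h * l : ℕ) : ℤ)).toNat) ?_ ?_
  · intro i hi
    rw [Finset.mem_filter] at hi
    rw [Finset.mem_filter, Finset.mem_range]
    refine ⟨?_, ?_, ?_⟩
    · have := Int.emod_lt_of_pos (n i) hm0'
      rw [← key] at this; exact_mod_cast this
    · exact dvd_eval_of_dvd_sub F (key2 i) (hi.2.1 ▸ H.dvd i hi.1)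
    · have := dvd_sub hi.2.2 (hdl.trans (key2 i))
      rwa [sub_sub_sub_cancel_left] at this
  · intro v hv
    rw [Finset.mem_filter] at hv
    have hc := H.count (h * l) v hm0 hR hv.2.1 1 one_pos (by linarith) le_rfl (by simpa using hU2)
    have : C * (1 * U / ((h * l : ℕ) : ℝ)) ≤ C := by
      have : (1 * U / ((h * l : ℕ) : ℝ)) ≤ 1 := by
        rw [div_le_one (by linarith)]; linarith
      nlinarith
    refine le_trans ?_ (hc.trans this)
    refine Nat.cast_le.mpr (Finset.card_le_card fun i hi => ?_)
    rw [Finset.mem_filter, Finset.mem_filter] at hi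
    rw [Finset.mem_filter]
    refine ⟨hi.1.1, by rw [hi.1.2.1], ?_⟩
    rw [← hi.2]; exact key2 i

end IsSlab

lemma card_near_le {η : ℝ} (hη0 : 0 < η) (hη1 : η ≤ 1 / 2) {g k : ℕ} (hg : 1 ≤ g) (hk : 0 < k) (hkη : (k : ℝ) ≤ 2 / η ^ g) :
    ((Finset.Icc ⌈(k : ℝ) * exp (-η)⌉₊ ⌊(k : ℝ) * exp η⌋₊).card : ℝ) ≤ 9 * (k : ℝ) ^ (1 - 1 / g : ℝ) := by
  have hk1 : (1 : ℝ) ≤ k := by exact_mod_cast hk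
  have hg1 : (1 : ℝ) ≤ g := by exact_mod_cast hg
  have hginv : (1 : ℝ) / g ≤ 1 := by rw [div_le_one (by positivity)]; exact hg1
  have h1 : (1 : ℝ) ≤ (k : ℝ) ^ (1 - 1 / g : ℝ) := one_le_rpow hk1 (by linarith)
  have h2 : η * k ≤ 2 * (k : ℝ) ^ (1 - 1 / g : ℝ) := by
    have h3 : η ^ g ≤ 2 / k := by
      rw [le_div_iff₀ (by positivity)] at hkη ⊢; linarith
    have h4 : η ≤ (2 / k : ℝ) ^ (1 / g : ℝ) := by
      have := rpow_le_rpow (by positivity) h3 (by positivity : (0 : ℝ) ≤ 1 / g)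
      rwa [← rpow_natCast, ← rpow_mul hη0.le, mul_one_div_cancel (by positivity), rpow_one] at this
    rw [div_rpow (by norm_num) (by positivity)] at h4
    have h5 : (2 : ℝ) ^ (1 / g : ℝ) ≤ 2 := by
      calc (2 : ℝ) ^ (1 / g : ℝ) ≤ 2 ^ (1 : ℝ) := rpow_le_rpow_of_exponent_le (by norm_num) hginv
        _ = 2 := rpow_one _
    rw [rpow_sub (by positivity), rpow_one]
    have h6 : 0 < (k : ℝ) ^ (1 / g : ℝ) := by positivity
    rw [le_div_iff₀ h6] at h4
    rw [mul_div_assoc', le_div_iff₀ h6]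
    nlinarith
  have e1 : exp η ≤ 1 + 2 * η := by
    have := Real.exp_bound_div_one_sub_of_interval hη0.le (by linarith)
    refine this.trans ?_
    rw [div_le_iff₀ (by linarith)]; nlinarith
  have e2 : 1 - η ≤ exp (-η) := by have := add_one_le_exp (-η); linarith
  have h7 : ((Finset.Icc ⌈(k : ℝ) * exp (-η)⌉₊ ⌊(k : ℝ) * exp η⌋₊).card : ℝ) ≤ 1 + 3 * (η * k) := by
    rw [Nat.card_Icc]
    have f1 := Nat.floor_le (by positivity : 0 ≤ (k : ℝ) * exp η)
    have f2 := Nat.le_ceil ((k : ℝ) * exp (-η))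
    rcases le_total ⌈(k : ℝ) * exp (-η)⌉₊ (⌊(k : ℝ) * exp η⌋₊ + 1) with hle | hle
    · rw [Nat.cast_sub hle]; push_cast
      nlinarith
    · rw [Nat.sub_eq_zero_of_le hle]; push_cast; positivity
  linarith

namespace IsSlab
variable {F : Polynomial ℤ} {D₀ : ℕ} {U η C : ℝ} {ι : Type} {𝒜 : Finset ι} {a : ι → ℕ} {n : ι → ℤ}

lemma sum_gcd_large_le (H : IsSlab F D₀ U η C 𝒜 a n) (G : GoodPoly F D₀) (hC : 0 ≤ C) (hU : 1 ≤ U) (hη : 0 < η) (hη1 : η ≤ 1 / 2)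
    (hηU : 1 ≤ η ^ (2 * F.natDegree) * U) :
    ∑ i ∈ 𝒜, ∑ j ∈ 𝒜, (if ((Nat.gcd (a i) (a j) : ℕ) : ℤ) ∣ n j - n i ∧ η ^ F.natDegree * U < ((Nat.gcd (a i) (a j) : ℕ) : ℝ)
      then ((Nat.gcd (a i) (a j) : ℕ) : ℝ) else 0) ≤
      36 * C ^ 2 * (η * U ^ 2) * ∑' k : ℕ, (k : ℝ) ^ (-(1 + 6 * (1 / (8 * F.natDegree))) : ℝ) := by
  have hg := G.two_le
  have hgr : (2 : ℝ) ≤ F.natDegree := by exact_mod_cast hg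
  set e : ℝ := 1 / (8 * F.natDegree) with he
  have he0 : 0 < e := by positivity
  have he1 : e ≤ 1 := by rw [he, div_le_one (by positivity)]; linarith
  have h8e : (1 : ℝ) / F.natDegree = 8 * e := by rw [he]; field_simp
  have hpg : 0 < η ^ F.natDegree := pow_pos hη _
  have ha0 : ∀ i ∈ 𝒜, 0 < a i := fun i hi => by
    have := H.lt i hi
    exact_mod_cast (by linarith : (0 : ℝ) < a i)
  have hexp2 : exp η ≤ 2 := (exp_le_exp.mpr hη1).trans exp_half_le_two
  have ha2 : ∀ i ∈ 𝒜, (a i : ℝ) ≤ 2 * U := fun i hi => (H.le i hi).trans (by nlinarith)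
  set K := (Finset.Icc 1 ⌊2 / η ^ F.natDegree⌋₊).filter (Rough D₀) with hK
  set L : ℕ → Finset ℕ := fun k => (Finset.Icc ⌈(k : ℝ) * exp (-η)⌉₊ ⌊(k : ℝ) * exp η⌋₊).filter (fun l => 0 < l ∧ Rough D₀ l) with hL
  have memK : ∀ k, k ∈ K → 0 < k ∧ (k : ℝ) ≤ 2 / η ^ F.natDegree ∧ Rough D₀ k := by
    intro k hk
    rw [hK, Finset.mem_filter, Finset.mem_Icc, Nat.le_floor_iff (by positivity)] at hk
    exact ⟨hk.1.1, hk.1.2, hk.2⟩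
  set f : ι → ι → ℕ → ℕ → ℝ := fun i j k l =>
    if k ∣ a i then (if a j = (a i / k) * l ∧ ((a i / k : ℕ) : ℤ) ∣ n j - n i then ((a i / k : ℕ) : ℝ) else 0) else 0 with hf
  have fnn : ∀ i j k l, 0 ≤ f i j k l := fun i j k l => by
    simp only [hf]; split_ifs <;> positivity
  have step1 : ∀ i ∈ 𝒜, ∀ j ∈ 𝒜, (if ((Nat.gcd (a i) (a j) : ℕ) : ℤ) ∣ n j - n i ∧ η ^ F.natDegree * U < ((Nat.gcd (a i) (a j) : ℕ) : ℝ)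
      then ((Nat.gcd (a i) (a j) : ℕ) : ℝ) else 0) ≤ ∑ k ∈ K, ∑ l ∈ L k, f i j k l := by
    intro i hi j hj
    split_ifs with hc
    · obtain ⟨k, hk⟩ := Nat.gcd_dvd_left (a i) (a j)
      obtain ⟨l, hl⟩ := Nat.gcd_dvd_right (a i) (a j)
      set h := Nat.gcd (a i) (a j) with hh
      have h0 : 0 < h := Nat.gcd_pos_of_pos_left _ (ha0 i hi)
      have h0r : (0 : ℝ) < h := by exact_mod_cast h0
      have k0 : 0 < k := Nat.pos_of_ne_zero fun h => by have := ha0 i hi; rw [hk, h] at this; simp at this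
      have l0 : 0 < l := Nat.pos_of_ne_zero fun h => by have := ha0 j hj; rw [hl, h] at this; simp at this
      have hkr : (a i : ℝ) = h * k := by exact_mod_cast hk
      have hlr : (a j : ℝ) = h * l := by exact_mod_cast hl
      have hdiv : a i / k = h := by
        conv_lhs => rw [hk]
        exact Nat.mul_div_cancel _ k0
      have hkK : k ∈ K := by
        rw [hK, Finset.mem_filter, Finset.mem_Icc, Nat.le_floor_iff (by positivity)]
        refine ⟨⟨k0, ?_⟩, (H.rough i hi).of_dvd ⟨h, by rw [mul_comm]; exact hk⟩⟩
        rw [le_div_iff₀ hpg]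
        have h1 := ha2 i hi
        rw [hkr] at h1
        have k0r : (0 : ℝ) < k := by exact_mod_cast k0
        have h2 : η ^ F.natDegree * U * k ≤ 2 * U := le_trans (mul_le_mul_of_nonneg_right hc.2.le k0r.le) h1
        have h3 : (k * η ^ F.natDegree) * U ≤ 2 * U := by linarith
        exact le_of_mul_le_mul_right h3 (by linarith)
      have hlL : l ∈ L k := by
        simp only [hL]
        rw [Finset.mem_filter, Finset.mem_Icc, Nat.le_floor_iff (by positivity), Nat.ceil_le]
        have hU0 : 0 < U := by linarith
        refine ⟨⟨?_, ?_⟩, l0, (H.rough j hj).of_dvd ⟨h, by rw [mul_comm]; exact hl⟩⟩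
        · have h1 := H.le i hi
          have h2 := H.lt j hj
          rw [hkr] at h1; rw [hlr] at h2
          rw [exp_neg, ← div_eq_mul_inv, div_le_iff₀ (exp_pos _)]
          have h3 : (h : ℝ) * k ≤ h * (l * exp η) := by nlinarith [exp_pos η]
          exact le_of_mul_le_mul_left h3 h0r
        · have h1 := H.le j hj
          have h2 := H.lt i hi
          rw [hlr] at h1; rw [hkr] at h2
          have h3 : (h : ℝ) * l ≤ h * (k * exp η) := by nlinarith [exp_pos η]
          exact le_of_mul_le_mul_left h3 h0r
      have h5 : f i j k l = h := by
        simp only [hf]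
        rw [if_pos ⟨h, by rw [mul_comm]; exact hk⟩, hdiv, if_pos ⟨hl, hc.1⟩]
      rw [← h5]
      exact (Finset.single_le_sum (fun l _ => fnn i j k l) hlL).trans
        (Finset.single_le_sum (f := fun k => ∑ l ∈ L k, f i j k l) (fun k _ => Finset.sum_nonneg fun l _ => fnn i j k l) hkK)
    · exact Finset.sum_nonneg fun k _ => Finset.sum_nonneg fun l _ => fnn i j k l
  have step2 : ∀ k ∈ K, ∀ l ∈ L k, ∀ i ∈ 𝒜, ∑ j ∈ 𝒜, f i j k l ≤ if k ∣ a i then (2 * U / k) * (C * (2 * (k : ℝ) ^ e)) else 0 := by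
    intro k hk l hl i hi
    obtain ⟨k0, hk1, hkR⟩ := memK k hk
    have k0r : (0 : ℝ) < k := by exact_mod_cast k0
    simp only [hL] at hl
    rw [Finset.mem_filter, Finset.mem_Icc, Nat.le_floor_iff (by positivity)] at hl
    simp only [hf]
    split_ifs with hd
    · have hh0 : 0 < a i / k := Nat.div_pos (Nat.le_of_dvd (ha0 i hi) hd) k0
      rw [← Finset.sum_filter, Finset.sum_const, nsmul_eq_mul, mul_comm]
      refine mul_le_mul ?_ ?_ (by positivity) (by positivity)
      · rw [Nat.cast_div hd k0r.ne']
        exact div_le_div_of_nonneg_right (ha2 i hi) k0r.le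
      · refine (H.card_ratio_le G hU hC hη hη1 hh0 hl.2.1 hl.2.2 (n i)).trans ?_
        refine mul_le_mul_of_nonneg_left ?_ hC
        rw [← he]
        calc (l : ℝ) ^ e ≤ (2 * k : ℝ) ^ e := rpow_le_rpow (by positivity) (hl.1.2.trans (by nlinarith)) he0.le
          _ = 2 ^ e * (k : ℝ) ^ e := mul_rpow (by norm_num) k0r.le
          _ ≤ 2 ^ (1 : ℝ) * (k : ℝ) ^ e := by
            refine mul_le_mul_of_nonneg_right ?_ (by positivity)
            exact rpow_le_rpow_of_exponent_le (by norm_num) he1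
          _ = _ := by rw [rpow_one]
    · simp
  have step3 : ∀ k ∈ K, ∀ l ∈ L k, ∑ i ∈ 𝒜, ∑ j ∈ 𝒜, f i j k l ≤
      (C * (η * U / k) * (k : ℝ) ^ e) * ((2 * U / k) * (C * (2 * (k : ℝ) ^ e))) := by
    intro k hk l hl
    refine (Finset.sum_le_sum fun i hi => step2 k hk l hl i hi).trans ?_
    obtain ⟨k0, hk1, hkR⟩ := memK k hk
    rw [← Finset.sum_filter, Finset.sum_const, nsmul_eq_mul]
    refine mul_le_mul_of_nonneg_right ?_ (by positivity)
    refine (H.card_dvd_le hη (by linarith) k0 hkR ?_).trans ?_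
    · refine hk1.trans ?_
      rw [div_le_iff₀ hpg]
      have : η ^ (2 * F.natDegree) = η ^ F.natDegree * η ^ F.natDegree := by rw [← pow_add]; ring_nf
      rw [this] at hηU
      linarith
    · exact mul_le_mul_of_nonneg_left (G.rho_le_rpow k0 hkR) (by positivity)
  calc _ ≤ ∑ i ∈ 𝒜, ∑ j ∈ 𝒜, ∑ k ∈ K, ∑ l ∈ L k, f i j k l :=
        Finset.sum_le_sum fun i hi => Finset.sum_le_sum fun j hj => step1 i hi j hj
    _ = ∑ k ∈ K, ∑ l ∈ L k, ∑ i ∈ 𝒜, ∑ j ∈ 𝒜, f i j k l := by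
        rw [Finset.sum_congr rfl fun i _ => Finset.sum_comm, Finset.sum_comm]
        refine Finset.sum_congr rfl fun k _ => ?_
        rw [Finset.sum_congr rfl fun i _ => Finset.sum_comm, Finset.sum_comm]
    _ ≤ ∑ k ∈ K, 36 * C ^ 2 * (η * U ^ 2) * (k : ℝ) ^ (-(1 + 6 * e)) := by
        refine Finset.sum_le_sum fun k hk => ?_
        obtain ⟨k0, hk1, hkR⟩ := memK k hk
        have k0r : (0 : ℝ) < k := by exact_mod_cast k0
        refine (Finset.sum_le_sum fun l hl => step3 k hk l hl).trans ?_
        rw [Finset.sum_const, nsmul_eq_mul]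
        have hc : ((L k).card : ℝ) ≤ 9 * (k : ℝ) ^ (1 - 8 * e) := by
          rw [← h8e]
          refine le_trans ?_ (card_near_le hη hη1 (by omega) k0 hk1)
          exact Nat.cast_le.mpr (Finset.card_le_card (Finset.filter_subset _ _))
        refine (mul_le_mul_of_nonneg_right hc (by positivity)).trans (le_of_eq ?_)
        have e1 : (k : ℝ) ^ (1 - 8 * e) * ((k : ℝ) ^ e * (k : ℝ) ^ e) = (k : ℝ) ^ (-(1 + 6 * e)) * k * k := by
          rw [← rpow_add k0r, ← rpow_add k0r]
          conv_rhs => rw [← rpow_one (k : ℝ)]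
          simp only [← rpow_mul k0r.le]
          rw [← rpow_add k0r, ← rpow_add k0r]
          congr 1; ring
        generalize (k : ℝ) ^ (-(1 + 6 * e)) = w at e1 ⊢
        field_simp
        linear_combination 36 * C ^ 2 * e1
    _ ≤ _ := by
        rw [← Finset.mul_sum]
        refine mul_le_mul_of_nonneg_left ?_ (by positivity)
        refine Summable.sum_le_tsum _ (fun k _ => by positivity) ?_
        rw [Real.summable_nat_rpow]; linarith

end IsSlab

lemma GoodPoly.exists_sum_gcd_le {F : Polynomial ℤ} {D₀ : ℕ} (G : GoodPoly F D₀) {C : ℝ} (hC : 0 ≤ C) :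
    ∃ C' > 0, ∀ U η : ℝ, 2 ≤ U → U ^ (-(1 / (10 * F.natDegree)) : ℝ) ≤ η → η ≤ 1 / 2 →
      ∀ (ι : Type) (𝒜 : Finset ι) (a : ι → ℕ) (n : ι → ℤ), IsSlab F D₀ U η C 𝒜 a n →
      ∑ i ∈ 𝒜, ∑ j ∈ 𝒜, (if ((Nat.gcd (a i) (a j) : ℕ) : ℤ) ∣ n j - n i then ((Nat.gcd (a i) (a j) : ℕ) : ℝ) else 0) ≤
        C' * (η * U ^ 2 * (1 + η * log U)) := by
  obtain ⟨C₂, hC₂, h₂⟩ := G.sum_rough_le_log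
  have hgr : (2 : ℝ) ≤ F.natDegree := by exact_mod_cast G.two_le
  set Z := ∑' k : ℕ, (k : ℝ) ^ (-(1 + 6 * (1 / (8 * F.natDegree))) : ℝ) with hZ
  have hZ0 : 0 ≤ Z := tsum_nonneg fun k => by positivity
  refine ⟨C ^ 2 * C₂ + 36 * C ^ 2 * Z + 1, by positivity, ?_⟩
  intro U η hU hη hη1 ι 𝒜 a n H
  have hU0 : 0 < U := by linarith
  have hη0 : 0 < η := lt_of_lt_of_le (by positivity) hη
  have hηU : 1 ≤ η ^ (2 * F.natDegree) * U := by
    have h1 : (U ^ (-(1 / (10 * F.natDegree)) : ℝ)) ^ (2 * F.natDegree) ≤ η ^ (2 * F.natDegree) :=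
      pow_le_pow_left₀ (by positivity) hη _
    rw [← rpow_natCast, ← rpow_mul hU0.le] at h1
    have h2 : (-(1 / (10 * F.natDegree)) : ℝ) * ((2 * F.natDegree : ℕ) : ℝ) = -(1 / 5) := by
      push_cast; field_simp; norm_num
    rw [h2] at h1
    have h3 : U ^ (-1 : ℝ) ≤ U ^ (-(1 / 5) : ℝ) := rpow_le_rpow_of_exponent_le (by linarith) (by norm_num)
    rw [rpow_neg_one] at h3
    have := mul_le_mul_of_nonneg_right (h3.trans h1) hU0.le
    rwa [inv_mul_cancel₀ hU0.ne'] at this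
  have ha0 : ∀ i ∈ 𝒜, 0 < a i := fun i hi => by
    have := H.lt i hi
    exact_mod_cast (by linarith : (0 : ℝ) < a i)
  have s1 := H.sum_gcd_small_le hC hU0.le hη0 (by linarith) ha0
  have s2 := H.sum_gcd_large_le G hC (by linarith) hη0 hη1 hηU
  have hf : 2 ≤ ⌊U⌋₊ := Nat.le_floor (by exact_mod_cast hU)
  have s3 := h₂ ⌊U⌋₊ hf
  have s4 : log (⌊U⌋₊ : ℝ) ≤ log U :=
    log_le_log (by exact_mod_cast (by omega : 0 < ⌊U⌋₊)) (Nat.floor_le hU0.le)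
  have hlog : 0 ≤ log U := log_nonneg (by linarith)
  have s5 : (C * (η * U)) ^ 2 * ∑ h ∈ (Finset.Icc 1 ⌊U⌋₊).filter (Rough D₀), (polyRho F h : ℝ) / h ≤
      (C * (η * U)) ^ 2 * (C₂ * log U) :=
    mul_le_mul_of_nonneg_left (s3.trans (mul_le_mul_of_nonneg_left s4 hC₂.le)) (by positivity)
  calc _ = ∑ i ∈ 𝒜, ∑ j ∈ 𝒜, (if ((Nat.gcd (a i) (a j) : ℕ) : ℤ) ∣ n j - n i ∧ ((Nat.gcd (a i) (a j) : ℕ) : ℝ) ≤ η ^ F.natDegree * U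
        then ((Nat.gcd (a i) (a j) : ℕ) : ℝ) else 0) +
      ∑ i ∈ 𝒜, ∑ j ∈ 𝒜, (if ((Nat.gcd (a i) (a j) : ℕ) : ℤ) ∣ n j - n i ∧ η ^ F.natDegree * U < ((Nat.gcd (a i) (a j) : ℕ) : ℝ)
        then ((Nat.gcd (a i) (a j) : ℕ) : ℝ) else 0) := by
        rw [← Finset.sum_add_distrib]
        refine Finset.sum_congr rfl fun i _ => ?_
        rw [← Finset.sum_add_distrib]
        refine Finset.sum_congr rfl fun j _ => ?_
        rcases le_or_gt ((Nat.gcd (a i) (a j) : ℕ) : ℝ) (η ^ F.natDegree * U) with h | h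
        · simp [h, not_lt.mpr h]
        · simp [h, not_le.mpr h]
    _ ≤ (C * (η * U)) ^ 2 * (C₂ * log U) + 36 * C ^ 2 * (η * U ^ 2) * Z := add_le_add (s1.trans s5) s2
    _ ≤ _ := by
        have e1 : 0 ≤ 36 * C ^ 2 * Z * (η * U ^ 2) * (η * log U) := by positivity
        have e2 : 0 ≤ C ^ 2 * C₂ * (η * U ^ 2) := by positivity
        have e3 : 0 ≤ (η * U ^ 2 * (1 + η * log U)) := by positivity
        nlinarith

lemma exists_int_crt {a b : ℤ} (h : IsCoprime a b) (n ν : ℤ) : ∃ N, a ∣ N - n ∧ b ∣ N - ν := by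
  obtain ⟨s, t, h⟩ := h
  refine ⟨ν * (s * a) + n * (t * b), ⟨s * (ν - n), ?_⟩, ⟨t * (n - ν), ?_⟩⟩
  · linear_combination n * h
  · linear_combination ν * h

/-- Lower bound for the number of `n ∈ (x/2, x]` in a residue class modulo `b` such that `F(n)` has a
divisor in `(u, u e^η]`. -/
lemma GoodPoly.exists_card_slab_ge {F : Polynomial ℤ} {D₀ : ℕ} (G : GoodPoly F D₀) (k : ℕ) :
    ∃ c > 0, ∃ u₀ : ℝ, 2 ≤ u₀ ∧ ∃ P : ℕ, ∀ u ≥ u₀, ∀ η, u ^ (-(1 / (10 * F.natDegree)) : ℝ) ≤ η → η ≤ 1 / 2 →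
      ∀ b : ℕ, 0 < b → b.primeFactors.card ≤ k → (∀ p ∈ b.primeFactors, P ≤ p) → ∀ ν : ℤ, ∀ x : ℝ, 16 * b * u ^ 2 ≤ x →
      ∀ Y : Finset ℕ, (∀ n ∈ upperHalf x, (b : ℤ) ∣ n - ν →
        (∃ a : ℕ, u < a ∧ (a : ℝ) ≤ u * exp η ∧ a.Coprime b ∧ (a : ℤ) ∣ F.eval (n : ℤ)) → n ∈ Y) →
      c * (η / (1 + η * log u)) * (x / b) ≤ Y.card := by
  obtain ⟨c, C, hc, hC, hs⟩ := G.slab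
  obtain ⟨C', hC', hS⟩ := G.exists_sum_gcd_le hC.le
  obtain ⟨U₀, P, hU₀, hs⟩ := hs k
  refine ⟨c ^ 2 / (192 * C'), by positivity, max U₀ 2, le_max_right _ _, P, ?_⟩
  intro u hu η hηu hη1 b hb hbk hbP ν x hx Y hY
  have hu2 : 2 ≤ u := (le_max_right _ _).trans hu
  have hu0 : 0 < u := by linarith
  have hη0 : 0 < η := lt_of_lt_of_le (by positivity) hηu
  have hexp2 : exp η ≤ 2 := (exp_le_exp.mpr hη1).trans exp_half_le_two
  have hbr : (1 : ℝ) ≤ b := by exact_mod_cast hb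
  obtain ⟨ι, 𝒜, a, n, hA, hcard, hcount⟩ := hs u ((le_max_left _ _).trans hu) η hηu hη1 b.primeFactors hbk
    fun p hp => ⟨Nat.prime_of_mem_primeFactors hp, hbP p hp⟩
  have H : IsSlab F D₀ u η C 𝒜 a n := ⟨fun i hi => (hA i hi).1, fun i hi => (hA i hi).2.1, fun i hi => (hA i hi).2.2.1,
    fun i hi => (hA i hi).2.2.2.2, hcount⟩
  have hT := hS u η hu2 hηu hη1 ι 𝒜 a n H
  have ha0r : ∀ i ∈ 𝒜, (0 : ℝ) < a i := fun i hi => by have := H.lt i hi; linarith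
  have ha0 : ∀ i ∈ 𝒜, 0 < a i := fun i hi => by exact_mod_cast ha0r i hi
  have ha2 : ∀ i ∈ 𝒜, (a i : ℝ) ≤ 2 * u := fun i hi => (H.le i hi).trans (by nlinarith)
  have hcop : ∀ i ∈ 𝒜, (a i).Coprime b := by
    intro i hi
    refine Nat.Coprime.symm (Nat.coprime_of_dvd fun p hp hpb hpa => ?_)
    exact (hA i hi).2.2.2.1 p (Nat.mem_primeFactors.mpr ⟨hp, hpb, hb.ne'⟩) hpa
  have hN : ∀ i, ∃ N : ℤ, i ∈ 𝒜 → (a i : ℤ) ∣ N - n i ∧ (b : ℤ) ∣ N - ν := by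
    intro i
    by_cases hi : i ∈ 𝒜
    · obtain ⟨N, h⟩ := exists_int_crt (Nat.isCoprime_iff_coprime.mpr (hcop i hi)) (n i) ν
      exact ⟨N, fun _ => h⟩
    · exact ⟨0, fun h => absurd h hi⟩
  choose N hN using hN
  have hx0 : 0 < x := lt_of_lt_of_le (by positivity) hx
  have main := sq_sum_le_card_mul 𝒜 (fun i => b * a i) N hx0 (fun i hi => Nat.mul_pos hb (ha0 i hi)) ?_ ?_ (Y := Y) ?_
  rotate_left
  · intro i hi
    push_cast
    have := ha2 i hi
    calc 8 * ((b : ℝ) * a i) ≤ 8 * (b * (2 * u)) := by gcongr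
      _ = 16 * b * u := by ring
      _ ≤ 16 * b * u ^ 2 := mul_le_mul_of_nonneg_left (by nlinarith) (by positivity)
      _ ≤ x := hx
  · intro i hi j hj
    rw [Nat.lcm_mul_left]
    push_cast
    have h1 : ((Nat.lcm (a i) (a j) : ℕ) : ℝ) ≤ (a i) * (a j) := by
      exact_mod_cast Nat.le_of_dvd (Nat.mul_pos (ha0 i hi) (ha0 j hj)) (Nat.lcm_dvd_mul _ _)
    calc (b : ℝ) * (Nat.lcm (a i) (a j) : ℕ) ≤ b * ((2 * u) * (2 * u)) := by
          refine mul_le_mul_of_nonneg_left (h1.trans ?_) (by positivity)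
          exact mul_le_mul (ha2 i hi) (ha2 j hj) (by positivity) (by positivity)
      _ ≤ 16 * b * u ^ 2 := by nlinarith [mul_pos (by linarith : (0 : ℝ) < b) (pow_pos hu0 2)]
      _ ≤ x := hx
  · intro m hm i hi hd
    push_cast at hd
    have d1 : (b : ℤ) ∣ m - ν := by
      have := dvd_add ((Dvd.intro _ rfl : (b : ℤ) ∣ b * a i).trans hd) (hN i hi).2
      rwa [sub_add_sub_cancel] at this
    have d2 : (a i : ℤ) ∣ m - n i := by
      have := dvd_add ((Dvd.intro_left _ rfl : (a i : ℤ) ∣ b * a i).trans hd) (hN i hi).1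
      rwa [sub_add_sub_cancel] at this
    refine hY m hm d1 ⟨a i, H.lt i hi, H.le i hi, hcop i hi, ?_⟩
    refine dvd_eval_of_dvd_sub F ?_ (H.dvd i hi)
    rwa [dvd_sub_comm]
  have h1 : c * η * x / (8 * b) ≤ ∑ i ∈ 𝒜, x / (4 * ((b * a i : ℕ) : ℝ)) := by
    calc c * η * x / (8 * b) = c * η * u * (x / (8 * b * u)) := by field_simp
      _ ≤ 𝒜.card * (x / (8 * b * u)) := mul_le_mul_of_nonneg_right hcard (by positivity)
      _ = ∑ i ∈ 𝒜, x / (8 * b * u) := by rw [Finset.sum_const, nsmul_eq_mul]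
      _ ≤ _ := by
        refine Finset.sum_le_sum fun i hi => ?_
        push_cast
        refine div_le_div_of_nonneg_left hx0.le (by have := ha0r i hi; positivity) ?_
        have := ha2 i hi
        calc 4 * ((b : ℝ) * a i) ≤ 4 * (b * (2 * u)) := by gcongr
          _ = _ := by ring
  have h2 : ∑ i ∈ 𝒜, ∑ j ∈ 𝒜, (if ((Nat.gcd (b * a i) (b * a j) : ℕ) : ℤ) ∣ N i - N j then
        1 / ((Nat.lcm (b * a i) (b * a j) : ℕ) : ℝ) else 0) ≤ (C' * (η * u ^ 2 * (1 + η * log u))) / (b * u ^ 2) := by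
    refine le_trans ?_ (div_le_div_of_nonneg_right hT (by positivity))
    rw [Finset.sum_div]
    refine Finset.sum_le_sum fun i hi => ?_
    rw [Finset.sum_div]
    refine Finset.sum_le_sum fun j hj => ?_
    rw [Nat.gcd_mul_left, Nat.lcm_mul_left]
    split_ifs with hd1 hd2
    · have e0 : ((Nat.gcd (a i) (a j) : ℕ) : ℝ) * (Nat.lcm (a i) (a j) : ℕ) = a i * a j := by
        exact_mod_cast Nat.gcd_mul_lcm (a i) (a j)
      have p1 : (0 : ℝ) < (Nat.lcm (a i) (a j) : ℕ) := by exact_mod_cast Nat.lcm_pos (ha0 i hi) (ha0 j hj)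
      push_cast
      rw [div_le_div_iff₀ (by positivity) (by positivity)]
      have e1 := H.lt i hi
      have e2 := H.lt j hj
      have e3 : u * u ≤ a i * a j := mul_le_mul e1.le e2.le hu0.le (by linarith)
      calc 1 * ((b : ℝ) * u ^ 2) = b * (u * u) := by ring
        _ ≤ b * (a i * a j) := mul_le_mul_of_nonneg_left e3 (by positivity)
        _ = _ := by rw [← e0]; ring
    · exfalso
      apply hd2
      have g1 : ((Nat.gcd (a i) (a j) : ℕ) : ℤ) ∣ N i - N j := by
        refine dvd_trans ?_ hd1
        push_cast
        exact Dvd.intro_left _ rfl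
      have g2 := (Int.natCast_dvd_natCast.mpr (Nat.gcd_dvd_left (a i) (a j))).trans (hN i hi).1
      have g3 := (Int.natCast_dvd_natCast.mpr (Nat.gcd_dvd_right (a i) (a j))).trans (hN j hj).1
      have := dvd_sub (dvd_sub g2 g3) g1
      have e : N i - n i - (N j - n j) - (N i - N j) = n j - n i := by ring
      rwa [e] at this
    · positivity
    · simp
  have h3 : (c * η * x / (8 * b)) ^ 2 ≤ Y.card * (3 * x * ((C' * (η * u ^ 2 * (1 + η * log u))) / (b * u ^ 2))) := by
    refine (pow_le_pow_left₀ (by positivity) h1 2).trans (main.trans ?_)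
    refine mul_le_mul_of_nonneg_left ?_ (by positivity)
    exact mul_le_mul_of_nonneg_left h2 (by positivity)
  have hlog : 0 ≤ log u := log_nonneg (by linarith)
  have hL : 0 < 1 + η * log u := by positivity
  have hpos : 0 < 3 * x * ((C' * (η * u ^ 2 * (1 + η * log u))) / (b * u ^ 2)) := by positivity
  rw [← div_le_iff₀ hpos] at h3
  refine le_trans (le_of_eq ?_) h3
  generalize log u = ℓ at hL
  field_simp
  ring

lemma tau_sq_le_W_mul {a : ℕ} (ha : 0 < a) {σ : ℝ} (hσ : 0 < σ) :
    ((a.divisors.card : ℕ) : ℝ) ^ 2 ≤ (Wfun a σ : ℝ) * (log a / σ + 1) := by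
  set f : ℕ → ℕ := fun d => ⌊log d / σ⌋₊ with hf
  set T := Finset.range (⌊log a / σ⌋₊ + 1) with hT
  have hmaps : ∀ d ∈ a.divisors, f d ∈ T := by
    intro d hd
    have hd0 := Nat.pos_of_mem_divisors hd
    have := Nat.le_of_dvd ha (Nat.dvd_of_mem_divisors hd)
    rw [hT, Finset.mem_range, Nat.lt_succ_iff]
    refine Nat.floor_le_floor (div_le_div_of_nonneg_right (log_le_log (by exact_mod_cast hd0) (by exact_mod_cast this)) hσ.le)
  have h1 := Finset.card_eq_sum_card_fiberwise hmaps
  have hla : 0 ≤ log (a : ℝ) := log_natCast_nonneg a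
  have hcardT : (T.card : ℝ) ≤ log a / σ + 1 := by
    rw [hT, Finset.card_range]; push_cast
    have := Nat.floor_le (by positivity : 0 ≤ log a / σ)
    linarith
  have h2 : ∑ b ∈ T, (((a.divisors.filter fun d => f d = b).card : ℕ) : ℝ) ^ 2 ≤ (Wfun a σ : ℝ) := by
    set Wf := (a.divisors ×ˢ a.divisors).filter fun p : ℕ × ℕ => |Real.log ((p.1 : ℝ) / (p.2 : ℝ))| ≤ σ with hWf
    have e1 : Wfun a σ = Wf.card := by
      rw [Wfun, ← Set.ncard_coe_finset]
      congr 1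
      ext p
      simp only [Set.mem_ofPred_eq, hWf, Finset.coe_filter, Finset.mem_product, Nat.mem_divisors]
      have := ha.ne'
      tauto
    have e2 : ∀ b ∈ T, ((a.divisors.filter fun d => f d = b).card) ^ 2 ≤ (Wf.filter fun p => f p.1 = b).card := by
      intro b _
      rw [sq, ← Finset.card_product]
      refine Finset.card_le_card fun p hp => ?_
      rw [Finset.mem_product, Finset.mem_filter, Finset.mem_filter] at hp
      obtain ⟨⟨hd, hfd⟩, hd', hfd'⟩ := hp
      rw [hWf, Finset.mem_filter, Finset.mem_filter, Finset.mem_product]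
      refine ⟨⟨⟨hd, hd'⟩, ?_⟩, hfd⟩
      have p1 : (1 : ℝ) ≤ p.1 := by exact_mod_cast Nat.pos_of_mem_divisors hd
      have p2 : (1 : ℝ) ≤ p.2 := by exact_mod_cast Nat.pos_of_mem_divisors hd'
      have l1 := log_nonneg p1
      have l2 := log_nonneg p2
      rw [log_div (by linarith) (by linarith)]
      have q1 := Nat.floor_le (by positivity : 0 ≤ log (p.1 : ℝ) / σ)
      have q2 := Nat.lt_floor_add_one (log (p.1 : ℝ) / σ)
      have q3 := Nat.floor_le (by positivity : 0 ≤ log (p.2 : ℝ) / σ)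
      have q4 := Nat.lt_floor_add_one (log (p.2 : ℝ) / σ)
      simp only [hf] at hfd hfd'
      rw [hfd] at q1 q2
      rw [hfd'] at q3 q4
      rw [le_div_iff₀ hσ] at q1 q3
      rw [div_lt_iff₀ hσ] at q2 q4
      rw [abs_le]
      constructor <;> nlinarith
    have : ∑ b ∈ T, ((a.divisors.filter fun d => f d = b).card) ^ 2 ≤ Wf.card := by
      refine (Finset.sum_le_sum e2).trans (le_of_eq ?_)
      refine (Finset.card_eq_sum_card_fiberwise (f := fun p : ℕ × ℕ => f p.1) fun p hp => ?_).symm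
      rw [hWf, Finset.coe_filter] at hp
      exact hmaps _ (Finset.mem_product.mp hp.1).1
    rw [e1]
    exact_mod_cast this
  have h3 : ((a.divisors.card : ℕ) : ℝ) = ∑ b ∈ T, (((a.divisors.filter fun d => f d = b).card : ℕ) : ℝ) := by
    exact_mod_cast h1
  rw [h3]
  calc _ ≤ (T.card : ℝ) * ∑ b ∈ T, (((a.divisors.filter fun d => f d = b).card : ℕ) : ℝ) ^ 2 := sq_sum_le_card_mul_sum_sq
    _ ≤ (log a / σ + 1) * (Wfun a σ : ℝ) := mul_le_mul hcardT h2 (Finset.sum_nonneg fun _ _ => sq_nonneg _) (by positivity)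
    _ = _ := mul_comm _ _

lemma tau_le_W {a : ℕ} (ha : 0 < a) {σ : ℝ} (hσ : 0 < σ) : a.divisors.card ≤ Wfun a σ := by
  rw [Wfun, ← Set.ncard_coe_finset]
  refine Set.ncard_le_ncard_of_injOn (fun d => (d, d)) ?_ ?_ ?_
  · intro d hd
    have hd := Finset.mem_coe.mp hd
    have hd0 : (d : ℝ) ≠ 0 := by exact_mod_cast (Nat.pos_of_mem_divisors hd).ne'
    simp only [Set.mem_ofPred_eq, div_self hd0, log_one, abs_zero]
    exact ⟨Nat.dvd_of_mem_divisors hd, Nat.dvd_of_mem_divisors hd, hσ.le⟩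
  · intro d _ d' _ h
    exact (Prod.mk.inj h).1
  · refine Set.Finite.subset (a.divisors ×ˢ a.divisors).finite_toSet fun p hp => ?_
    simp only [Finset.coe_product, Set.mem_prod, Finset.mem_coe, Nat.mem_divisors]
    exact ⟨⟨hp.1, ha.ne'⟩, hp.2.1, ha.ne'⟩

lemma card_divisors_prod {B : Finset ℕ} (hB : ∀ p ∈ B, p.Prime) : (∏ p ∈ B, p).divisors.card = 2 ^ B.card := by
  induction B using Finset.induction_on with
  | empty => simp
  | insert q B hq ih =>
    have hB' : ∀ p ∈ B, p.Prime := fun p hp => hB p (Finset.mem_insert_of_mem hp)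
    have hq' := hB q (Finset.mem_insert_self _ _)
    rw [Finset.prod_insert hq, Nat.Coprime.card_divisors_mul, ih hB', Finset.card_insert_of_notMem hq, hq'.divisors,
      Finset.card_pair hq'.one_lt.ne, pow_succ, mul_comm]
    refine Nat.Coprime.prod_right fun p hp => (Nat.coprime_primes hq' (hB' p hp)).mpr ?_
    rintro rfl
    exact hq hp

lemma sum_psfFin_tau (F : Polynomial ℤ) (s t : ℝ) (m : ℕ) :
    ∑ a ∈ psfFin s t, (a.divisors.card : ℝ) ^ m * ((polyRho F a : ℝ) / a) =
      ∏ p ∈ primesIn s t, (1 + 2 ^ m * ((polyRho F p : ℝ) / p)) := by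
  rw [sum_psfFin, Finset.prod_one_add]
  refine Finset.sum_congr rfl fun B hB => ?_
  have hp := prime_of_mem_powerset hB
  rw [rho_div_prod F hp, card_divisors_prod hp, Finset.prod_mul_distrib, Finset.prod_const]
  push_cast
  rw [← pow_mul, ← pow_mul, mul_comm m]

lemma sum_psfFin_tau_log (F : Polynomial ℤ) (s t : ℝ) (m : ℕ) :
    ∑ a ∈ psfFin s t, (a.divisors.card : ℝ) ^ m * ((polyRho F a : ℝ) / a) * log a ≤
      (∏ p ∈ primesIn s t, (1 + 2 ^ m * ((polyRho F p : ℝ) / p))) *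
        ∑ p ∈ primesIn s t, 2 ^ m * ((polyRho F p : ℝ) / p) * log p := by
  rw [sum_psfFin]
  refine le_trans (le_of_eq ?_) (sum_powerset_prod_mul_sum_le (primesIn s t) (fun p => 2 ^ m * ((polyRho F p : ℝ) / p)) (fun p => log p) (fun p _ => by positivity) fun p _ => log_natCast_nonneg p)
  refine Finset.sum_congr rfl fun B hB => ?_
  have hp := prime_of_mem_powerset hB
  rw [rho_div_prod F hp, card_divisors_prod hp, Finset.prod_mul_distrib, Finset.prod_const]
  push_cast
  rw [← pow_mul, ← pow_mul, mul_comm m, Real.log_prod fun p h => by exact_mod_cast (hp p h).ne_zero]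

lemma eta_mul_log_le_of_pos {S E E4 V R M η lz ls K C C₁ : ℝ} (hEp : 0 < E) (hE4p : 0 < E4) (hC₁ : 0 < C₁)
    (hK : 0 < K) (hη : 0 < η) (g1 : 0 < ls) (g2 : 0 < lz) (hSpos : 0 < S) (c1 : S ≤ 2 * E - η * R)
    (c2 : M ≤ E4 * ((4 * C₁ + 1) * lz)) (c3 : E4 ^ 2 ≤ R * M) (h0 : 0 ≤ R) (v2 : lz / ls ≤ C * V)
    (e : E * V ^ 2 ≤ K * E4) : η * lz ≤ (2 * (4 * C₁ + 1) * K * C ^ 2 + C ^ 2) * ls ^ 2 := by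
  have c4 : E4 ≤ R * ((4 * C₁ + 1) * lz) := by
    have := c3.trans (mul_le_mul_of_nonneg_left c2 h0)
    nlinarith
  have c5 : η * E4 ≤ 2 * E * ((4 * C₁ + 1) * lz) := by
    have hp : 0 < (4 * C₁ + 1) * lz := by positivity
    calc η * E4 ≤ η * (R * ((4 * C₁ + 1) * lz)) := mul_le_mul_of_nonneg_left c4 hη.le
      _ = (η * R) * ((4 * C₁ + 1) * lz) := by ring
      _ ≤ _ := mul_le_mul_of_nonneg_right (by linarith) hp.le
  have c6 : η * V ^ 2 ≤ K * (2 * ((4 * C₁ + 1) * lz)) := by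
    have h1 := mul_le_mul_of_nonneg_left e hη.le
    have h2 := mul_le_mul_of_nonneg_left c5 hK.le
    have h3 : E * (η * V ^ 2) ≤ E * (K * (2 * ((4 * C₁ + 1) * lz))) := by linarith
    exact le_of_mul_le_mul_left h3 hEp
  have c7 : (lz / ls) ^ 2 ≤ C ^ 2 * V ^ 2 := by
    rw [← mul_pow]; exact pow_le_pow_left₀ (by positivity) v2 2
  have c8 : η * (lz / ls) ^ 2 ≤ 2 * (4 * C₁ + 1) * K * C ^ 2 * lz := by
    have h1 := mul_le_mul_of_nonneg_left c7 hη.le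
    have h2 := mul_le_mul_of_nonneg_left c6 (sq_nonneg C)
    linarith
  rw [div_pow, ← mul_div_assoc, div_le_iff₀ (by positivity)] at c8
  have c9 : lz * (η * lz) ≤ lz * (2 * (4 * C₁ + 1) * K * C ^ 2 * (ls) ^ 2) := by linarith
  have := le_of_mul_le_mul_left c9 g2
  nlinarith [mul_nonneg (sq_nonneg C) (sq_nonneg (ls))]

namespace GoodPoly
variable {F : Polynomial ℤ} {D₀ : ℕ}

lemma exists_prod_interval (H : GoodPoly F D₀) (hD : 2 ≤ D₀) : ∃ C > 0, ∀ s z : ℝ, (D₀ : ℝ) ≤ s → s ≤ z →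
    ∏ p ∈ primesIn s z, (1 + (polyRho F p : ℝ) / p) ≤ C * (log z / log s) ∧
      log z / log s ≤ C * ∏ p ∈ primesIn s z, (1 + (polyRho F p : ℝ) / p) := by
  obtain ⟨C, hC, hu⟩ := H.prod_rho_le
  obtain ⟨c, hc, hl⟩ := H.prod_rho_ge
  refine ⟨C / c, by positivity, fun s z hs hz => ?_⟩
  have hD' : (2 : ℝ) ≤ D₀ := by exact_mod_cast hD
  have h1 := prod_primesIn_mul hs hz (fun p => 1 + (polyRho F p : ℝ) / p)
  have u1 := hu s (by linarith)
  have u2 := hu z (by linarith)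
  have l1 := hl s (by linarith)
  have l2 := hl z (by linarith)
  have g1 : 0 < log s := log_pos (by linarith)
  have g2 : 0 < log z := log_pos (by linarith)
  set V := ∏ p ∈ primesIn s z, (1 + (polyRho F p : ℝ) / p)
  set A := ∏ p ∈ primesIn D₀ s, (1 + (polyRho F p : ℝ) / p)
  have hV : 0 < V := Finset.prod_pos fun p _ => by positivity
  rw [← h1] at u2 l2
  constructor
  · rw [div_mul_div_comm, le_div_iff₀ (by positivity)]
    nlinarith
  · rw [div_mul_eq_mul_div, div_le_div_iff₀ g1 hc]
    nlinarith

lemma exists_prod_sq_le (H : GoodPoly F D₀) : ∃ K > 0, ∀ s z : ℝ, (D₀ : ℝ) ≤ s →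
    (∏ p ∈ primesIn s z, (1 + 2 * ((polyRho F p : ℝ) / p))) * (∏ p ∈ primesIn s z, (1 + (polyRho F p : ℝ) / p)) ^ 2 ≤
      K * ∏ p ∈ primesIn s z, (1 + 4 * ((polyRho F p : ℝ) / p)) := by
  have hsum : Summable fun n : ℕ => 1 / (n : ℝ) ^ 2 := Real.summable_one_div_nat_pow.mpr (by norm_num)
  refine ⟨exp (7 * F.natDegree ^ 2 * ∑' n : ℕ, 1 / (n : ℝ) ^ 2), exp_pos _, fun s z hs => ?_⟩
  have hx : ∀ p ∈ primesIn s z, (polyRho F p : ℝ) / p ≤ F.natDegree / p := fun p hp => by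
    rw [mem_primesIn] at hp
    refine div_le_div_of_nonneg_right ?_ (by positivity)
    exact_mod_cast H.rho_prime_le hp.1 (by exact_mod_cast hs.trans_lt hp.2.1)
  have h1 : ∏ p ∈ primesIn s z, (1 + 7 * ((polyRho F p : ℝ) / p) ^ 2) ≤ exp (7 * F.natDegree ^ 2 * ∑' n : ℕ, 1 / (n : ℝ) ^ 2) := by
    calc _ ≤ ∏ p ∈ primesIn s z, exp (7 * ((polyRho F p : ℝ) / p) ^ 2) :=
          Finset.prod_le_prod (fun p _ => by positivity) fun p _ => by
            have := add_one_le_exp (7 * ((polyRho F p : ℝ) / p) ^ 2); linarith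
      _ = exp (∑ p ∈ primesIn s z, 7 * ((polyRho F p : ℝ) / p) ^ 2) := (Real.exp_sum _ _).symm
      _ ≤ _ := by
        refine exp_le_exp.mpr ?_
        calc _ ≤ ∑ p ∈ primesIn s z, 7 * (F.natDegree : ℝ) ^ 2 * (1 / (p : ℝ) ^ 2) := by
              refine Finset.sum_le_sum fun p hp => ?_
              have := pow_le_pow_left₀ (by positivity) (hx p hp) 2
              rw [div_pow (F.natDegree : ℝ)] at this
              calc _ ≤ 7 * ((F.natDegree : ℝ) ^ 2 / (p : ℝ) ^ 2) := by linarith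
                _ = _ := by ring
          _ ≤ _ := by
            rw [← Finset.mul_sum]
            refine mul_le_mul_of_nonneg_left ?_ (by positivity)
            exact hsum.sum_le_tsum _ fun n _ => by positivity
  calc _ = ∏ p ∈ primesIn s z, ((1 + 2 * ((polyRho F p : ℝ) / p)) * (1 + (polyRho F p : ℝ) / p) ^ 2) := by
        rw [Finset.prod_mul_distrib, Finset.prod_pow]
    _ ≤ ∏ p ∈ primesIn s z, ((1 + 7 * ((polyRho F p : ℝ) / p) ^ 2) * (1 + 4 * ((polyRho F p : ℝ) / p))) := by
        refine Finset.prod_le_prod (fun p _ => by positivity) fun p _ => ?_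
        have : 0 ≤ (polyRho F p : ℝ) / p := by positivity
        generalize (polyRho F p : ℝ) / p = t at this
        nlinarith [pow_nonneg this 2, pow_nonneg this 3]
    _ ≤ _ := by
        rw [Finset.prod_mul_distrib]
        exact mul_le_mul_of_nonneg_right h1 (Finset.prod_nonneg fun p _ => by positivity)

set_option maxHeartbeats 1000000 in
lemma exists_sum_tau_sub_W (H : GoodPoly F D₀) (hD : 2 ≤ D₀) : ∃ K > 0, ∀ s z η : ℝ, (D₀ : ℝ) ≤ s → s ≤ z → 0 < η → η ≤ log z →
    (0 < ∑ a ∈ psfFin s z, (2 * (a.divisors.card : ℝ) - (Wfun a η : ℝ)) * (polyRho F a : ℝ) / (a : ℝ) →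
      η * log z ≤ K * (log s) ^ 2) ∧
    ∑ a ∈ psfFin s z, (2 * (a.divisors.card : ℝ) - (Wfun a η : ℝ)) * (polyRho F a : ℝ) / (a : ℝ) ≤
      K * (log z / log s) ^ 2 := by
  obtain ⟨C, hC, hV⟩ := H.exists_prod_interval hD
  obtain ⟨K, hK, hE⟩ := H.exists_prod_sq_le
  obtain ⟨C₁, hC₁, hlog⟩ := H.sum_rho_log_le
  refine ⟨2 * (4 * C₁ + 1) * K * C ^ 2 + C ^ 2, by positivity, fun s z η hs hz hη hηz => ?_⟩
  have hD' : (2 : ℝ) ≤ D₀ := by exact_mod_cast hD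
  have g1 : 0 < log s := log_pos (by linarith)
  have g2 : 0 < log z := log_pos (by linarith)
  obtain ⟨v1, v2⟩ := hV s z hs hz
  have e := hE s z hs
  have t1 := sum_psfFin_tau F s z 1
  have t2 := sum_psfFin_tau F s z 2
  have t3 := sum_psfFin_tau_log F s z 2
  norm_num only at t1 t2 t3
  have hEV : ∏ p ∈ primesIn s z, (1 + 2 * ((polyRho F p : ℝ) / p)) ≤ (∏ p ∈ primesIn s z, (1 + (polyRho F p : ℝ) / p)) ^ 2 := by
    rw [← Finset.prod_pow]
    refine Finset.prod_le_prod (fun p _ => by positivity) fun p _ => ?_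
    nlinarith [sq_nonneg ((polyRho F p : ℝ) / p)]
  have hVp : 0 < ∏ p ∈ primesIn s z, (1 + (polyRho F p : ℝ) / p) := Finset.prod_pos fun p _ => by positivity
  have hEp : 0 < ∏ p ∈ primesIn s z, (1 + 2 * ((polyRho F p : ℝ) / p)) := Finset.prod_pos fun p _ => by positivity
  have hE4p : 0 < ∏ p ∈ primesIn s z, (1 + 4 * ((polyRho F p : ℝ) / p)) := Finset.prod_pos fun p _ => by positivity
  generalize ∏ p ∈ primesIn s z, (1 + (polyRho F p : ℝ) / p) = V at *
  generalize ∏ p ∈ primesIn s z, (1 + 2 * ((polyRho F p : ℝ) / p)) = E at *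
  generalize ∏ p ∈ primesIn s z, (1 + 4 * ((polyRho F p : ℝ) / p)) = E4 at *
  obtain ⟨S, hS⟩ : ∃ S, S = ∑ a ∈ psfFin s z, (2 * (a.divisors.card : ℝ) - (Wfun a η : ℝ)) * (polyRho F a : ℝ) / (a : ℝ) := ⟨_, rfl⟩
  rw [← hS]
  have ha0 : ∀ a ∈ psfFin s z, 0 < a := fun a ha => (mem_psfFin.mp ha).1
  constructor
  · intro hSpos
    set w : ℕ → ℝ := fun a => (a.divisors.card : ℝ) ^ 2 * ((polyRho F a : ℝ) / a) with hw
    set m : ℕ → ℝ := fun a => log a + η with hm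
    have hm0 : ∀ a, 0 < m a := fun a => by
      have := log_natCast_nonneg a
      simp only [hm]; linarith
    have hw0 : ∀ a, 0 ≤ w a := fun a =>
      mul_nonneg (sq_nonneg _) (div_nonneg (Nat.cast_nonneg _) (Nat.cast_nonneg _))
    have c1 : S ≤ 2 * E - η * ∑ a ∈ psfFin s z, w a / m a := by
      rw [← t1, hS, Finset.mul_sum, Finset.mul_sum, ← Finset.sum_sub_distrib]
      refine Finset.sum_le_sum fun a ha => ?_
      have h := tau_sq_le_W_mul (ha0 a ha) hη
      have h2 : (a.divisors.card : ℝ) ^ 2 * η / m a ≤ Wfun a η := by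
        rw [div_le_iff₀ (hm0 a)]
        have : (Wfun a η : ℝ) * m a = (Wfun a η : ℝ) * (log a / η + 1) * η := by
          simp only [hm]; field_simp
        rw [this]
        exact mul_le_mul_of_nonneg_right h hη.le
      have hr : 0 ≤ (polyRho F a : ℝ) / a := div_nonneg (Nat.cast_nonneg _) (Nat.cast_nonneg _)
      have h3 := mul_le_mul_of_nonneg_right h2 hr
      simp only [hw]
      rw [pow_one]
      calc _ = 2 * ((a.divisors.card : ℝ) * ((polyRho F a : ℝ) / a)) - (Wfun a η : ℝ) * ((polyRho F a : ℝ) / a) := by ring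
        _ ≤ 2 * ((a.divisors.card : ℝ) * ((polyRho F a : ℝ) / a)) - (a.divisors.card : ℝ) ^ 2 * η / m a * ((polyRho F a : ℝ) / a) := by linarith
        _ = _ := by ring
    have c2 : ∑ a ∈ psfFin s z, w a * m a ≤ E4 * ((4 * C₁ + 1) * log z) := by
      have h1 : ∑ a ∈ psfFin s z, w a * m a = ∑ a ∈ psfFin s z, w a * log a + η * E4 := by
        rw [← t2, Finset.mul_sum, ← Finset.sum_add_distrib]
        refine Finset.sum_congr rfl fun a _ => ?_
        simp only [hm, hw]; ring
      have h2 : ∑ p ∈ primesIn s z, 4 * ((polyRho F p : ℝ) / p) * log p ≤ 4 * (C₁ * log z) := by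
        refine le_trans ?_ (mul_le_mul_of_nonneg_left (hlog z (by linarith)) (by norm_num))
        rw [Finset.mul_sum]
        refine le_trans (le_of_eq (Finset.sum_congr rfl fun p _ => ?_)) (Finset.sum_le_sum_of_subset_of_nonneg (primesIn_subset hs le_rfl) fun p _ _ => ?_)
        · ring
        · exact mul_nonneg (by norm_num) (mul_nonneg (div_nonneg (Nat.cast_nonneg _) (Nat.cast_nonneg _)) (log_natCast_nonneg p))
      rw [h1]
      have h3 := t3.trans (mul_le_mul_of_nonneg_left h2 hE4p.le)
      have h4 := mul_le_mul_of_nonneg_right hηz hE4p.le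
      have h5 : ∑ a ∈ psfFin s z, w a * log a ≤ E4 * (4 * (C₁ * log z)) := h3
      linarith
    have c3 : E4 ^ 2 ≤ (∑ a ∈ psfFin s z, w a / m a) * ∑ a ∈ psfFin s z, w a * m a := by
      rw [← t2]
      refine Finset.sum_sq_le_sum_mul_sum_of_sq_le_mul _ (fun a _ => div_nonneg (hw0 a) (hm0 a).le)
        (fun a _ => mul_nonneg (hw0 a) (hm0 a).le) fun a _ => le_of_eq ?_
      have h1 := (hm0 a).ne'
      change (w a) ^ 2 = _
      field_simp
    have h0 : 0 ≤ ∑ a ∈ psfFin s z, w a / m a := Finset.sum_nonneg fun a _ => div_nonneg (hw0 a) (hm0 a).le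
    exact eta_mul_log_le_of_pos hEp hE4p hC₁ hK hη g1 g2 hSpos c1 c2 c3 h0 v2 e
  · have h1 : S ≤ E := by
      rw [← t1, hS]
      refine Finset.sum_le_sum fun a ha => ?_
      have h := tau_le_W (ha0 a ha) hη
      have h' : (a.divisors.card : ℝ) ≤ Wfun a η := by exact_mod_cast h
      rw [mul_div_assoc, pow_one]
      exact mul_le_mul_of_nonneg_right (by linarith) (div_nonneg (Nat.cast_nonneg _) (Nat.cast_nonneg _))
    have h2 : E ≤ V ^ 2 := hEV
    have h3 : V ^ 2 ≤ (C * (log z / log s)) ^ 2 := pow_le_pow_left₀ hVp.le v1 2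
    rw [mul_pow] at h3
    have : 0 ≤ 2 * (4 * C₁ + 1) * K * C ^ 2 * (log z / log s) ^ 2 := by positivity
    linarith

end GoodPoly

lemma prod_primesIn_range (t : ℕ → ℝ) (ht : Monotone t) (f : ℕ → ℝ) (N : ℕ) :
    ∏ p ∈ primesIn (t 0) (t N), f p = ∏ i ∈ Finset.range N, ∏ p ∈ primesIn (t i) (t (i + 1)), f p := by
  induction N with
  | zero =>
    rw [Finset.range_zero, Finset.prod_empty]
    refine Finset.prod_eq_one fun p hp => ?_
    rw [mem_primesIn] at hp
    linarith [hp.2.1, hp.2.2]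
  | succ N ih => rw [Finset.prod_range_succ, ← ih, prod_primesIn_mul (ht (Nat.zero_le _)) (ht (Nat.le_succ _))]

/-- Products of boundedly many primes modulo which `F` has a root, all falling in `(Y, Y^(1+κ)]`. -/
lemma GoodPoly.exists_primes {F : Polynomial ℤ} {D₀ : ℕ} (H : GoodPoly F D₀) (hD : 2 ≤ D₀) {κ : ℝ} (hκ : 0 < κ) (hκ1 : κ ≤ 1) :
    ∃ (k : ℕ) (c s₁ Y₀ : ℝ), 0 < c ∧ 0 < s₁ ∧ 2 ≤ Y₀ ∧ ∀ Y ≥ Y₀, ∃ (P : Finset ℕ) (m : ℕ) (t : ℝ), 0 < m ∧ m ≤ k ∧ 2 ≤ t ∧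
      (∀ p ∈ P, p.Prime ∧ D₀ < p ∧ Y ^ s₁ ≤ p ∧ t < p ∧ (p : ℝ) ≤ t ^ 2 ∧ ∃ μ : ℤ, (p : ℤ) ∣ F.eval μ) ∧
      c ≤ ∑ p ∈ P, (1 : ℝ) / p ∧
      ∀ f : Fin m → ℕ, (∀ i, f i ∈ P) → Y < ((∏ i, f i : ℕ) : ℝ) ∧ ((∏ i, f i : ℕ) : ℝ) ≤ Y ^ (1 + κ) := by
  obtain ⟨C, hC, hV⟩ := H.exists_prod_interval hD
  set q : ℝ := 1 + κ / 4 with hq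
  have hq1 : 1 < q := by rw [hq]; linarith
  have hq2 : q ≤ 2 := by rw [hq]; linarith
  obtain ⟨N, hN⟩ := pow_unbounded_of_one_lt (C * exp 1) hq1
  have hN0 : 0 < N + 1 := Nat.succ_pos _
  set M := N + 1 with hM
  have hNM : C * exp 1 < q ^ M := hN.trans (by rw [hM, pow_succ]; nlinarith [pow_pos (by linarith : 0 < q) N])
  have hqM : 0 < q ^ M := by positivity
  set s₁ : ℝ := κ / 4 / q ^ M with hs₁
  have hs₁0 : 0 < s₁ := by positivity
  have hg := H.two_le
  have hgr : (2 : ℝ) ≤ F.natDegree := by exact_mod_cast hg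
  have hD' : (2 : ℝ) ≤ D₀ := by exact_mod_cast hD
  refine ⟨⌈1 / s₁⌉₊, 1 / (M * F.natDegree), s₁, max 2 ((D₀ : ℝ) ^ (1 / s₁)), by positivity, hs₁0, le_max_left _ _, ?_⟩
  intro Y hY
  have hY2 : 2 ≤ Y := (le_max_left _ _).trans hY
  have hY0 : 0 < Y := by linarith
  have hlY : 0 < log Y := log_pos (by linarith)
  have hYD : (D₀ : ℝ) ≤ Y ^ s₁ := by
    have := rpow_le_rpow (by positivity) ((le_max_right _ _).trans hY) hs₁0.le
    rwa [← rpow_mul (by linarith), one_div_mul_cancel hs₁0.ne', rpow_one] at this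
  set τ : ℕ → ℝ := fun i => Y ^ (s₁ * q ^ i) with hτ
  have hmono : Monotone τ := fun i j hij => by
    refine rpow_le_rpow_of_exponent_le (by linarith) (mul_le_mul_of_nonneg_left ?_ hs₁0.le)
    exact pow_le_pow_right₀ hq1.le hij
  have hτ0 : τ 0 = Y ^ s₁ := by simp [hτ]
  have hτM : τ M = Y ^ (κ / 4) := by
    simp only [hτ, hs₁]; congr 1; field_simp
  have hVM := (hV (τ 0) (τ M) (hτ0 ▸ hYD) (hmono (Nat.zero_le _))).2
  have hratio : log (τ M) / log (τ 0) = q ^ M := by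
    rw [hτ0, hτM, log_rpow hY0, log_rpow hY0, hs₁]
    field_simp
  rw [hratio, prod_primesIn_range τ hmono] at hVM
  have hbig : exp 1 < ∏ i ∈ Finset.range M, ∏ p ∈ primesIn (τ i) (τ (i + 1)), (1 + (polyRho F p : ℝ) / p) := by
    have := hNM.trans_le hVM
    exact lt_of_mul_lt_mul_left this hC.le
  obtain ⟨i, hi, hprod⟩ : ∃ i ∈ Finset.range M, exp (1 / M) ≤ ∏ p ∈ primesIn (τ i) (τ (i + 1)), (1 + (polyRho F p : ℝ) / p) := by
    by_contra hcon
    push Not at hcon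
    have : ∏ i ∈ Finset.range M, ∏ p ∈ primesIn (τ i) (τ (i + 1)), (1 + (polyRho F p : ℝ) / p) ≤ ∏ i ∈ Finset.range M, exp (1 / M) :=
      Finset.prod_le_prod (fun i _ => Finset.prod_nonneg fun p _ => by positivity) fun i hi => (hcon i hi).le
    rw [Finset.prod_const, Finset.card_range, ← Real.exp_nat_mul, mul_one_div_cancel (by positivity)] at this
    linarith
  rw [Finset.mem_range] at hi
  set t := τ i with ht
  have htt : Y ^ s₁ ≤ t := hτ0 ▸ hmono (Nat.zero_le i)
  have ht2 : 2 ≤ t := hD'.trans (hYD.trans htt)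
  have ht' : τ (i + 1) = t ^ q := by
    rw [ht]; simp only [hτ]
    rw [← rpow_mul hY0.le, pow_succ, mul_assoc]
  set σ := s₁ * q ^ i with hσ
  have htσ : t = Y ^ σ := rfl
  have hσ1 : s₁ ≤ σ := by
    rw [hσ]; nlinarith [one_le_pow₀ hq1.le (n := i)]
  have hσ0 : 0 < σ := hs₁0.trans_le hσ1
  have hσ2 : σ ≤ κ / 4 := by
    have : q ^ i ≤ q ^ M := pow_le_pow_right₀ hq1.le hi.le
    calc σ ≤ s₁ * q ^ M := mul_le_mul_of_nonneg_left this hs₁0.le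
      _ = κ / 4 := by rw [hs₁]; field_simp
  set m := ⌈1 / σ⌉₊ with hm
  have hm0 : 0 < m := Nat.ceil_pos.mpr (by positivity)
  have hm1 : 1 ≤ σ * m := by
    have := Nat.le_ceil (1 / σ)
    rw [div_le_iff₀ hσ0] at this
    linarith
  have hm2 : σ * m ≤ 1 + σ := by
    have := (Nat.ceil_lt_add_one (by positivity : 0 ≤ 1 / σ)).le
    have h2 := mul_le_mul_of_nonneg_left this hσ0.le
    rwa [mul_add, mul_one_div_cancel hσ0.ne', mul_one] at h2
  refine ⟨(primesIn t (t ^ q)).filter fun p => 1 ≤ polyRho F p, m, t, hm0, Nat.ceil_le_ceil ?_, ht2, ?_, ?_, ?_⟩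
  · exact one_div_le_one_div_of_le hs₁0 hσ1
  · intro p hp
    rw [Finset.mem_filter, mem_primesIn] at hp
    obtain ⟨⟨hpp, hp1, hp2⟩, hp3⟩ := hp
    refine ⟨hpp, ?_, htt.trans hp1.le, hp1, hp2.trans ?_, ?_⟩
    · exact_mod_cast (hYD.trans htt).trans_lt hp1
    · calc t ^ q ≤ t ^ (2 : ℝ) := rpow_le_rpow_of_exponent_le (by linarith) hq2
        _ = t ^ 2 := by norm_cast
    · rw [polyRho_eq] at hp3
      obtain ⟨n, hn⟩ := Finset.card_pos.mp hp3
      exact ⟨n, (Finset.mem_filter.mp hn).2⟩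
  · rw [ht'] at hprod
    have h1 : exp (1 / M) ≤ exp (∑ p ∈ primesIn t (t ^ q), (polyRho F p : ℝ) / p) := by
      refine hprod.trans ?_
      rw [Real.exp_sum]
      refine Finset.prod_le_prod (fun p _ => by positivity) fun p _ => ?_
      have := add_one_le_exp ((polyRho F p : ℝ) / p); linarith
    rw [exp_le_exp] at h1
    have h2 : ∑ p ∈ primesIn t (t ^ q), (polyRho F p : ℝ) / p ≤
        F.natDegree * ∑ p ∈ (primesIn t (t ^ q)).filter (fun p => 1 ≤ polyRho F p), (1 : ℝ) / p := by
      rw [Finset.mul_sum, Finset.sum_filter]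
      refine Finset.sum_le_sum fun p hp => ?_
      rw [mem_primesIn] at hp
      split_ifs with h
      · rw [mul_one_div]
        refine div_le_div_of_nonneg_right ?_ (by positivity)
        exact_mod_cast H.rho_prime_le hp.1 (by exact_mod_cast (hYD.trans htt).trans_lt hp.2.1)
      · have : polyRho F p = 0 := by omega
        rw [this]; simp
    rw [div_mul_eq_div_div, div_le_iff₀ (by positivity)]
    linarith
  · intro f hf
    have hmem : ∀ j, t < f j ∧ (f j : ℝ) ≤ t ^ q := fun j => by
      have := hf j
      rw [Finset.mem_filter, mem_primesIn] at this
      exact this.1.2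
    push_cast
    constructor
    · have h1 : Y ≤ t ^ m := by
        rw [htσ, ← rpow_natCast, ← rpow_mul hY0.le]
        calc Y = Y ^ (1 : ℝ) := (rpow_one _).symm
          _ ≤ _ := rpow_le_rpow_of_exponent_le (by linarith) hm1
      refine h1.trans_lt ?_
      have h2 : t ^ m = ∏ _j : Fin m, t := by simp
      rw [h2]
      have : Nonempty (Fin m) := ⟨⟨0, hm0⟩⟩
      exact Finset.prod_lt_prod_of_nonempty (fun _ _ => by linarith) (fun j _ => (hmem j).1) Finset.univ_nonempty
    · calc ∏ j, (f j : ℝ) ≤ ∏ _j : Fin m, t ^ q := Finset.prod_le_prod (fun _ _ => by positivity) fun j _ => (hmem j).2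
        _ = (t ^ q) ^ m := by simp
        _ = Y ^ (σ * q * m) := by
          rw [htσ, ← rpow_natCast, ← rpow_mul hY0.le, ← rpow_mul hY0.le]
        _ ≤ Y ^ (1 + κ) := by
          refine rpow_le_rpow_of_exponent_le (by linarith) ?_
          have h1 : σ * q * m = (σ * m) * q := by ring
          rw [h1]
          calc (σ * m) * q ≤ (1 + κ / 4) * q := mul_le_mul_of_nonneg_right (by linarith) (by linarith)
            _ ≤ 1 + κ := by rw [hq]; nlinarith

lemma exists_card_eq_polyH_sub (F : Polynomial ℤ) {x y z : ℝ} (hx : 0 < x) : ∃ Y : Finset ℕ,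
    (∀ n ∈ upperHalf x, ∀ d : ℕ, 0 < d → (d : ℤ) ∣ F.eval (n : ℤ) → y < d → (d : ℝ) ≤ z → n ∈ Y) ∧
      (Y.card : ℝ) = (polyH F x y z : ℝ) - polyH F (x / 2) y z := by
  obtain ⟨Q, hQ⟩ : ∃ Q : ℕ → Prop, ∀ n, Q n ↔
      ∃ d : ℕ, 0 < d ∧ (d : ℤ) ∣ F.eval (n : ℤ) ∧ y < (d : ℝ) ∧ (d : ℝ) ≤ z := ⟨_, fun _ => Iff.rfl⟩
  have hcard : ∀ w : ℝ, 0 ≤ w → polyH F w y z = ((Finset.Ioc 0 ⌊w⌋₊).filter Q).card := by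
    intro w hw
    rw [polyH, ← Set.ncard_coe_finset]
    congr 1
    ext n
    simp only [Finset.coe_filter, Finset.mem_Ioc, Set.mem_ofPred_eq, Nat.le_floor_iff hw, hQ, and_assoc]
  have hle : ⌊x / 2⌋₊ ≤ ⌊x⌋₊ := Nat.floor_le_floor (by linarith)
  refine ⟨(upperHalf x).filter Q, fun n hn d hd0 hd hy hz =>
    Finset.mem_filter.mpr ⟨hn, (hQ n).mpr ⟨d, hd0, hd, hy, hz⟩⟩, ?_⟩
  rw [hcard x hx.le, hcard (x / 2) (by linarith), eq_sub_iff_add_eq, ← Nat.cast_add, upperHalf,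
    ← Finset.card_union_of_disjoint, ← Finset.filter_union, Finset.union_comm,
    Finset.Ioc_union_Ioc_eq_Ioc (Nat.zero_le _) hle]
  refine Finset.disjoint_filter_filter (Finset.disjoint_left.mpr fun n h1 h2 => ?_)
  rw [Finset.mem_Ioc] at h1 h2
  omega

namespace GoodPoly
variable {F : Polynomial ℤ} {D₀ : ℕ} (H : GoodPoly F D₀)
include H

lemma exists_root_prod (m : ℕ) (f : Fin m → ℕ)
    (hf : ∀ i, (f i).Prime ∧ D₀ < f i ∧ ∃ μ : ℤ, (f i : ℤ) ∣ F.eval μ) :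
    ∃ ν : ℤ, ((∏ i, f i : ℕ) : ℤ) ∣ F.eval ν := by
  induction m with
  | zero => exact ⟨0, by simp⟩
  | succ m ih =>
    rw [Fin.prod_univ_castSucc]
    refine H.exists_root_mul_prime (Finset.prod_pos fun i _ => (hf i.castSucc).1.pos) (hf (Fin.last m)).1
      (hf (Fin.last m)).2.1 (ih _ fun i => hf i.castSucc) (hf (Fin.last m)).2.2

/-- A value `F n` with `n ≤ x` has boundedly many prime factors exceeding a power of `x`. -/
lemma exists_card_prime_dvd_le : ∃ x₀ : ℝ, 1 < x₀ ∧ ∀ x ≥ x₀, ∀ σ > 0, ∀ P : Finset ℕ,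
    (∀ p ∈ P, p.Prime ∧ x ^ σ ≤ (p : ℝ)) → ∀ n ∈ upperHalf x,
      ((P.filter fun p : ℕ => (p : ℤ) ∣ F.eval (n : ℤ)).card : ℝ) ≤ (F.natDegree + 1) / σ := by
  obtain ⟨A, hA⟩ : ∃ A : ℝ, A = ∑ i ∈ Finset.range (F.natDegree + 1), |(F.coeff i : ℝ)| := ⟨_, rfl⟩
  refine ⟨max 2 A, by have := le_max_left 2 A; linarith, fun x hx σ hσ P hP n hn => ?_⟩
  have hx2 : 2 ≤ x := le_trans (le_max_left _ _) hx
  have hxA : A ≤ x := le_trans (le_max_right _ _) hx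
  have hx0 : 0 < x := by linarith
  obtain ⟨hn1, hn2⟩ := (mem_upperHalf hx0.le).mp hn
  have hF : |((F.eval (n : ℤ) : ℤ) : ℝ)| ≤ x ^ (F.natDegree + 1) := by
    rw [Polynomial.eval_eq_sum_range]
    push_cast
    calc _ ≤ ∑ i ∈ Finset.range (F.natDegree + 1), |(F.coeff i : ℝ) * (n : ℝ) ^ i| := Finset.abs_sum_le_sum_abs _ _
      _ ≤ ∑ i ∈ Finset.range (F.natDegree + 1), |(F.coeff i : ℝ)| * x ^ F.natDegree := by
          refine Finset.sum_le_sum fun i hi => ?_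
          rw [abs_mul, abs_of_nonneg (by positivity : (0 : ℝ) ≤ (n : ℝ) ^ i)]
          refine mul_le_mul_of_nonneg_left ?_ (abs_nonneg _)
          calc (n : ℝ) ^ i ≤ x ^ i := by gcongr
            _ ≤ x ^ F.natDegree := pow_le_pow_right₀ (by linarith) (by rw [Finset.mem_range] at hi; omega)
      _ = A * x ^ F.natDegree := by rw [hA, Finset.sum_mul]
      _ ≤ x * x ^ F.natDegree := by gcongr
      _ = _ := by ring
  obtain ⟨Q, hQ⟩ : ∃ Q, Q = P.filter fun p : ℕ => (p : ℤ) ∣ F.eval (n : ℤ) := ⟨_, rfl⟩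
  rw [← hQ]
  have hQm : ∀ p ∈ Q, p.Prime ∧ x ^ σ ≤ (p : ℝ) ∧ p ∣ (F.eval (n : ℤ)).natAbs := by
    intro p hp
    rw [hQ, Finset.mem_filter] at hp
    exact ⟨(hP p hp.1).1, (hP p hp.1).2, Int.natCast_dvd.mp hp.2⟩
  have hdvd : (∏ p ∈ Q, p) ∣ (F.eval (n : ℤ)).natAbs :=
    Finset.prod_primes_dvd _ (fun p hp => (hQm p hp).1.prime) fun p hp => (hQm p hp).2.2
  have hle := Nat.le_of_dvd (Int.natAbs_pos.mpr (H.eval_ne_zero n)) hdvd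
  have h1 : (x ^ σ) ^ Q.card ≤ x ^ (F.natDegree + 1) := by
    calc (x ^ σ) ^ Q.card = ∏ _p ∈ Q, x ^ σ := by rw [Finset.prod_const]
      _ ≤ ∏ p ∈ Q, (p : ℝ) := Finset.prod_le_prod (fun p _ => by positivity) fun p hp => (hQm p hp).2.1
      _ = ((∏ p ∈ Q, p : ℕ) : ℝ) := by push_cast; rfl
      _ ≤ ((F.eval (n : ℤ)).natAbs : ℝ) := by exact_mod_cast hle
      _ = |((F.eval (n : ℤ) : ℤ) : ℝ)| := by rw [Nat.cast_natAbs, Int.cast_abs]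
      _ ≤ _ := hF
  rw [← Real.rpow_mul_natCast hx0.le, ← Real.rpow_natCast x (F.natDegree + 1),
    Real.rpow_le_rpow_left_iff (by linarith)] at h1
  rw [le_div_iff₀ hσ]
  push_cast at h1
  linarith

end GoodPoly

/-- Double counting of integers `n` against tuples of primes whose product divides `F n`. -/
lemma sum_card_le_of_prod_dvd (F : Polynomial ℤ) {m : ℕ} (P : Finset ℕ) (Y : Finset ℕ) (S : (Fin m → ℕ) → Finset ℕ)
    {B : ℝ} (hY : ∀ f ∈ Fintype.piFinset fun _ : Fin m => P, S f ⊆ Y)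
    (hS : ∀ f ∈ Fintype.piFinset fun _ : Fin m => P, ∀ n ∈ S f, ((∏ i, f i : ℕ) : ℤ) ∣ F.eval (n : ℤ))
    (hB : ∀ f ∈ Fintype.piFinset fun _ : Fin m => P, ∀ n ∈ S f,
      ((P.filter fun p : ℕ => (p : ℤ) ∣ F.eval (n : ℤ)).card : ℝ) ≤ B) (hB0 : 0 ≤ B) :
    ∑ f ∈ Fintype.piFinset fun _ : Fin m => P, ((S f).card : ℝ) ≤ B ^ m * Y.card := by
  have h1 : ∀ f ∈ Fintype.piFinset fun _ : Fin m => P, ((S f).card : ℝ) = ∑ n ∈ Y, if n ∈ S f then (1 : ℝ) else 0 := by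
    intro f hf
    rw [Finset.sum_boole, Finset.filter_mem_eq_inter, Finset.inter_eq_right.mpr (hY f hf)]
  rw [Finset.sum_congr rfl h1, Finset.sum_comm, mul_comm, ← nsmul_eq_mul]
  refine Finset.sum_le_card_nsmul _ _ _ fun n _ => ?_
  rw [Finset.sum_boole]
  by_cases he : ∃ f ∈ Fintype.piFinset fun _ : Fin m => P, n ∈ S f
  · obtain ⟨f₀, hf₀, hn₀⟩ := he
    have hsub : ((Fintype.piFinset fun _ : Fin m => P).filter fun f => n ∈ S f) ⊆
        Fintype.piFinset fun _ : Fin m => P.filter fun p : ℕ => (p : ℤ) ∣ F.eval (n : ℤ) := by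
      intro f hf
      rw [Finset.mem_filter] at hf
      rw [Fintype.mem_piFinset]
      intro i
      refine Finset.mem_filter.mpr ⟨Fintype.mem_piFinset.mp hf.1 i, ?_⟩
      exact (Int.natCast_dvd_natCast.mpr (Finset.dvd_prod_of_mem f (Finset.mem_univ i))).trans (hS f hf.1 n hf.2)
    calc _ ≤ ((Fintype.piFinset fun _ : Fin m => P.filter fun p : ℕ => (p : ℤ) ∣ F.eval (n : ℤ)).card : ℝ) := by
          exact_mod_cast Finset.card_le_card hsub
      _ = ((P.filter fun p : ℕ => (p : ℤ) ∣ F.eval (n : ℤ)).card : ℝ) ^ m := by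
          rw [Fintype.card_piFinset_const, Nat.cast_pow]
      _ ≤ B ^ m := by
          have := hB f₀ hf₀ n hn₀
          gcongr
  · rw [Finset.filter_false_of_mem fun f hf hn => he ⟨f, hf, hn⟩]
    simpa using pow_nonneg hB0 m

lemma sum_piFinset_inv_prod (P : Finset ℕ) (m : ℕ) :
    ∑ f ∈ Fintype.piFinset fun _ : Fin m => P, (1 : ℝ) / ((∏ i, f i : ℕ) : ℝ) = (∑ p ∈ P, (1 : ℝ) / p) ^ m := by
  have := Finset.sum_prod_piFinset P fun (_ : Fin m) (p : ℕ) => (1 : ℝ) / p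
  rw [Finset.prod_const, Finset.card_univ, Fintype.card_fin] at this
  rw [← this]
  refine Finset.sum_congr rfl fun f _ => ?_
  rw [Finset.prod_div_distrib]
  push_cast
  simp

lemma gcd_prod_le {ι : Type*} (s : Finset ι) (b : ℕ) (c : ι → ℕ) (hc : ∀ i ∈ s, 0 < c i) :
    b.gcd (∏ i ∈ s, c i) ≤ ∏ i ∈ s, b.gcd (c i) := by
  refine Nat.le_of_dvd (Finset.prod_pos fun i hi => Nat.gcd_pos_of_pos_right _ (hc i hi)) ?_
  induction s using Finset.induction_on with
  | empty => simp
  | insert a s ha ih =>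
    rw [Finset.prod_insert ha, Finset.prod_insert ha]
    exact (Nat.gcd_mul_right_dvd_mul_gcd _ _ _).trans
      (mul_dvd_mul_left _ (ih fun i hi => hc i (Finset.mem_insert_of_mem hi)))

lemma sum_gcd_div_le (P : Finset ℕ) (hP : ∀ p ∈ P, p.Prime) {m : ℕ} (f : Fin m → ℕ)
    (hf : f ∈ Fintype.piFinset fun _ : Fin m => P) :
    ∑ p ∈ P, (((∏ i, f i).gcd p : ℕ) : ℝ) / p ≤ m + ∑ p ∈ P, (1 : ℝ) / p := by
  have h1 : ∀ p ∈ P, (((∏ i, f i).gcd p : ℕ) : ℝ) / p ≤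
      (if p ∈ Finset.univ.image f then (1 : ℝ) else 0) + 1 / p := by
    intro p hp
    have hp0 : (0 : ℝ) < p := by exact_mod_cast (hP p hp).pos
    split_ifs with h
    · have : (((∏ i, f i).gcd p : ℕ) : ℝ) ≤ p := by
        exact_mod_cast Nat.le_of_dvd (hP p hp).pos (Nat.gcd_dvd_right _ _)
      have h2 : (((∏ i, f i).gcd p : ℕ) : ℝ) / p ≤ 1 := (div_le_one hp0).mpr this
      have : (0 : ℝ) ≤ 1 / p := by positivity
      linarith
    · have : Nat.Coprime (∏ i, f i) p := by
        refine Nat.Coprime.prod_left fun i _ => (Nat.coprime_primes (hP _ (Fintype.mem_piFinset.mp hf i)) (hP p hp)).mpr ?_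
        rintro rfl
        exact h (Finset.mem_image_of_mem f (Finset.mem_univ i))
      rw [this]
      simp
  refine (Finset.sum_le_sum h1).trans ?_
  rw [Finset.sum_add_distrib, Finset.sum_boole]
  gcongr
  calc (P.filter fun p => p ∈ Finset.univ.image f).card ≤ (Finset.univ.image f).card :=
        Finset.card_le_card fun p hp => (Finset.mem_filter.mp hp).2
    _ ≤ m := Finset.card_image_le.trans (by simp)

lemma sum_inv_lcm_le (P : Finset ℕ) (hP : ∀ p ∈ P, p.Prime) (m : ℕ) :
    ∑ f ∈ Fintype.piFinset fun _ : Fin m => P, ∑ f' ∈ Fintype.piFinset fun _ : Fin m => P,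
      (1 : ℝ) / ((∏ i, f i).lcm (∏ i, f' i) : ℕ) ≤
        (∑ p ∈ P, (1 : ℝ) / p) ^ m * (m + ∑ p ∈ P, (1 : ℝ) / p) ^ m := by
  have hpos : ∀ f ∈ Fintype.piFinset fun _ : Fin m => P, ∀ i, 0 < f i := fun f hf i =>
    (hP _ (Fintype.mem_piFinset.mp hf i)).pos
  rw [← sum_piFinset_inv_prod, Finset.sum_mul]
  refine Finset.sum_le_sum fun f hf => ?_
  calc _ ≤ ∑ f' ∈ Fintype.piFinset fun _ : Fin m => P, (1 : ℝ) / ((∏ i, f i : ℕ) : ℝ) *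
        ∏ i, (((∏ i, f i).gcd (f' i) : ℕ) : ℝ) / (f' i) := by
        refine Finset.sum_le_sum fun f' hf' => ?_
        have hb : 0 < ∏ i, f i := Finset.prod_pos fun i _ => hpos f hf i
        have hb' : 0 < ∏ i, f' i := Finset.prod_pos fun i _ => hpos f' hf' i
        have h1 := gcd_prod_le Finset.univ (∏ i, f i) f' fun i _ => hpos f' hf' i
        have h2 := Nat.gcd_mul_lcm (∏ i, f i) (∏ i, f' i)
        have hl : 0 < (∏ i, f i).lcm (∏ i, f' i) := Nat.lcm_pos hb hb'
        rw [Finset.prod_div_distrib, ← Nat.cast_prod, ← Nat.cast_prod]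
        generalize ∏ i, f i = b at *
        generalize ∏ i, f' i = b' at *
        generalize ∏ i, b.gcd (f' i) = G at *
        have hb0 : (0 : ℝ) < b := by exact_mod_cast hb
        have hb0' : (0 : ℝ) < b' := by exact_mod_cast hb'
        have hl0 : (0 : ℝ) < (b.lcm b' : ℕ) := by exact_mod_cast hl
        rw [div_mul_div_comm, one_mul, div_le_div_iff₀ hl0 (by positivity), one_mul]
        have h3 : ((b.gcd b' : ℕ) : ℝ) * (b.lcm b' : ℕ) = b * b' := by exact_mod_cast h2
        rw [← h3]
        gcongr
    _ = (1 : ℝ) / ((∏ i, f i : ℕ) : ℝ) * (∑ p ∈ P, (((∏ i, f i).gcd p : ℕ) : ℝ) / p) ^ m := by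
        rw [← Finset.mul_sum]
        have := Finset.sum_prod_piFinset P fun (_ : Fin m) (p : ℕ) => (((∏ i, f i).gcd p : ℕ) : ℝ) / p
        rw [Finset.prod_const, Finset.card_univ, Fintype.card_fin] at this
        rw [this]
    _ ≤ _ := by
        have := sum_gcd_div_le P hP f hf
        have h0 : 0 ≤ ∑ p ∈ P, (((∏ i, f i).gcd p : ℕ) : ℝ) / p := Finset.sum_nonneg fun p _ => by positivity
        gcongr

namespace GoodPoly
variable {F : Polynomial ℤ} {D₀ : ℕ} (H : GoodPoly F D₀)
include H

/-- Integers at which `F` has a divisor that is a product of `m` primes of `P`, when these products are small. -/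
lemma card_ge_of_mul_le (P : Finset ℕ) {m : ℕ} {x : ℝ} (hx : 0 < x)
    (hP : ∀ p ∈ P, p.Prime ∧ D₀ < p ∧ ∃ μ : ℤ, (p : ℤ) ∣ F.eval μ) (hS : 0 < ∑ p ∈ P, (1 : ℝ) / p)
    (hle : ∀ f ∈ Fintype.piFinset fun _ : Fin m => P, 8 * ((∏ i, f i : ℕ) : ℝ) ≤ x ∧
      ((∏ i, f i : ℕ) : ℝ) ^ 2 ≤ x) (Y : Finset ℕ)
    (hY : ∀ f ∈ Fintype.piFinset fun _ : Fin m => P, ∀ n ∈ upperHalf x,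
      ((∏ i, f i : ℕ) : ℤ) ∣ F.eval (n : ℤ) → n ∈ Y) :
    (∑ p ∈ P, (1 : ℝ) / p) ^ m * x ≤ 48 * (m + ∑ p ∈ P, (1 : ℝ) / p) ^ m * Y.card := by
  have hroot : ∀ f : Fin m → ℕ, ∃ ν : ℤ, f ∈ (Fintype.piFinset fun _ : Fin m => P) →
      ((∏ i, f i : ℕ) : ℤ) ∣ F.eval ν := by
    intro f
    by_cases hf : f ∈ Fintype.piFinset fun _ : Fin m => P
    · obtain ⟨ν, hν⟩ := H.exists_root_prod m f fun i => hP _ (Fintype.mem_piFinset.mp hf i)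
      exact ⟨ν, fun _ => hν⟩
    · exact ⟨0, fun h => absurd h hf⟩
  choose ν hν using hroot
  have hb : ∀ f ∈ Fintype.piFinset fun _ : Fin m => P, 0 < ∏ i, f i := fun f hf =>
    Finset.prod_pos fun i _ => (hP _ (Fintype.mem_piFinset.mp hf i)).1.pos
  have key := sq_sum_le_card_mul (Fintype.piFinset fun _ : Fin m => P) (fun f => ∏ i, f i) ν hx hb
    (fun f hf => (hle f hf).1)
    (fun f hf f' hf' => by
      have h1 : (∏ i, f i).lcm (∏ i, f' i) ≤ (∏ i, f i) * (∏ i, f' i) :=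
        Nat.le_of_dvd (Nat.mul_pos (hb f hf) (hb f' hf')) (Nat.lcm_dvd_mul _ _)
      have h2 : (((∏ i, f i).lcm (∏ i, f' i) : ℕ) : ℝ) ≤ ((∏ i, f i : ℕ) : ℝ) * ((∏ i, f' i : ℕ) : ℝ) := by
        exact_mod_cast h1
      have h3 := (hle f hf).2
      have h4 := (hle f' hf').2
      nlinarith [sq_nonneg (((∏ i, f i : ℕ) : ℝ) - ((∏ i, f' i : ℕ) : ℝ))])
    (Y := Y) (fun n hn f hf hd => hY f hf n hn (by
      have h := dvd_eval_of_dvd_sub F (h := ((∏ i, f i : ℕ) : ℤ)) (m := ν f) (ν := n)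
      refine h ?_ (hν f hf)
      rw [← neg_sub, dvd_neg]
      exact hd))
  have h1 : ∑ f ∈ Fintype.piFinset fun _ : Fin m => P, x / (4 * ((∏ i, f i : ℕ) : ℝ)) =
      x / 4 * (∑ p ∈ P, (1 : ℝ) / p) ^ m := by
    rw [← sum_piFinset_inv_prod, Finset.mul_sum]
    refine Finset.sum_congr rfl fun f _ => ?_
    rw [div_mul_div_comm, mul_one]
  have h2 : ∑ f ∈ Fintype.piFinset fun _ : Fin m => P, ∑ f' ∈ Fintype.piFinset fun _ : Fin m => P,
      (if (((∏ i, f i).gcd (∏ i, f' i) : ℕ) : ℤ) ∣ ν f - ν f' then (1 : ℝ) / ((∏ i, f i).lcm (∏ i, f' i) : ℕ) else 0) ≤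
        (∑ p ∈ P, (1 : ℝ) / p) ^ m * (m + ∑ p ∈ P, (1 : ℝ) / p) ^ m := by
    refine le_trans (Finset.sum_le_sum fun f _ => Finset.sum_le_sum fun f' _ => ?_)
      (sum_inv_lcm_le P (fun p hp => (hP p hp).1) m)
    split_ifs
    · exact le_rfl
    · positivity
  rw [h1] at key
  have h3 := mul_le_mul_of_nonneg_left h2 (by positivity : 0 ≤ 3 * x)
  have h4 := key.trans (mul_le_mul_of_nonneg_left h3 (Nat.cast_nonneg Y.card))
  generalize ∑ p ∈ P, (1 : ℝ) / p = S at *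
  have hT : 0 < S ^ m := pow_pos hS m
  generalize S ^ m = T at *
  generalize (m + S) ^ m = V at *
  have h5 : (x * T) * (T * x) ≤ (x * T) * (48 * V * Y.card) := by nlinarith [h4]
  exact le_of_mul_le_mul_left h5 (by positivity)

end GoodPoly

lemma pow_le_mul_of_pow_add_le {S V c X N : ℝ} {m k : ℕ} (hm : m ≤ k) (hc : 0 < c) (hcS : c ≤ S) (hX : 0 ≤ X)
    (h : S ^ m * X ≤ V * (m + S) ^ m * N) : (c / (k + c)) ^ k * X ≤ V * N := by
  have hS : 0 < S := hc.trans_le hcS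
  have hmk : (m : ℝ) ≤ k := by exact_mod_cast hm
  have hm0 : (0 : ℝ) ≤ m := Nat.cast_nonneg m
  have hk0 : (0 : ℝ) ≤ k := Nat.cast_nonneg k
  have h1 : c / (k + c) ≤ S / (m + S) := by
    rw [div_le_div_iff₀ (by linarith) (by linarith)]
    nlinarith
  have h2 : (c / (k + c)) ^ k ≤ (S / (m + S)) ^ m := by
    calc (c / (k + c)) ^ k ≤ (c / (k + c)) ^ m :=
          pow_le_pow_of_le_one (by positivity) ((div_le_one (by linarith)).mpr (by linarith)) hm
      _ ≤ _ := pow_le_pow_left₀ (by positivity) h1 m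
  calc (c / (k + c)) ^ k * X ≤ (S / (m + S)) ^ m * X := by gcongr
    _ = (S ^ m * X) / (m + S) ^ m := by rw [div_pow]; ring
    _ ≤ (V * (m + S) ^ m * N) / (m + S) ^ m := by gcongr
    _ = _ := by field_simp

lemma mul_le_of_mul_pow_le {S B c L N : ℝ} {m k : ℕ} (hm : m ≤ k) (hc : 0 < c) (hcS : c ≤ S) (hL : 0 ≤ L)
    (hB : 0 ≤ B) (hN : 0 ≤ N) (h : L * S ^ m ≤ B ^ m * N) : (min c 1) ^ k / (max B 1) ^ k * L ≤ N := by
  have h1 : (min c 1) ^ k ≤ S ^ m := by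
    calc (min c 1) ^ k ≤ (min c 1) ^ m :=
          pow_le_pow_of_le_one (le_min hc.le zero_le_one) (min_le_right _ _) hm
      _ ≤ S ^ m := pow_le_pow_left₀ (le_min hc.le zero_le_one) ((min_le_left _ _).trans hcS) m
  have h2 : B ^ m ≤ (max B 1) ^ k := by
    calc B ^ m ≤ (max B 1) ^ m := pow_le_pow_left₀ hB (le_max_left _ _) m
      _ ≤ _ := pow_le_pow_right₀ (le_max_right _ _) hm
  have h3 : 0 < (max B 1) ^ k := pow_pos (lt_of_lt_of_le one_pos (le_max_right _ _)) k
  rw [div_mul_eq_mul_div, div_le_iff₀ h3]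
  calc (min c 1) ^ k * L ≤ S ^ m * L := by gcongr
    _ ≤ B ^ m * N := by linarith
    _ ≤ _ := by rw [mul_comm N]; gcongr

/-- If `y < z ≤ x ^ (1 - δ / 2)` with `y` large, then `x` exceeds `y` and `16 ≤ x ^ (δ / 4)`. -/
lemma le_of_le_rpow {δ x y z : ℝ} (hδ0 : 0 < δ) (hδ1 : δ < 1) (hx : 0 < x) (hy1 : 1 ≤ y)
    (hy : (16 : ℝ) ^ (4 / δ) ≤ y) (hyz : y < z) (hz : z ≤ x ^ (1 - δ / 2)) :
    y ≤ x ∧ 16 ≤ x ^ (δ / 4) ∧ 16 * z ≤ x := by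
  have hx1 : 1 ≤ x := by
    by_contra! h
    have := Real.rpow_le_one hx.le h.le (by linarith : 0 ≤ 1 - δ / 2)
    linarith
  have h1 : x ^ (1 - δ / 2) ≤ x := by
    calc x ^ (1 - δ / 2) ≤ x ^ (1 : ℝ) := Real.rpow_le_rpow_of_exponent_le hx1 (by linarith)
      _ = x := Real.rpow_one x
  have hyx : y ≤ x := by linarith
  have h2 : (16 : ℝ) ≤ x ^ (δ / 4) := by
    calc (16 : ℝ) = ((16 : ℝ) ^ (4 / δ)) ^ (δ / 4) := by
          rw [← Real.rpow_mul (by norm_num), show 4 / δ * (δ / 4) = 1 by field_simp, Real.rpow_one]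
      _ ≤ x ^ (δ / 4) := Real.rpow_le_rpow (by positivity) (hy.trans hyx) (by linarith)
  refine ⟨hyx, h2, ?_⟩
  calc 16 * z ≤ x ^ (δ / 4) * x ^ (1 - δ / 2) :=
        mul_le_mul h2 hz (by linarith) (Real.rpow_nonneg hx.le _)
    _ = x ^ (1 - δ / 4) := by rw [← Real.rpow_add hx]; congr 1; ring
    _ ≤ x ^ (1 : ℝ) := Real.rpow_le_rpow_of_exponent_le hx1 (by linarith)
    _ = x := Real.rpow_one x

/-- For negative `x`, `x ^ (1 - δ / 2)` is negative. -/
lemma pos_of_pos_rpow {δ x : ℝ} (hδ0 : 0 < δ) (hδ1 : δ < 1) (h : 0 < x ^ (1 - δ / 2)) : 0 < x := by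
  by_contra! hx
  rcases hx.eq_or_lt with rfl | hx
  · rw [Real.zero_rpow (by linarith)] at h
    exact lt_irrefl _ h
  · rw [Real.rpow_def_of_neg hx] at h
    have h1 : cos ((1 - δ / 2) * π) < 0 :=
      Real.cos_neg_of_pi_div_two_lt_of_lt (by nlinarith [Real.pi_pos]) (by nlinarith [Real.pi_pos])
    have := mul_neg_of_pos_of_neg (exp_pos (log x * (1 - δ / 2))) h1
    linarith

namespace GoodPoly
variable {F : Polynomial ℤ} {D₀ : ℕ} (H : GoodPoly F D₀)
include H

/-- Integers at which `F` has a divisor that is a multiple of a product of `m` large primes of `P`. -/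
lemma exists_mul_pow_le : ∃ x₀ : ℝ, 1 < x₀ ∧ ∀ x ≥ x₀, ∀ σ > 0, ∀ (P : Finset ℕ) (m : ℕ) (L : ℝ) (Y : Finset ℕ),
    (∀ p ∈ P, p.Prime ∧ D₀ < p ∧ x ^ σ ≤ (p : ℝ) ∧ ∃ μ : ℤ, (p : ℤ) ∣ F.eval μ) →
    (∀ f ∈ Fintype.piFinset fun _ : Fin m => P, ∀ ν : ℤ, ((∏ i, f i : ℕ) : ℤ) ∣ F.eval ν → ∃ S : Finset ℕ, S ⊆ Y ∧
      (∀ n ∈ S, n ∈ upperHalf x ∧ ((∏ i, f i : ℕ) : ℤ) ∣ n - ν) ∧ L / ((∏ i, f i : ℕ) : ℝ) ≤ S.card) →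
    L * (∑ p ∈ P, (1 : ℝ) / p) ^ m ≤ ((F.natDegree + 1) / σ) ^ m * Y.card := by
  obtain ⟨x₀, hx₀, h⟩ := H.exists_card_prime_dvd_le
  refine ⟨x₀, hx₀, fun x hx σ hσ P m L Y hP hS => ?_⟩
  have hex : ∀ f : Fin m → ℕ, ∃ S : Finset ℕ, f ∈ (Fintype.piFinset fun _ : Fin m => P) → S ⊆ Y ∧
      (∀ n ∈ S, n ∈ upperHalf x ∧ ((∏ i, f i : ℕ) : ℤ) ∣ F.eval (n : ℤ)) ∧ L / ((∏ i, f i : ℕ) : ℝ) ≤ S.card := by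
    intro f
    by_cases hf : f ∈ Fintype.piFinset fun _ : Fin m => P
    · obtain ⟨ν, hν⟩ := H.exists_root_prod m f fun i =>
        have := hP _ (Fintype.mem_piFinset.mp hf i)
        ⟨this.1, this.2.1, this.2.2.2⟩
      obtain ⟨S, hS1, hS2, hS3⟩ := hS f hf ν hν
      refine ⟨S, fun _ => ⟨hS1, fun n hn => ⟨(hS2 n hn).1, dvd_eval_of_dvd_sub F ?_ hν⟩, hS3⟩⟩
      rw [← neg_sub, dvd_neg]
      exact (hS2 n hn).2
    · exact ⟨∅, fun h => absurd h hf⟩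
  choose S hS using hex
  have h1 := sum_card_le_of_prod_dvd F P Y S (B := (F.natDegree + 1) / σ) (fun f hf => (hS f hf).1)
    (fun f hf n hn => ((hS f hf).2.1 n hn).2)
    (fun f hf n hn => h x hx σ hσ P (fun p hp => ⟨(hP p hp).1, (hP p hp).2.2.1⟩) n ((hS f hf).2.1 n hn).1)
    (by positivity)
  refine le_trans ?_ h1
  rw [← sum_piFinset_inv_prod, Finset.mul_sum]
  refine Finset.sum_le_sum fun f hf => ?_
  rw [mul_one_div]
  exact (hS f hf).2.2

/-- A positive proportion of integers `n` have a divisor of `F n` in `(y, z]`, if `z` exceeds a power of `y`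
with exponent greater than one. -/
lemma exists_card_ge_of_rpow_le (hD : 2 ≤ D₀) {δ κ : ℝ} (hδ0 : 0 < δ) (hδ1 : δ < 1) (hκ : 0 < κ) (hκ1 : κ ≤ 1) :
    ∃ c > 0, ∃ y₀ : ℝ, 2 ≤ y₀ ∧ ∀ x y z : ℝ, 0 < x → y₀ ≤ y → y ^ (1 + κ) ≤ z → z ≤ x ^ (1 - δ / 2) → ∀ Y : Finset ℕ,
      (∀ n ∈ upperHalf x, ∀ d : ℕ, 0 < d → (d : ℤ) ∣ F.eval (n : ℤ) → y < d → (d : ℝ) ≤ z → n ∈ Y) →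
      c * x ≤ Y.card := by
  obtain ⟨k, c, s₁, Y₀, hc, hs₁, hY₀, hp⟩ := H.exists_primes hD hκ hκ1
  obtain ⟨x₀, hx₀, hlarge⟩ := H.exists_mul_pow_le
  obtain ⟨B, hB⟩ : ∃ B : ℝ, B = (F.natDegree + 1) / (s₁ / 4) := ⟨_, rfl⟩
  have hB0 : 0 ≤ B := by rw [hB]; positivity
  have hmax : 0 < max B 1 := lt_of_lt_of_le one_pos (le_max_right _ _)
  have hmin : 0 < min c 1 := lt_min hc one_pos
  refine ⟨min ((c / (k + c)) ^ k / 48) ((min c 1) ^ k / (max B 1) ^ k / 4), by positivity,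
    max (max Y₀ x₀) ((16 : ℝ) ^ (4 / δ)), le_max_of_le_left (le_max_of_le_left hY₀), ?_⟩
  intro x y z hx hy hyz hz Y hY
  have hyY : Y₀ ≤ y := (le_max_left _ _).trans ((le_max_left _ _).trans hy)
  have hyx₀ : x₀ ≤ y := (le_max_right _ _).trans ((le_max_left _ _).trans hy)
  have hy1 : 1 < y := by linarith
  have hyz' : y < z := by
    calc y = y ^ (1 : ℝ) := (Real.rpow_one y).symm
      _ < y ^ (1 + κ) := Real.rpow_lt_rpow_of_exponent_lt hy1 (by linarith)
      _ ≤ z := hyz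
  obtain ⟨hyx, h16, hzx⟩ := le_of_le_rpow hδ0 hδ1 hx hy1.le ((le_max_right _ _).trans hy) hyz' hz
  obtain ⟨P, m, t, hm0, hmk, -, hP, hcS, hf⟩ := hp y hyY
  have hdiv : ∀ f ∈ Fintype.piFinset fun _ : Fin m => P, 0 < (∏ i, f i) ∧ y < ((∏ i, f i : ℕ) : ℝ) ∧
      ((∏ i, f i : ℕ) : ℝ) ≤ z ∧ ((∏ i, f i : ℕ) : ℝ) ≤ y ^ (1 + κ) := fun f hf' => by
    have h1 := hf f fun i => Fintype.mem_piFinset.mp hf' i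
    exact ⟨Finset.prod_pos fun i _ => (hP _ (Fintype.mem_piFinset.mp hf' i)).1.pos, h1.1, h1.2.trans hyz, h1.2⟩
  rcases le_or_gt (y ^ 4) x with hcase | hcase
  · have h1 := H.card_ge_of_mul_le P (m := m) hx (fun p hp => ⟨(hP p hp).1, (hP p hp).2.1, (hP p hp).2.2.2.2.2⟩)
      (hc.trans_le hcS) (fun f hf => by
        obtain ⟨h0, h1, h2, h3⟩ := hdiv f hf
        refine ⟨by linarith, le_trans ?_ hcase⟩
        have h4 : y ^ (1 + κ) ≤ y ^ (2 : ℝ) := Real.rpow_le_rpow_of_exponent_le hy1.le (by linarith)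
        rw [Real.rpow_two] at h4
        calc ((∏ i, f i : ℕ) : ℝ) ^ 2 ≤ (y ^ 2) ^ 2 := pow_le_pow_left₀ (Nat.cast_nonneg _) (h3.trans h4) 2
          _ = y ^ 4 := by ring)
      Y (fun f hf n hn hd => hY n hn _ (hdiv f hf).1 hd (hdiv f hf).2.1 (hdiv f hf).2.2.1)
    have h2 := pow_le_mul_of_pow_add_le hmk hc hcS hx.le h1
    calc _ ≤ (c / (k + c)) ^ k / 48 * x := mul_le_mul_of_nonneg_right (min_le_left _ _) hx.le
      _ ≤ _ := by linarith
  · have h1 := hlarge x (hyx₀.trans hyx) (s₁ / 4) (by linarith) P m (x / 4) Y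
      (fun p hp => ⟨(hP p hp).1, (hP p hp).2.1, le_trans (by
        calc x ^ (s₁ / 4) ≤ (y ^ 4) ^ (s₁ / 4) := Real.rpow_le_rpow hx.le hcase.le (by linarith)
          _ = y ^ s₁ := by
            rw [← Real.rpow_natCast, ← Real.rpow_mul (by linarith)]
            congr 1; push_cast; ring) (hP p hp).2.2.1, (hP p hp).2.2.2.2.2⟩)
      (fun f hf ν hν => by
        obtain ⟨h0, h1, h2, h3⟩ := hdiv f hf
        refine ⟨(upperHalf x).filter fun n : ℕ => ((∏ i, f i : ℕ) : ℤ) ∣ n - ν, fun n hn => ?_,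
          fun n hn => Finset.mem_filter.mp hn, ?_⟩
        · rw [Finset.mem_filter] at hn
          refine hY n hn.1 _ h0 (dvd_eval_of_dvd_sub F ?_ hν) h1 h2
          rw [← neg_sub, dvd_neg]
          exact hn.2
        · refine le_trans ?_ (card_upperHalf_filter hx.le h0 ν).1
          have hb0 : (0 : ℝ) < ((∏ i, f i : ℕ) : ℝ) := by exact_mod_cast h0
          generalize ((∏ i, f i : ℕ) : ℝ) = b at *
          have h8 : 2 ≤ x / (4 * b) := by rw [le_div_iff₀ (by positivity)]; linarith
          have e1 : x / (2 * b) = 2 * (x / (4 * b)) := by field_simp; ring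
          have e2 : x / 4 / b = x / (4 * b) := by field_simp
          linarith)
    rw [← hB] at h1
    have h2 := mul_le_of_mul_pow_le hmk hc hcS (by linarith) hB0 (Nat.cast_nonneg _) h1
    calc _ ≤ (min c 1) ^ k / (max B 1) ^ k / 4 * x := mul_le_mul_of_nonneg_right (min_le_right _ _) hx.le
      _ ≤ _ := by linarith

end GoodPoly

lemma log_rpow_neg_ge {u y ε r C : ℝ} (hy : 1 < y) (hu : y ^ ε ≤ u) (hr : 0 ≤ r) (h : log y ^ C ≤ y ^ (ε * r)) :
    u ^ (-r) ≤ log y ^ (-C) := by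
  have hy0 : 0 < y := by linarith
  have h1 : 0 < y ^ ε := Real.rpow_pos_of_pos hy0 _
  rw [Real.rpow_neg (h1.le.trans hu), Real.rpow_neg (Real.log_pos hy).le]
  refine inv_anti₀ (Real.rpow_pos_of_pos (Real.log_pos hy) _) (h.trans ?_)
  rw [Real.rpow_mul hy0.le]
  exact Real.rpow_le_rpow h1.le hu hr

lemma primeFactors_prod_subset {m : ℕ} {P : Finset ℕ} (hP : ∀ p ∈ P, p.Prime) {f : Fin m → ℕ}
    (hf : ∀ i, f i ∈ P) : (∏ i, f i).primeFactors ⊆ Finset.univ.image f := by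
  intro p hp
  obtain ⟨i, -, hi⟩ := ((Nat.prime_of_mem_primeFactors hp).prime.dvd_finsetProd_iff f).mp
    (Nat.dvd_of_mem_primeFactors hp)
  rw [(Nat.prime_dvd_prime_iff_eq (Nat.prime_of_mem_primeFactors hp) (hP _ (hf i))).mp hi]
  exact Finset.mem_image_of_mem f (Finset.mem_univ i)

lemma sixteen_mul_sq_div_le {δ x y z b : ℝ} (hδ0 : 0 < δ) (hδ1 : δ < 1) (hy1 : 1 ≤ y) (hyx : y ≤ x)
    (h16 : 16 ≤ x ^ (δ / 4)) (hyz : y < z) (hz : z ≤ x ^ (1 - δ / 2)) (hb : y ^ (1 - 2 * (δ / 8)) < b) :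
    16 * b * (y / b) ^ 2 ≤ x := by
  have hy0 : 0 < y := by linarith
  have hx0 : 0 < x := by linarith
  have hb1 : 0 < y ^ (1 - 2 * (δ / 8)) := Real.rpow_pos_of_pos hy0 _
  have hb0 : 0 < b := hb1.trans hb
  have e1 : 16 * b * (y / b) ^ 2 = 16 * (y ^ 2 / b) := by field_simp
  have h2 : y ^ 2 / b ≤ y ^ (1 + δ / 4) := by
    rw [div_le_iff₀ hb0]
    calc y ^ 2 = y ^ (1 + δ / 4) * y ^ (1 - 2 * (δ / 8)) := by
          rw [← Real.rpow_add hy0, ← Real.rpow_two]; congr 1; ring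
      _ ≤ _ := mul_le_mul_of_nonneg_left hb.le (Real.rpow_nonneg hy0.le _)
  have h3 : y ^ (1 + δ / 4) ≤ x ^ (1 - δ / 4) := by
    calc y ^ (1 + δ / 4) ≤ (x ^ (1 - δ / 2)) ^ (1 + δ / 4) :=
          Real.rpow_le_rpow hy0.le (by linarith) (by linarith)
      _ = x ^ ((1 - δ / 2) * (1 + δ / 4)) := by rw [← Real.rpow_mul hx0.le]
      _ ≤ x ^ (1 - δ / 4) := Real.rpow_le_rpow_of_exponent_le (by linarith) (by nlinarith)
  rw [e1]
  calc 16 * (y ^ 2 / b) ≤ x ^ (δ / 4) * x ^ (1 - δ / 4) :=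
        mul_le_mul h16 (h2.trans h3) (by positivity) (Real.rpow_nonneg hx0.le _)
    _ = x := by rw [← Real.rpow_add hx0, show δ / 4 + (1 - δ / 4) = 1 by ring, Real.rpow_one]

namespace GoodPoly
variable {F : Polynomial ℤ} {D₀ : ℕ} (H : GoodPoly F D₀)
include H

lemma exists_card_slab_ge_of_log (k : ℕ) (C : ℝ) {K ε : ℝ} (hK : 0 < K) (hε : 0 < ε) :
    ∃ c > 0, ∃ y₀ : ℝ, 2 ≤ y₀ ∧ ∃ P₀ : ℕ, ∀ y u η x : ℝ, y₀ ≤ y → y ^ ε ≤ u → u ≤ y → log y ^ (-C) ≤ η →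
      η * log y ≤ K → ∀ b : ℕ, 0 < b → b.primeFactors.card ≤ k → (∀ p ∈ b.primeFactors, P₀ ≤ p) → ∀ ν : ℤ,
      16 * b * u ^ 2 ≤ x → ∀ Y : Finset ℕ, (∀ n ∈ upperHalf x, (b : ℤ) ∣ n - ν →
        (∃ a : ℕ, u < a ∧ (a : ℝ) ≤ u * exp η ∧ a.Coprime b ∧ (a : ℤ) ∣ F.eval (n : ℤ)) → n ∈ Y) →
      c * η * x / b ≤ Y.card := by
  obtain ⟨c, hc, u₀, hu₀, P₀, h⟩ := H.exists_card_slab_ge k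
  have hg : (0 : ℝ) < F.natDegree := by have := H.two_le; exact_mod_cast (by omega : 0 < F.natDegree)
  obtain ⟨r, hr⟩ : ∃ r : ℝ, r = 1 / (10 * F.natDegree) := ⟨_, rfl⟩
  have hr0 : 0 < r := by rw [hr]; positivity
  have ev1 : ∀ᶠ y : ℝ in Filter.atTop, log y ^ C ≤ y ^ (ε * r) := by
    filter_upwards [(isLittleO_log_rpow_rpow_atTop C (mul_pos hε hr0)).bound one_pos, Filter.eventually_gt_atTop 1]
      with y hy hy1
    have h1 : 0 ≤ log y ^ C := Real.rpow_nonneg (Real.log_pos hy1).le _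
    have h2 : 0 ≤ y ^ (ε * r) := Real.rpow_nonneg (by linarith) _
    rwa [one_mul, Real.norm_of_nonneg h1, Real.norm_of_nonneg h2] at hy
  have ev2 : ∀ᶠ y : ℝ in Filter.atTop, u₀ ≤ y ^ ε := (tendsto_rpow_atTop hε).eventually_ge_atTop u₀
  have ev3 : ∀ᶠ y : ℝ in Filter.atTop, 2 * K ≤ log y := Real.tendsto_log_atTop.eventually_ge_atTop _
  obtain ⟨y₀, hy₀⟩ := Filter.eventually_atTop.mp (ev1.and (ev2.and ev3))
  refine ⟨c / (1 + K), by positivity, max y₀ 2, le_max_right _ _, P₀, ?_⟩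
  intro y u η x hy hyu huy hη hηK b hb hbk hbP ν hx Y hY
  obtain ⟨e1, e2, e3⟩ := hy₀ y ((le_max_left _ _).trans hy)
  have hy2 : 2 ≤ y := (le_max_right _ _).trans hy
  have hu0 : u₀ ≤ u := e2.trans hyu
  have hlog : 0 < log y := Real.log_pos (by linarith)
  have hη0 : 0 < η := (Real.rpow_pos_of_pos hlog _).trans_le hη
  have hη1 : η ≤ 1 / 2 := by nlinarith
  have hlu : log u ≤ log y := Real.log_le_log (by linarith) huy
  have hlu0 : 0 ≤ log u := Real.log_nonneg (by linarith)
  have h1 := h u hu0 η (by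
    rw [← hr]
    exact (log_rpow_neg_ge (by linarith) hyu hr0.le e1).trans hη) hη1 b hb hbk hbP ν x hx Y hY
  refine le_trans ?_ h1
  have hx0 : 0 ≤ x := le_trans (by positivity) hx
  have hu1 : 0 ≤ η * log u := mul_nonneg hη0.le hlu0
  have h2 : η * log u ≤ K := (mul_le_mul_of_nonneg_left hlu hη0.le).trans hηK
  have h3 : η / (1 + K) ≤ η / (1 + η * log u) := div_le_div_of_nonneg_left hη0.le (by linarith) (by linarith)
  calc c / (1 + K) * η * x / b = c * (η / (1 + K)) * (x / b) := by field_simp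
    _ ≤ _ := mul_le_mul_of_nonneg_right (mul_le_mul_of_nonneg_left h3 hc.le) (by positivity)

/-- The number of integers `n` such that `F n` has a divisor in the short interval `(y, z]`. -/
lemma exists_card_ge_of_log_mul_le (hD : 2 ≤ D₀) (C : ℝ) {δ K : ℝ} (hδ0 : 0 < δ) (hδ1 : δ < 1) (hK : 0 < K) :
    ∃ c > 0, ∃ y₀ : ℝ, 2 ≤ y₀ ∧ ∀ x y z : ℝ, 0 < x → y₀ ≤ y → y < z → z ≤ x ^ (1 - δ / 2) →
      log y ^ (-C) ≤ log (z / y) → log (z / y) * log y ≤ K → ∀ Y : Finset ℕ,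
      (∀ n ∈ upperHalf x, ∀ d : ℕ, 0 < d → (d : ℤ) ∣ F.eval (n : ℤ) → y < d → (d : ℝ) ≤ z → n ∈ Y) →
      c * log (z / y) * x ≤ Y.card := by
  obtain ⟨ε, hε⟩ : ∃ ε : ℝ, ε = δ / 8 := ⟨_, rfl⟩
  have hε0 : 0 < ε := by rw [hε]; positivity
  have hε1 : ε < 1 / 8 := by rw [hε]; linarith
  obtain ⟨k, c, s₁, Y₀, hc, hs₁, hY₀, hp⟩ := H.exists_primes hD hε0 (by linarith)
  obtain ⟨x₀, hx₀, hlarge⟩ := H.exists_mul_pow_le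
  obtain ⟨c', hc', y₁, hy₁, P₀, hslab⟩ := H.exists_card_slab_ge_of_log k C hK hε0
  obtain ⟨σ, hσ⟩ : ∃ σ : ℝ, σ = (1 - 2 * ε) * s₁ := ⟨_, rfl⟩
  have hσ0 : 0 < σ := by rw [hσ]; exact mul_pos (by linarith) hs₁
  obtain ⟨B, hB⟩ : ∃ B : ℝ, B = (F.natDegree + 1) / (σ / 4) := ⟨_, rfl⟩
  have hB0 : 0 ≤ B := by rw [hB]; positivity
  have hmax : 0 < max B 1 := lt_of_lt_of_le one_pos (le_max_right _ _)
  have hmin : 0 < min c 1 := lt_min hc one_pos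
  have ev1 : ∀ᶠ y : ℝ in Filter.atTop, Y₀ ≤ y ^ (1 - 2 * ε) :=
    (tendsto_rpow_atTop (by linarith)).eventually_ge_atTop _
  have ev2 : ∀ᶠ y : ℝ in Filter.atTop, (P₀ : ℝ) ≤ y ^ σ := (tendsto_rpow_atTop hσ0).eventually_ge_atTop _
  obtain ⟨y₀, hy₀⟩ := Filter.eventually_atTop.mp (ev1.and (ev2.and ((Filter.eventually_ge_atTop x₀).and
    ((Filter.eventually_ge_atTop y₁).and ((Filter.eventually_ge_atTop ((16 : ℝ) ^ (4 / δ))).and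
      (Filter.eventually_ge_atTop 16))))))
  refine ⟨min c' ((min c 1) ^ k / (max B 1) ^ k * c'), by positivity, max y₀ 2, le_max_right _ _, ?_⟩
  intro x y z hx hy hyz hz hη hηK Y hY
  obtain ⟨e1, e2, e3, e4, e5, e6⟩ := hy₀ y ((le_max_left _ _).trans hy)
  have hy0 : 0 < y := by linarith
  have hy1 : 1 ≤ y := by linarith
  obtain ⟨hyx, h16, hzx⟩ := le_of_le_rpow hδ0 hδ1 hx hy1 e5 hyz hz
  have hexp : exp (log (z / y)) = z / y := Real.exp_log (by have : 0 < z := by linarith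
                                                            positivity)
  have hη0 : 0 < log (z / y) := Real.log_pos ((one_lt_div hy0).mpr hyz)
  obtain ⟨η, hηdef⟩ : ∃ η, η = log (z / y) := ⟨_, rfl⟩
  rw [← hηdef] at hη hηK hexp hη0 ⊢
  rcases le_or_gt (y ^ 4) x with hcase | hcase
  · have h1 := hslab y y η x e4 (by
        calc y ^ ε ≤ y ^ (1 : ℝ) := Real.rpow_le_rpow_of_exponent_le hy1 (by linarith)
          _ = y := Real.rpow_one y) le_rfl hη hηK 1 one_pos (by simp) (by simp) 0 (by
        refine le_trans ?_ hcase
        push_cast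
        nlinarith [sq_nonneg (y ^ 2 - 16), mul_pos hy0 hy0]) Y (by
        rintro n hn - ⟨a, ha1, ha2, -, ha3⟩
        refine hY n hn a ?_ ha3 ha1 ?_
        · exact_mod_cast hy0.trans ha1
        · rw [hexp] at ha2
          refine ha2.trans (le_of_eq ?_)
          field_simp)
    rw [Nat.cast_one, div_one] at h1
    refine le_trans ?_ h1
    exact mul_le_mul_of_nonneg_right (mul_le_mul_of_nonneg_right (min_le_left _ _) hη0.le) hx.le
  · obtain ⟨P, m, t, hm0, hmk, -, hP, hcS, hf⟩ := hp (y ^ (1 - 2 * ε)) e1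
    have hpow : (y ^ (1 - 2 * ε)) ^ s₁ = y ^ σ := by rw [← Real.rpow_mul hy0.le, hσ]
    have hdiv : ∀ f ∈ Fintype.piFinset fun _ : Fin m => P, 0 < (∏ i, f i) ∧
        y ^ (1 - 2 * ε) < ((∏ i, f i : ℕ) : ℝ) ∧ ((∏ i, f i : ℕ) : ℝ) ≤ y ^ (1 - ε) ∧
        (∏ i, f i).primeFactors.card ≤ k ∧ ∀ p ∈ (∏ i, f i).primeFactors, P₀ ≤ p := fun f hf' => by
      have hfP : ∀ i, f i ∈ P := fun i => Fintype.mem_piFinset.mp hf' i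
      have h1 := hf f hfP
      have hsub := primeFactors_prod_subset (fun p hp => (hP p hp).1) hfP
      refine ⟨Finset.prod_pos fun i _ => (hP _ (hfP i)).1.pos, h1.1, h1.2.trans ?_, ?_, fun p hp => ?_⟩
      · rw [← Real.rpow_mul hy0.le]
        exact Real.rpow_le_rpow_of_exponent_le hy1 (by nlinarith)
      · refine (Finset.card_le_card hsub).trans (Finset.card_image_le.trans ?_)
        simpa using hmk
      · obtain ⟨i, -, rfl⟩ := Finset.mem_image.mp (hsub hp)
        have h3 := (hP _ (hfP i)).2.2.1
        rw [hpow] at h3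
        exact_mod_cast e2.trans h3
    have h1 := hlarge x (e3.trans hyx) (σ / 4) (by linarith) P m (c' * η * x) Y
      (fun p hp => ⟨(hP p hp).1, (hP p hp).2.1, le_trans (by
        calc x ^ (σ / 4) ≤ (y ^ 4) ^ (σ / 4) := Real.rpow_le_rpow hx.le hcase.le (by linarith)
          _ = y ^ σ := by
            rw [← Real.rpow_natCast, ← Real.rpow_mul (by linarith)]
            congr 1; push_cast; ring
          _ = _ := hpow.symm) (hP p hp).2.2.1, (hP p hp).2.2.2.2.2⟩)
      (fun f hf ν hν => by
        obtain ⟨h0, h1, h2, h3, h4⟩ := hdiv f hf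
        generalize (∏ i, f i) = b at *
        have hb0 : (0 : ℝ) < b := by exact_mod_cast h0
        obtain ⟨S, hS⟩ : ∃ S : Finset ℕ, ∀ n, n ∈ S ↔ n ∈ upperHalf x ∧ ((b : ℤ) ∣ n - ν ∧
            ∃ a : ℕ, y / b < a ∧ (a : ℝ) ≤ y / b * exp η ∧ a.Coprime b ∧ (a : ℤ) ∣ F.eval (n : ℤ)) :=
          ⟨(upperHalf x).filter _, fun n => Finset.mem_filter⟩
        refine ⟨S, fun n hn => ?_, fun n hn => ⟨((hS n).mp hn).1, ((hS n).mp hn).2.1⟩, ?_⟩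
        · obtain ⟨hn1, hn2, a, ha1, ha2, ha3, ha4⟩ := (hS n).mp hn
          have ha0 : 0 < a := by exact_mod_cast (div_pos hy0 hb0).trans ha1
          refine hY n hn1 (a * b) (Nat.mul_pos ha0 h0) ?_ ?_ ?_
          · push_cast
            refine (Nat.isCoprime_iff_coprime.mpr ha3).mul_dvd ha4 (dvd_eval_of_dvd_sub F ?_ hν)
            rw [← neg_sub, dvd_neg]
            exact hn2
          · rw [div_lt_iff₀ hb0] at ha1
            exact_mod_cast ha1
          · rw [hexp] at ha2
            push_cast
            calc (a : ℝ) * b ≤ y / b * (z / y) * b := mul_le_mul_of_nonneg_right ha2 hb0.le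
              _ = z := by field_simp
        · refine hslab y (y / b) η x e4 ?_ ?_ hη hηK b h0 h3 h4 ν ?_ S fun n hn h5 h6 => (hS n).mpr ⟨hn, h5, h6⟩
          · rw [le_div_iff₀ hb0]
            calc y ^ ε * b ≤ y ^ ε * y ^ (1 - ε) := mul_le_mul_of_nonneg_left h2 (Real.rpow_nonneg hy0.le _)
              _ = y := by rw [← Real.rpow_add hy0, show ε + (1 - ε) = 1 by ring, Real.rpow_one]
          · exact div_le_self hy0.le (by exact_mod_cast h0)
          · rw [hε] at h1
            exact sixteen_mul_sq_div_le hδ0 hδ1 hy1 hyx h16 hyz hz h1)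
    rw [← hB] at h1
    have hL : 0 ≤ c' * η * x := mul_nonneg (mul_nonneg hc'.le hη0.le) hx.le
    have h2 := mul_le_of_mul_pow_le hmk hc hcS hL hB0 (Nat.cast_nonneg _) h1
    calc _ ≤ (min c 1) ^ k / (max B 1) ^ k * c' * η * x :=
          mul_le_mul_of_nonneg_right (mul_le_mul_of_nonneg_right (min_le_right _ _) hη0.le) hx.le
      _ = (min c 1) ^ k / (max B 1) ^ k * (c' * η * x) := by ring
      _ ≤ _ := h2

end GoodPoly

lemma tsum_Psf_eq (s t : ℝ) (f : ℕ → ℝ) : ∑' a : (Psf s t), f a = ∑ a ∈ psfFin s t, f a := by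
  have h : Psf s t = (psfFin s t : Set ℕ) := by
    ext a
    rw [Finset.mem_coe, mem_psfFin]
    rfl
  rw [h]
  exact Finset.tsum_subtype (psfFin s t) f

lemma large_bound {c η ly x S K cA N : ℝ} (hη : 0 < η) (hηy : η ≤ ly) (hly : 1 ≤ ly) (hx : 0 < x) (hc : 0 ≤ c)
    (hS : S ≤ K) (hK : 0 < K) (hcA : c ≤ cA / (2 * K)) (hN : cA * x ≤ N) :
    c * η * (1 + η) * (x / ly ^ 2) * S ≤ N := by
  have h1 : η * (1 + η) / ly ^ 2 ≤ 2 := by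
    rw [div_le_iff₀ (by positivity)]
    nlinarith
  rw [le_div_iff₀ (by positivity)] at hcA
  calc c * η * (1 + η) * (x / ly ^ 2) * S ≤ c * η * (1 + η) * (x / ly ^ 2) * K :=
        mul_le_mul_of_nonneg_left hS (by positivity)
    _ = (c * x * K) * (η * (1 + η) / ly ^ 2) := by ring
    _ ≤ (c * x * K) * 2 := mul_le_mul_of_nonneg_left h1 (by positivity)
    _ = c * (2 * K) * x := by ring
    _ ≤ cA * x := mul_le_mul_of_nonneg_right hcA hx.le
    _ ≤ N := hN

lemma small_bound {c η ly x S K M cB N : ℝ} (hη : 0 < η) (hηM : η ≤ M) (hly : 0 < ly) (hx : 0 < x) (hc : 0 ≤ c)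
    (hS : S ≤ K * ly ^ 2) (hK : 0 < K) (hcB : c ≤ cB / (K * (1 + M))) (hN : cB * η * x ≤ N) :
    c * η * (1 + η) * (x / ly ^ 2) * S ≤ N := by
  have hM : 0 < M := hη.trans_le hηM
  rw [le_div_iff₀ (by positivity)] at hcB
  calc c * η * (1 + η) * (x / ly ^ 2) * S ≤ c * η * (1 + η) * (x / ly ^ 2) * (K * ly ^ 2) :=
        mul_le_mul_of_nonneg_left hS (by positivity)
    _ = c * η * x * K * (1 + η) := by field_simp
    _ ≤ c * η * x * K * (1 + M) := mul_le_mul_of_nonneg_left (by linarith) (by positivity)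
    _ = c * (K * (1 + M)) * (η * x) := by ring
    _ ≤ cB * (η * x) := mul_le_mul_of_nonneg_right hcB (by positivity)
    _ ≤ N := by linarith

theorem stmt7 (F : Polynomial ℤ) (hF : Irreducible F) (hdeg : 2 ≤ F.natDegree)
    (δ C : ℝ) (hδ0 : 0 < δ) (hδ1 : δ < 1) (hC : 0 < C) :
    ∃ D y₀ c : ℝ, 2 ≤ D ∧ 0 < c ∧
      ∀ x y z : ℝ, y₀ ≤ y → y < z → z ≤ x ^ (1 - δ / 2) →
        (Real.log y) ^ (-C) ≤ Real.log (z / y) → Real.log (z / y) ≤ Real.log y →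
        c * Real.log (z / y) * (1 + Real.log (z / y)) * (x / (Real.log y) ^ 2) *
            ∑' a : (Psf (max D (z / y)) z),
              (2 * ((a : ℕ).divisors.card : ℝ) - (Wfun a (Real.log (z / y)) : ℝ)) *
                (polyRho F a : ℝ) / (a : ℝ) ≤
          (polyH F x y z : ℝ) - (polyH F (x / 2) y z : ℝ) := by
  obtain ⟨D₀, hD, H⟩ := exists_goodPoly hF hdeg
  obtain ⟨K, hK, hsum⟩ := H.exists_sum_tau_sub_W hD
  have hD2 : (2 : ℝ) ≤ D₀ := by exact_mod_cast hD
  obtain ⟨ℓ, hℓ⟩ : ∃ ℓ, ℓ = log (D₀ : ℝ) := ⟨_, rfl⟩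
  have hℓ0 : 0 < ℓ := by rw [hℓ]; exact Real.log_pos (by linarith)
  obtain ⟨κ, hκ⟩ : ∃ κ, κ = min (1 / K) 1 := ⟨_, rfl⟩
  have hκ0 : 0 < κ := by rw [hκ]; exact lt_min (by positivity) one_pos
  have hκK : κ * K ≤ 1 := by rw [← le_div_iff₀ hK, hκ]; exact min_le_left _ _
  obtain ⟨cA, hcA, yA, hyA, hA⟩ := H.exists_card_ge_of_rpow_le hD hδ0 hδ1 hκ0 (by rw [hκ]; exact min_le_right _ _)
  obtain ⟨M, hM⟩ : ∃ M, M = K * ℓ ^ 2 := ⟨_, rfl⟩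
  have hM0 : 0 < M := by rw [hM]; positivity
  obtain ⟨cB, hcB, yB, hyB, hB⟩ := H.exists_card_ge_of_log_mul_le hD C hδ0 hδ1 hM0
  obtain ⟨c, hc⟩ : ∃ c, c = min (cA / (2 * (K * K ^ 2))) (cB / (4 * K / ℓ ^ 2 * (1 + M))) := ⟨_, rfl⟩
  have hc0 : 0 < c := by rw [hc]; exact lt_min (by positivity) (by positivity)
  have hc1 : c ≤ cA / (2 * (K * K ^ 2)) := by rw [hc]; exact min_le_left _ _
  have hc2 : c ≤ cB / (4 * K / ℓ ^ 2 * (1 + M)) := by rw [hc]; exact min_le_right _ _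
  refine ⟨D₀, max (max yA yB) (max D₀ (exp 1)), c, hD2, hc0, ?_⟩
  intro x y z hy hyz hz hη hηy
  have hy1 : yA ≤ y := (le_max_left _ _).trans ((le_max_left _ _).trans hy)
  have hy2 : yB ≤ y := (le_max_right _ _).trans ((le_max_left _ _).trans hy)
  have hy3 : (D₀ : ℝ) ≤ y := (le_max_left _ _).trans ((le_max_right _ _).trans hy)
  have hy4 : exp 1 ≤ y := (le_max_right _ _).trans ((le_max_right _ _).trans hy)
  have hy0 : 0 < y := by linarith
  have hz0 : 0 < z := hy0.trans hyz
  have hx : 0 < x := pos_of_pos_rpow hδ0 hδ1 (hz0.trans_le hz)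
  have hly : 1 ≤ log y := (Real.le_log_iff_exp_le hy0).mpr hy4
  have hη0 : 0 < log (z / y) := Real.log_pos ((one_lt_div hy0).mpr hyz)
  have hlz : log z = log y + log (z / y) := by rw [Real.log_div hz0.ne' hy0.ne']; ring
  obtain ⟨Y, hY, hYc⟩ := exists_card_eq_polyH_sub F (y := y) (z := z) hx
  rw [← hYc, tsum_Psf_eq (max (D₀ : ℝ) (z / y)) z
    fun a => (2 * (a.divisors.card : ℝ) - (Wfun a (log (z / y)) : ℝ)) * (polyRho F a : ℝ) / (a : ℝ)]
  have hsz : max (D₀ : ℝ) (z / y) ≤ z := max_le (hy3.trans hyz.le) (div_le_self hz0.le (by linarith))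
  obtain ⟨h1, h2⟩ := hsum (max (D₀ : ℝ) (z / y)) z (log (z / y)) (le_max_left _ _) hsz hη0 (by linarith)
  have hA' := hA x y z hx hy1
  have hB' := hB x y z hx hy2 hyz hz hη
  have hexp : exp (log (z / y)) = z / y := Real.exp_log (div_pos hz0 hy0)
  generalize ∑ a ∈ psfFin (max (D₀ : ℝ) (z / y)) z,
    (2 * (a.divisors.card : ℝ) - (Wfun a (log (z / y)) : ℝ)) * (polyRho F a : ℝ) / (a : ℝ) = S at *
  rcases le_or_gt S 0 with hS | hS
  · refine le_trans (mul_nonpos_of_nonneg_of_nonpos ?_ hS) (Nat.cast_nonneg _)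
    positivity
  have h3 := h1 hS
  rcases le_or_gt (D₀ : ℝ) (z / y) with hcase | hcase
  · rw [max_eq_right hcase] at h2 h3
    generalize log (z / y) = η at *
    have h4 : log z ≤ K * η := by
      refine le_of_mul_le_mul_left ?_ hη0
      linarith
    refine large_bound hη0 hηy hly hx hc0.le (S := S) (K := K * K ^ 2) ?_ (by positivity) hc1 (hA' ?_ hz Y hY)
    · refine h2.trans (mul_le_mul_of_nonneg_left (pow_le_pow_left₀ ?_ ?_ 2) hK.le)
      · exact div_nonneg (by linarith) hη0.le
      · rwa [div_le_iff₀ hη0]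
    · have h5 : y ^ κ ≤ z / y := by
        rw [← hexp, Real.rpow_def_of_pos hy0, Real.exp_le_exp]
        nlinarith
      rw [Real.rpow_add hy0, Real.rpow_one]
      calc y * y ^ κ ≤ y * (z / y) := mul_le_mul_of_nonneg_left h5 hy0.le
        _ = z := by field_simp
  · rw [max_eq_left hcase.le, ← hℓ] at h2 h3
    generalize log (z / y) = η at *
    have h4 : η * log y ≤ M := by
      rw [hM]
      exact (mul_le_mul_of_nonneg_left (by linarith) hη0.le).trans h3
    refine small_bound hη0 ((le_mul_of_one_le_right hη0.le hly).trans h4) (one_pos.trans_le hly) hx hc0.le (S := S) (K := 4 * K / ℓ ^ 2) ?_ (by positivity)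
      hc2 (hB' h4 Y hY)
    refine h2.trans ?_
    rw [div_pow, div_mul_eq_mul_div, mul_div_assoc', div_le_div_iff_of_pos_right (by positivity)]
    have h5 : log z ^ 2 ≤ (2 * log y) ^ 2 := pow_le_pow_left₀ (by linarith) (by linarith) 2
    nlinarith
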